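/- There exists an absolute constant C > 0 such that for all integers k ≥ 2, d ≥ 1 and L ≥ 1, | E[P_d(L) − P_0(L)] − 2√(dL/k) | ≤ 2√(dL/k) · C · ( d^{−2/3} + (log L)·(dk/L)^{1/2} + d^{3/2}·k^{−1/2} + k^{1/2}·d^{3/2}·L^{3/2}·exp(−L^{1/2}·k^{−3/2}) ). -/

import Mathlib

/-- `u` is `d`-almost contained in `v`: one may remove at most `d` symbols from `u`
and obtain a subsequence of `v`. -/
def AlmostIn (d : ℕ) (u v : List ℕ) : Prop :=
  ∃ s : List ℕ, s.Sublist u ∧ u.length ≤ s.length + d ∧ s.Sublist v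

/-- The length-`m` prefix of an infinite word `w : ℕ → ℕ`. -/
def pre (w : ℕ → ℕ) (m : ℕ) : List ℕ :=
  (List.range m).map w

/-- `Pd d L w w'` is the random variable `P_d(L)`: the length of the longest prefix of the
infinite word `w` that is `d`-almost contained in the length-`L` prefix of `w'`. -/
noncomputable def Pd (d L : ℕ) (w w' : ℕ → ℕ) : ℕ :=
  sSup {m | AlmostIn d (pre w m) (pre w' L)}

/-- Expectation of `f(w, w')` for independent uniformly random infinite words `w, w'` over the
alphabet `[k] = {1, …, k}`, for a function `f` depending only on the first `N` symbols of `w`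
and the first `N'` symbols of `w'` (positions beyond the cutoffs are padded with the symbol
`1`, which such an `f` never reads). -/
noncomputable def EE (k N N' : ℕ) (f : (ℕ → ℕ) → (ℕ → ℕ) → ℝ) : ℝ :=
  (∑ u : Fin N → Fin k, ∑ v : Fin N' → Fin k,
      f (fun i => if h : i < N then (u ⟨i, h⟩ : ℕ) + 1 else 1)
        (fun i => if h : i < N' then (v ⟨i, h⟩ : ℕ) + 1 else 1)) /
    ((k : ℝ) ^ N * (k : ℝ) ^ N')

/-! ### The particle dynamics behind almost containment -/

/-- One step of the pushing dynamics: particle `j` attempts to move by `e j`, and must stay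
strictly ahead of particle `j - 1`. -/
def pushStep (x e : ℕ → ℕ) : ℕ → ℕ
  | 0 => x 0 + e 0
  | j + 1 => max (x (j + 1) + e (j + 1)) (pushStep x e j + 1)

/-- The history of the infinite word `v` up to time `n`, most recent letter first. -/
def hist {α : Type*} (v : ℕ → α) : ℕ → List α
  | 0 => []
  | n + 1 => v n :: hist v n

/-- Positions in `w` of the particles driven by a history of letters. -/
def pos {α : Type*} [DecidableEq α] (w : ℕ → α) : List α → ℕ → ℕ
  | [] => fun j => j
  | c :: l => pushStep (pos w l) (fun j => if w (pos w l j) = c then 1 else 0)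

theorem reverse_hist (w : ℕ → ℕ) (m : ℕ) : (hist w m).reverse = pre w m := by
  induction m with
  | zero => rfl
  | succ m ih => simp [hist, ih, pre, List.range_succ]

theorem length_hist {α : Type*} (w : ℕ → α) (m : ℕ) : (hist w m).length = m := by
  induction m with
  | zero => rfl
  | succ m ih => simp [hist, ih]

theorem almostIn_reverse (d : ℕ) (u v : List ℕ) :
    AlmostIn d u.reverse v.reverse ↔ AlmostIn d u v := by
  constructor
  · rintro ⟨s, h1, h2, h3⟩
    refine ⟨s.reverse, ?_, by simpa using h2, ?_⟩
    · simpa using h1.reverse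
    · simpa using h3.reverse
  · rintro ⟨s, h1, h2, h3⟩
    exact ⟨s.reverse, h1.reverse, by simpa using h2, h3.reverse⟩

theorem almostIn_nil (j : ℕ) (u : List ℕ) : AlmostIn j u [] ↔ u.length ≤ j := by
  constructor
  · rintro ⟨s, -, h2, h3⟩
    simp only [List.sublist_nil] at h3
    simpa [h3] using h2
  · intro h
    exact ⟨[], List.nil_sublist _, by simpa using h, List.Sublist.refl _⟩

theorem nil_almostIn (j : ℕ) (v : List ℕ) : AlmostIn j [] v :=
  ⟨[], List.Sublist.refl _, by simp, List.nil_sublist _⟩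

theorem almostIn_cons_cons (j a b : ℕ) (u v : List ℕ) :
    AlmostIn j (a :: u) (b :: v) ↔
      (∃ j', j = j' + 1 ∧ AlmostIn j' u (b :: v)) ∨ AlmostIn j (a :: u) v ∨
        (a = b ∧ AlmostIn j u v) := by
  constructor
  · rintro ⟨s, h1, h2, h3⟩
    rcases List.sublist_cons_iff.1 h1 with h | ⟨r, rfl, h⟩
    · left
      have := h.length_le
      simp only [List.length_cons] at h2
      obtain ⟨j', rfl⟩ : ∃ j', j = j' + 1 := ⟨j - 1, by omega⟩
      exact ⟨j', rfl, s, h, by omega, h3⟩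
    · right
      rcases List.sublist_cons_iff.1 h3 with h' | ⟨r', hr, h'⟩
      · exact Or.inl ⟨_, h1, h2, h'⟩
      · simp only [List.cons.injEq] at hr
        obtain ⟨rfl, rfl⟩ := hr
        exact Or.inr ⟨rfl, r, h, by simp only [List.length_cons] at h2; omega, h'⟩
  · rintro (⟨j', rfl, s, h1, h2, h3⟩ | ⟨s, h1, h2, h3⟩ | ⟨rfl, s, h1, h2, h3⟩)
    · exact ⟨s, h1.cons _, by simp only [List.length_cons]; omega, h3⟩
    · exact ⟨s, h1, h2, h3.cons _⟩
    · exact ⟨a :: s, h1.cons_cons _, by simp only [List.length_cons]; omega, h3.cons_cons _⟩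

theorem almostIn_hist_iff (w w' : ℕ → ℕ) (l j m : ℕ) :
    AlmostIn j (hist w m) (hist w' l) ↔ m ≤ pos w (hist w' l) j := by
  induction l generalizing j m with
  | zero => simp [hist, almostIn_nil, length_hist, pos]
  | succ l ihl =>
    induction j generalizing m with
    | zero =>
      cases m with
      | zero => simp [hist, nil_almostIn]
      | succ m =>
        have h1 := ihl 0 (m + 1)
        have h2 := ihl 0 m
        simp only [hist] at h1 ⊢
        rw [almostIn_cons_cons, h1, h2]
        simp only [pos, pushStep]
        split_ifs with h
        · have : (w m = w' l ∧ m ≤ pos w (hist w' l) 0) ∨ ¬ (m = pos w (hist w' l) 0) := by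
            by_cases hm : m = pos w (hist w' l) 0
            · left; rw [hm]; exact ⟨h, le_rfl⟩
            · exact Or.inr hm
          grind
        · grind
    | succ j ihj =>
      cases m with
      | zero => simp [hist, nil_almostIn]
      | succ m =>
        have h1 := ihl (j + 1) (m + 1)
        have h2 := ihl (j + 1) m
        have h3 := ihj m
        simp only [hist] at h1 h3 ⊢
        rw [almostIn_cons_cons, h1, h2]
        simp only [pos] at h3 ⊢
        rw [pushStep]
        split_ifs with h
        · grind
        · grind

theorem Pd_eq_pos (d L : ℕ) (w w' : ℕ → ℕ) : Pd d L w w' = pos w (hist w' L) d := by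
  have : {m | AlmostIn d (pre w m) (pre w' L)} = Set.Iic (pos w (hist w' L) d) := by
    ext m
    simp only [Set.mem_ofPred_eq, Set.mem_Iic, ← reverse_hist, almostIn_reverse,
      almostIn_hist_iff]
  rw [Pd, this, csSup_Iic]

theorem pos_map {α β : Type*} [DecidableEq α] [DecidableEq β] (f : α → β)
    (hf : Function.Injective f) (w : ℕ → α) (l : List α) :
    pos (fun i => f (w i)) (l.map f) = pos w l := by
  induction l with
  | nil => rfl
  | cons c l ih => simp [pos, ih, hf.eq_iff]

theorem hist_map {α β : Type*} (f : α → β) (v : ℕ → α) (n : ℕ) :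
    hist (fun i => f (v i)) n = (hist v n).map f := by
  induction n with
  | zero => rfl
  | succ n ih => simp [hist, ih]

/-! ### Averages over random histories -/

/-- Average of a function of the history over `n` independent uniform letters. -/
noncomputable def av (k : ℕ) : ℕ → (List (Fin k) → ℝ) → ℝ
  | 0, F => F []
  | n + 1, F => av k n (fun l => (∑ c, F (c :: l)) / k)

theorem av_mono {k : ℕ} {n : ℕ} {F G : List (Fin k) → ℝ}
    (h : ∀ l, l.length = n → F l ≤ G l) : av k n F ≤ av k n G := by
  induction n generalizing F G with
  | zero => exact h [] rfl
  | succ n ih =>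
    refine ih fun l hl => ?_
    gcongr with c
    exact h _ (by simp [hl])

theorem av_congr {k : ℕ} {n : ℕ} {F G : List (Fin k) → ℝ}
    (h : ∀ l, l.length = n → F l = G l) : av k n F = av k n G :=
  le_antisymm (av_mono fun l hl => (h l hl).le) (av_mono fun l hl => (h l hl).ge)

theorem av_add {k : ℕ} (n : ℕ) (F G : List (Fin k) → ℝ) :
    av k n (fun l => F l + G l) = av k n F + av k n G := by
  induction n generalizing F G with
  | zero => rfl
  | succ n ih => simp only [av, Finset.sum_add_distrib, add_div, ih]

theorem av_mul {k : ℕ} (n : ℕ) (a : ℝ) (F : List (Fin k) → ℝ) :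
    av k n (fun l => a * F l) = a * av k n F := by
  induction n generalizing F with
  | zero => rfl
  | succ n ih => simp only [av, ← Finset.mul_sum, mul_div_assoc, ih]

theorem av_sub {k : ℕ} (n : ℕ) (F G : List (Fin k) → ℝ) :
    av k n (fun l => F l - G l) = av k n F - av k n G := by
  have h := av_add n F (fun l => (-1) * G l)
  rw [av_mul] at h
  simpa [sub_eq_add_neg] using h

theorem av_const {k : ℕ} (hk : k ≠ 0) (n : ℕ) (a : ℝ) : av k n (fun _ => a) = a := by
  induction n with
  | zero => rfl
  | succ n ih =>
    have : (k : ℝ) ≠ 0 := by exact_mod_cast hk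
    simp only [av, Finset.sum_const, Finset.card_univ, Fintype.card_fin, nsmul_eq_mul]
    rw [mul_div_cancel_left₀ _ this, ih]

theorem av_sum {k : ℕ} {ι : Type*} (n : ℕ) (s : Finset ι) (F : ι → List (Fin k) → ℝ) :
    av k n (fun l => ∑ i ∈ s, F i l) = ∑ i ∈ s, av k n (F i) := by
  classical
  induction s using Finset.induction_on with
  | empty =>
    have := av_mul n 0 (fun _ : List (Fin k) => (0 : ℝ))
    simpa using this
  | insert i s hi ih => simp only [Finset.sum_insert hi, av_add, ih]

theorem av_nonneg {k : ℕ} {n : ℕ} {F : List (Fin k) → ℝ} (h : ∀ l, l.length = n → 0 ≤ F l) :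
    0 ≤ av k n F := by
  have h0 : av k n (fun _ => (0 : ℝ)) = 0 := by
    have := av_mul n 0 (fun _ : List (Fin k) => (0 : ℝ))
    simpa using this
  rw [← h0]
  exact av_mono h

theorem abs_av_le {k : ℕ} (n : ℕ) (F : List (Fin k) → ℝ) :
    |av k n F| ≤ av k n (fun l => |F l|) := by
  rw [abs_le]
  constructor
  · have := av_mul n (-1) (fun l => |F l|)
    have h2 : av k n (fun l => (-1) * |F l|) ≤ av k n F :=
      av_mono fun l _ => by have := neg_abs_le (F l); linarith
    linarith
  · exact av_mono fun l _ => le_abs_self _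

theorem av_hist {k : ℕ} (L : ℕ) (z : Fin k) (F : List (Fin k) → ℝ) :
    (∑ v : Fin L → Fin k, F (hist (fun i => if h : i < L then v ⟨i, h⟩ else z) L)) / (k : ℝ) ^ L
      = av k L F := by
  induction L generalizing F with
  | zero => simp [hist, av]
  | succ L ih =>
    rw [av, ← ih]
    have key : ∀ n ≤ L, ∀ (c : Fin k) (v : Fin L → Fin k),
        hist (fun i => if h : i < L + 1 then (Fin.snoc v c : Fin (L + 1) → Fin k) ⟨i, h⟩ else z) n
        = hist (fun i => if h : i < L then v ⟨i, h⟩ else z) n := by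
      intro n
      induction n with
      | zero => intros; rfl
      | succ n ihn =>
        intro hn c v
        rw [hist, hist, ihn (by omega)]
        congr 1
        have h1 : n < L := by omega
        have h2 : n < L + 1 := by omega
        simp only [h1, h2, dif_pos]
        exact Fin.snoc_castSucc (α := fun _ => Fin k) c v ⟨n, h1⟩
    have e := Fintype.sum_equiv (Fin.snocEquiv (fun _ : Fin (L + 1) => Fin k)).symm
      (fun v : Fin (L + 1) → Fin k =>
        F (hist (fun i => if h : i < L + 1 then v ⟨i, h⟩ else z) (L + 1)))
      (fun p => F (p.1 :: hist (fun i => if h : i < L then p.2 ⟨i, h⟩ else z) L)) (by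
        intro v
        obtain ⟨p, rfl⟩ := (Fin.snocEquiv (fun _ : Fin (L + 1) => Fin k)).surjective v
        rw [Equiv.symm_apply_apply]
        simp only [Fin.snocEquiv_apply]
        rw [hist, key L le_rfl]
        congr 2
        simp only [Nat.lt_succ_self, dif_pos]
        exact Fin.snoc_last (α := fun _ => Fin k) p.1 p.2)
    rw [e, Fintype.sum_prod_type, Finset.sum_comm, pow_succ, Finset.sum_div, Finset.sum_div]
    refine Finset.sum_congr rfl fun v _ => ?_
    rw [div_div, mul_comm]

/-! ### Real-valued runs of the dynamics and their comparison -/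

/-- Real-valued version of `pushStep`. -/
noncomputable def rstep (x e : ℕ → ℝ) : ℕ → ℝ
  | 0 => x 0 + e 0
  | j + 1 => max (x (j + 1) + e (j + 1)) (rstep x e j + 1)

/-- The run of the dynamics whose increments `e l c` may depend on the history. -/
noncomputable def run {α : Type*} (e : List α → α → ℕ → ℝ) : List α → ℕ → ℝ
  | [] => fun j => j
  | c :: l => rstep (run e l) (e l c)

/-- Accumulated increments. -/
noncomputable def cum {α : Type*} (δ : List α → α → ℝ) : List α → ℝ
  | [] => 0
  | c :: l => cum δ l + δ l c

/-- Running maximum of the absolute accumulated increments. -/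
noncomputable def cumMax {α : Type*} (δ : List α → α → ℝ) : List α → ℝ
  | [] => 0
  | c :: l => max (cumMax δ l) |cum δ (c :: l)|

theorem abs_cum_le_cumMax {α : Type*} (δ : List α → α → ℝ) (l : List α) :
    |cum δ l| ≤ cumMax δ l := by
  cases l with
  | nil => simp [cum, cumMax]
  | cons c l => exact le_max_right _ _

theorem cumMax_nonneg {α : Type*} (δ : List α → α → ℝ) (l : List α) : 0 ≤ cumMax δ l :=
  (abs_nonneg _).trans (abs_cum_le_cumMax δ l)

theorem run_sub_sub_cum_le {α : Type*} (e e' : List α → α → ℕ → ℝ) (l : List α) (j : ℕ) :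
    |run e l j - run e' l j - cum (fun l c => e l c j - e' l c j) l| ≤
      2 * ∑ i ∈ Finset.range j, cumMax (fun l c => e l c i - e' l c i) l +
        cumMax (fun l c => e l c j - e' l c j) l := by
  induction l generalizing j with
  | nil => simp [run, cum, cumMax]
  | cons c l ihl =>
    have mono : ∀ i, cumMax (fun l c => e l c i - e' l c i) l ≤
        cumMax (fun l c => e l c i - e' l c i) (c :: l) := fun i => le_max_left _ _
    induction j with
    | zero =>
      have h := ihl 0
      have hm := mono 0
      simp only [run, rstep, cum, Finset.range_zero, Finset.sum_empty, mul_zero, zero_add] at h ⊢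
      rw [abs_le] at h ⊢
      constructor <;> linarith
    | succ j ihj =>
      have h := ihl (j + 1)
      have hm := mono (j + 1)
      have hs : ∑ i ∈ Finset.range (j + 1), cumMax (fun l c => e l c i - e' l c i) l ≤
          ∑ i ∈ Finset.range (j + 1), cumMax (fun l c => e l c i - e' l c i) (c :: l) :=
        Finset.sum_le_sum fun i _ => mono i
      have hs' := Finset.sum_range_succ
        (fun i => cumMax (fun l c => e l c i - e' l c i) (c :: l)) j
      have a1 := abs_le.1 (abs_cum_le_cumMax (fun l c => e l c j - e' l c j) (c :: l))
      have a2 := abs_le.1 (abs_cum_le_cumMax (fun l c => e l c (j + 1) - e' l c (j + 1)) (c :: l))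
      rw [abs_le] at h ihj ⊢
      simp only [run, rstep, cum] at h ihj a1 a2 ⊢
      constructor
      · rcases max_cases (run e' l (j + 1) + e' l c (j + 1)) (rstep (run e' l) (e' l c) j + 1) with
          ⟨h1, -⟩ | ⟨h1, -⟩ <;> rw [h1]
        · have := le_max_left (run e l (j + 1) + e l c (j + 1)) (rstep (run e l) (e l c) j + 1)
          linarith
        · have := le_max_right (run e l (j + 1) + e l c (j + 1)) (rstep (run e l) (e l c) j + 1)
          linarith
      · rcases max_cases (run e l (j + 1) + e l c (j + 1)) (rstep (run e l) (e l c) j + 1) with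
          ⟨h1, -⟩ | ⟨h1, -⟩ <;> rw [h1]
        · have := le_max_left (run e' l (j + 1) + e' l c (j + 1))
            (rstep (run e' l) (e' l c) j + 1)
          linarith
        · have := le_max_right (run e' l (j + 1) + e' l c (j + 1))
            (rstep (run e' l) (e' l c) j + 1)
          linarith

theorem abs_run_sub_run_le {α : Type*} (e e' : List α → α → ℕ → ℝ) (l : List α) (j : ℕ) :
    |run e l j - run e' l j| ≤
      2 * ∑ i ∈ Finset.range (j + 1), cumMax (fun l c => e l c i - e' l c i) l := by
  have h := run_sub_sub_cum_le e e' l j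
  have h2 := abs_cum_le_cumMax (fun l c => e l c j - e' l c j) l
  rw [Finset.sum_range_succ]
  rw [abs_le] at h h2 ⊢
  constructor <;> linarith

theorem av_cum_sq {k : ℕ} (hk : k ≠ 0) (δ : List (Fin k) → Fin k → ℝ)
    (h0 : ∀ l, ∑ c, δ l c = 0) (n : ℕ) :
    av k n (fun l => cum δ l ^ 2) =
      ∑ m ∈ Finset.range n, av k m (fun l => (∑ c, δ l c ^ 2) / k) := by
  have hk' : (k : ℝ) ≠ 0 := by exact_mod_cast hk
  induction n with
  | zero => simp [av, cum]
  | succ n ih =>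
    rw [Finset.sum_range_succ, ← ih, av, ← av_add]
    refine av_congr fun l _ => ?_
    have : ∀ c, cum δ (c :: l) ^ 2 = cum δ l ^ 2 + 2 * cum δ l * δ l c + δ l c ^ 2 := by
      intro c; simp only [cum]; ring
    simp only [this, Finset.sum_add_distrib, ← Finset.mul_sum, h0, Finset.sum_const,
      Finset.card_univ, Fintype.card_fin, nsmul_eq_mul]
    field_simp
    ring

theorem av_cumMax_sq_le {k : ℕ} (hk : k ≠ 0) (δ : List (Fin k) → Fin k → ℝ)
    (h0 : ∀ l, ∑ c, δ l c = 0) (n : ℕ) :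
    av k n (fun l => cumMax δ l ^ 2) ≤ 4 * av k n (fun l => cum δ l ^ 2) := by
  have hk' : (0 : ℝ) < k := by exact_mod_cast Nat.pos_of_ne_zero hk
  have key : av k n (fun l => cumMax δ l ^ 2 / 2 - cumMax δ l * |cum δ l|) ≤ 0 := by
    induction n with
    | zero => simp [av, cum, cumMax]
    | succ n ih =>
      refine le_trans ?_ ih
      rw [av]
      refine av_mono fun l _ => ?_
      rw [div_le_iff₀ hk']
      have step : ∀ c, cumMax δ (c :: l) ^ 2 / 2 - cumMax δ (c :: l) * |cum δ (c :: l)| ≤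
          cumMax δ l ^ 2 / 2 - cumMax δ l * |cum δ (c :: l)| := by
        intro c
        simp only [cumMax]
        rcases max_cases (cumMax δ l) |cum δ (c :: l)| with ⟨h, -⟩ | ⟨h, -⟩ <;> rw [h]
        nlinarith [sq_nonneg (cumMax δ l - |cum δ (c :: l)|)]
      have hsum : (k : ℝ) * |cum δ l| ≤ ∑ c, |cum δ (c :: l)| := by
        refine le_trans (le_of_eq ?_) (Finset.abs_sum_le_sum_abs _ _)
        simp only [cum, Finset.sum_add_distrib, h0, Finset.sum_const,
          Finset.card_univ, Fintype.card_fin, nsmul_eq_mul, add_zero, abs_mul, Nat.abs_cast]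
      calc _ ≤ ∑ c, (cumMax δ l ^ 2 / 2 - cumMax δ l * |cum δ (c :: l)|) :=
            Finset.sum_le_sum fun c _ => step c
        _ = k * (cumMax δ l ^ 2 / 2) - cumMax δ l * ∑ c, |cum δ (c :: l)| := by
            rw [Finset.sum_sub_distrib, ← Finset.mul_sum]
            simp
        _ ≤ k * (cumMax δ l ^ 2 / 2) - cumMax δ l * (k * |cum δ l|) := by
            have := mul_le_mul_of_nonneg_left hsum (cumMax_nonneg δ l)
            linarith
        _ = _ := by ring
  have h2 : av k n (fun l => (1 / 4) * cumMax δ l ^ 2 - cum δ l ^ 2) ≤ 0 := by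
    refine le_trans (av_mono fun l _ => ?_) key
    rw [← sq_abs (cum δ l)]
    nlinarith [sq_nonneg (cumMax δ l / 2 - |cum δ l|)]
  rw [av_sub, av_mul] at h2
  linarith

theorem av_le_of_av_sq_le {k : ℕ} (hk : k ≠ 0) {n : ℕ} {F : List (Fin k) → ℝ} {V : ℝ}
    (hV : 0 ≤ V) (h : av k n (fun l => F l ^ 2) ≤ V ^ 2) : av k n F ≤ V := by
  refine le_of_forall_pos_le_add fun ε hε => ?_
  have h1 : av k n (fun l => 2 * (V + ε) * F l) ≤
      av k n (fun l => F l ^ 2 + (V + ε) ^ 2) :=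
    av_mono fun l _ => by nlinarith [sq_nonneg (F l - (V + ε))]
  rw [av_mul, av_add, av_const hk] at h1
  have : 0 < V + ε := by linarith
  nlinarith

theorem av_cumMax_le {k : ℕ} (hk : k ≠ 0) (δ : List (Fin k) → Fin k → ℝ)
    (h0 : ∀ l, ∑ c, δ l c = 0) (n : ℕ) {V : ℝ}
    (hV : ∑ m ∈ Finset.range n, av k m (fun l => (∑ c, δ l c ^ 2) / k) ≤ V) :
    av k n (fun l => cumMax δ l) ≤ 2 * √V := by
  have hV0 : 0 ≤ V := le_trans (Finset.sum_nonneg fun m _ => av_nonneg fun l _ =>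
    div_nonneg (Finset.sum_nonneg fun c _ => sq_nonneg _) (by positivity)) hV
  refine av_le_of_av_sq_le hk (by positivity) ?_
  rw [mul_pow, Real.sq_sqrt hV0]
  refine (av_cumMax_sq_le hk δ h0 n).trans ?_
  rw [av_cum_sq hk δ h0]
  linarith

theorem av_abs_run_sub_run_le {k : ℕ} (hk : k ≠ 0) (e e' : List (Fin k) → Fin k → ℕ → ℝ)
    (n j : ℕ) {V : ℕ → ℝ} (h0 : ∀ i ≤ j, ∀ l, ∑ c, (e l c i - e' l c i) = 0)
    (hV : ∀ i ≤ j, ∑ m ∈ Finset.range n,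
      av k m (fun l => (∑ c, (e l c i - e' l c i) ^ 2) / k) ≤ V i) :
    av k n (fun l => |run e l j - run e' l j|) ≤ 4 * ∑ i ∈ Finset.range (j + 1), √(V i) := by
  calc av k n (fun l => |run e l j - run e' l j|)
      ≤ av k n (fun l =>
        2 * ∑ i ∈ Finset.range (j + 1), cumMax (fun l c => e l c i - e' l c i) l) :=
        av_mono fun l _ => abs_run_sub_run_le e e' l j
    _ = 2 * ∑ i ∈ Finset.range (j + 1), av k n (cumMax (fun l c => e l c i - e' l c i)) := by
        rw [av_mul, av_sum]
    _ ≤ 2 * ∑ i ∈ Finset.range (j + 1), 2 * √(V i) := by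
        gcongr with i hi
        have hij : i ≤ j := by simpa [Nat.lt_succ_iff] using hi
        exact av_cumMax_le hk _ (h0 i hij) n (hV i hij)
    _ = _ := by rw [← Finset.mul_sum]; ring

/-! ### Comparison with the fluid limit -/

/-- The increments of the dynamics in the word `w`. -/
noncomputable def wordInc {k : ℕ} (w : ℕ → Fin k) (l : List (Fin k)) (c : Fin k) (j : ℕ) : ℝ :=
  if w (pos w l j) = c then 1 else 0

theorem rstep_cast (x e : ℕ → ℕ) (j : ℕ) :
    rstep (fun i => (x i : ℝ)) (fun i => (e i : ℝ)) j = (pushStep x e j : ℕ) := by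
  induction j with
  | zero => simp [rstep, pushStep]
  | succ j ih => simp [rstep, pushStep, ih]

theorem run_wordInc {k : ℕ} (w : ℕ → Fin k) (l : List (Fin k)) :
    run (wordInc w) l = fun j => (pos w l j : ℝ) := by
  induction l with
  | nil => rfl
  | cons c l ih =>
    funext j
    rw [run, ih, pos, ← rstep_cast]
    congr 1
    funext i
    simp [wordInc]

theorem run_const {α : Type*} (a : ℝ) (l : List α) (j : ℕ) :
    run (fun _ _ _ => a) l j = j + l.length * a := by
  induction l generalizing j with
  | nil => simp [run]
  | cons c l ih =>
    rw [run]
    induction j with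
    | zero => simp [rstep, ih]; ring
    | succ j ihj =>
      rw [rstep, ihj, ih]
      rw [max_eq_left]
      · push_cast [List.length_cons]; ring
      · push_cast [List.length_cons]; linarith

theorem sum_wordInc {k : ℕ} (w : ℕ → Fin k) (l : List (Fin k)) (j : ℕ) :
    ∑ c, wordInc w l c j = 1 := by
  simp [wordInc]

theorem av_abs_pos_sub_le {k : ℕ} (hk : k ≠ 0) (w : ℕ → Fin k) (n j : ℕ) :
    av k n (fun l => |(pos w l j : ℝ) - (j + n / k)|) ≤ 4 * (j + 1) * √(n / k) := by
  have hk' : (0 : ℝ) < k := by exact_mod_cast Nat.pos_of_ne_zero hk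
  have h := av_abs_run_sub_run_le hk (wordInc w) (fun _ _ _ => 1 / k) n j (V := fun _ => n / k)
    (by
      intro i _ l
      rw [Finset.sum_sub_distrib, sum_wordInc]
      simp [hk'.ne'])
    (by
      intro i _
      calc _ ≤ ∑ m ∈ Finset.range n, av k m (fun _ => (1 / k : ℝ)) := by
            gcongr with m
            refine av_mono fun l _ => ?_
            gcongr
            have : ∀ c, (wordInc w l c i - 1 / k) ^ 2 =
                (1 - 2 / k) * wordInc w l c i + 1 / k ^ 2 := by
              intro c
              unfold wordInc
              split_ifs <;> ring
            simp only [this, Finset.sum_add_distrib, ← Finset.mul_sum, sum_wordInc]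
            simp only [Finset.sum_const, Finset.card_univ, Fintype.card_fin, nsmul_eq_mul]
            have : (k : ℝ) * (1 / k ^ 2) = 1 / k := by field_simp
            rw [this]
            have : (2 : ℝ) / k = 1 / k + 1 / k := by ring
            have : (0 : ℝ) < 1 / k := by positivity
            linarith
        _ = n / k := by
            simp only [av_const hk]
            simp; ring)
  rw [Finset.sum_const, Finset.card_range, nsmul_eq_mul, ← mul_assoc] at h
  push_cast at h
  refine le_trans (le_of_eq ?_) h
  refine av_congr fun l hl => ?_
  rw [run_wordInc, run_const, hl]
  simp only [mul_one_div]

theorem av_pos_zero {k : ℕ} (hk : k ≠ 0) (w : ℕ → Fin k) (n : ℕ) :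
    av k n (fun l => (pos w l 0 : ℝ)) = n / k := by
  have hk' : (0 : ℝ) < k := by exact_mod_cast Nat.pos_of_ne_zero hk
  induction n with
  | zero => simp [av, pos]
  | succ n ih =>
    have : ∀ l : List (Fin k), (∑ c, (pos w (c :: l) 0 : ℝ)) / k = pos w l 0 + 1 / k := by
      intro l
      simp only [pos, pushStep, Nat.cast_add, Finset.sum_add_distrib]
      simp
      field_simp
    simp only [av, this, av_add, ih, av_const hk]
    push_cast
    ring

theorem add_le_pushStep (x e : ℕ → ℕ) (j : ℕ) :
    x j + e j ≤ pushStep x e j := by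
  cases j with
  | zero => exact le_rfl
  | succ j => exact le_max_left _ _

theorem le_pushStep (x e : ℕ → ℕ) (j : ℕ) : x j ≤ pushStep x e j :=
  le_trans (Nat.le_add_right _ _) (add_le_pushStep x e j)

theorem pushStep_strictMono (x e : ℕ → ℕ) : StrictMono (pushStep x e) :=
  strictMono_nat_of_lt_succ fun _ => lt_of_lt_of_le (Nat.lt_succ_self _) (le_max_right _ _)

theorem pos_strictMono {α : Type*} [DecidableEq α] (w : ℕ → α) (l : List α) :
    StrictMono (pos w l) := by
  cases l with
  | nil => exact strictMono_id
  | cons c l => exact pushStep_strictMono _ _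

theorem pushStep_le {x e : ℕ → ℕ} (hx : StrictMono x) (he : ∀ j, e j ≤ 1) (j : ℕ) :
    pushStep x e j ≤ x j + 1 := by
  induction j with
  | zero => have := he 0; simp only [pushStep]; omega
  | succ j ih =>
    have := he (j + 1)
    have : x j < x (j + 1) := hx (Nat.lt_succ_self j)
    simp only [pushStep]; omega

theorem pos_le {α : Type*} [DecidableEq α] (w : ℕ → α) (l : List α) (j : ℕ) :
    pos w l j ≤ l.length + j := by
  induction l with
  | nil => simp [pos]
  | cons c l ih =>
    have := pushStep_le (pos_strictMono w l) (e := fun j => if w (pos w l j) = c then 1 else 0)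
      (fun _ => by split_ifs <;> omega) j
    simp only [pos, List.length_cons]
    omega

/-! ### Counting coincidences of letters -/

theorem min_pushStep_congr {x x' e e' : ℕ → ℕ} {a : ℕ} (hx : ∀ j, min (x j) a = min (x' j) a)
    (he : ∀ j, x j < a → e j = e' j) (j : ℕ) :
    min (pushStep x e j) a = min (pushStep x' e' j) a := by
  induction j with
  | zero =>
    have h1 := hx 0
    have h2 := he 0
    simp only [pushStep]
    omega
  | succ j ih =>
    have h1 := hx (j + 1)
    have h2 := he (j + 1)
    simp only [pushStep]
    omega

theorem min_pos_congr {α : Type*} [DecidableEq α] {w w' : ℕ → α} {a : ℕ}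
    (h : ∀ b < a, w b = w' b) (l : List α) (j : ℕ) :
    min (pos w l j) a = min (pos w' l j) a := by
  induction l generalizing j with
  | nil => rfl
  | cons c l ih =>
    refine min_pushStep_congr ih (fun j hj => ?_) j
    have h1 := ih j
    have h2 : pos w' l j = pos w l j := by omega
    rw [h2, h _ hj]

/-- Letters that have not occurred in the history since the particle `j` reached `a`. -/
def unseen {k : ℕ} (w : ℕ → Fin k) (a j : ℕ) : List (Fin k) → Finset (Fin k)
  | [] => Finset.univ
  | c :: l => if a ≤ pos w l j then (unseen w a j l).erase c else Finset.univ

theorem mem_unseen_of_pos_eq {k : ℕ} (w : ℕ → Fin k) {a j : ℕ} {l : List (Fin k)}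
    (h : pos w l j = a) : w a ∈ unseen w a j l := by
  induction l with
  | nil => simp [unseen]
  | cons c l ih =>
    simp only [unseen]
    split_ifs with hl
    · have h1 := le_pushStep (pos w l) (fun j => if w (pos w l j) = c then 1 else 0) j
      have h2 := add_le_pushStep (pos w l) (fun j => if w (pos w l j) = c then 1 else 0) j
      simp only [pos] at h
      rw [h] at h1 h2
      have h3 : pos w l j = a := le_antisymm h1 hl
      refine Finset.mem_erase.2 ⟨fun hc => ?_, ih h3⟩
      simp only [h3, hc, if_true] at h2
      omega
    · simp

theorem unseen_congr {k : ℕ} {w w' : ℕ → Fin k} {a : ℕ} (h : ∀ b < a, w b = w' b) (j : ℕ)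
    (l : List (Fin k)) : unseen w a j l = unseen w' a j l := by
  induction l with
  | nil => rfl
  | cons c l ih =>
    have h1 := min_pos_congr h l j
    have h2 : a ≤ pos w l j ↔ a ≤ pos w' l j := by omega
    simp only [unseen, ih, h2]

theorem sum_harmonic_erase {k : ℕ} {s : Finset (Fin k)} (hs : s.Nonempty) :
    ∑ c, (harmonic (s.erase c).card : ℝ) = k * harmonic s.card - 1 := by
  obtain ⟨m, hm⟩ : ∃ m, s.card = m + 1 := ⟨s.card - 1, by have := hs.card_pos; omega⟩
  have h1 : ∀ c, (harmonic (s.erase c).card : ℝ) =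
      harmonic s.card - if c ∈ s then ((m : ℝ) + 1)⁻¹ else 0 := by
    intro c
    split_ifs with hc
    · rw [Finset.card_erase_of_mem hc, hm, Nat.add_sub_cancel, harmonic_succ]
      push_cast
      ring
    · rw [Finset.erase_eq_of_notMem hc, sub_zero]
  simp only [h1, Finset.sum_sub_distrib, Finset.sum_ite_mem, Finset.univ_inter, Finset.sum_const,
    Finset.card_univ, Fintype.card_fin, nsmul_eq_mul, hm]
  have : (m : ℝ) + 1 ≠ 0 := by positivity
  push_cast
  field_simp

theorem sum_av_unseen_le {k : ℕ} (hk : k ≠ 0) (w : ℕ → Fin k) (a j L : ℕ) :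
    ∑ m ∈ Finset.range L,
        av k m (fun l => if a ≤ pos w l j ∧ (unseen w a j l).Nonempty then 1 else 0) ≤
      k * harmonic k * av k L (fun l => if a ≤ pos w l j then 1 else 0) := by
  have hk' : (0 : ℝ) < k := by exact_mod_cast Nat.pos_of_ne_zero hk
  have key : ∑ m ∈ Finset.range L,
        av k m (fun l => if a ≤ pos w l j ∧ (unseen w a j l).Nonempty then 1 else 0) ≤
      av k L (fun l => if a ≤ pos w l j then
        (k : ℝ) * harmonic k - k * harmonic (unseen w a j l).card else 0) := by
    induction L with
    | zero => simp [av, unseen]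
    | succ L ih =>
      rw [Finset.sum_range_succ]
      refine (add_le_add_left ih _).trans ?_
      rw [← av_add, av]
      refine av_mono fun l _ => ?_
      rw [le_div_iff₀ hk']
      by_cases hl : a ≤ pos w l j
      · have h1 : ∀ c, a ≤ pos w (c :: l) j := fun c => hl.trans (le_pushStep _ _ j)
        simp only [h1, hl, if_true, true_and, unseen]
        rw [Finset.sum_sub_distrib, ← Finset.mul_sum, ← Finset.mul_sum]
        simp only [Finset.sum_const, Finset.card_univ, Fintype.card_fin, nsmul_eq_mul]
        by_cases hs : (unseen w a j l).Nonempty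
        · rw [sum_harmonic_erase hs, if_pos hs]
          apply le_of_eq
          ring
        · rw [if_neg hs]
          rw [Finset.not_nonempty_iff_eq_empty] at hs
          simp [hs]
          apply le_of_eq
          ring
      · simp only [hl, if_false, false_and, unseen]
        simp
  refine key.trans ?_
  rw [← av_mul]
  refine av_mono fun l _ => ?_
  split_ifs with hl
  · have : (0 : ℝ) ≤ harmonic (unseen w a j l).card := by
      have : (0 : ℚ) ≤ harmonic (unseen w a j l).card := by unfold harmonic; positivity
      exact_mod_cast this
    nlinarith
  · simp

/-- Average over uniform words of length `N`. -/
noncomputable def ew (k N : ℕ) (g : (Fin N → Fin k) → ℝ) : ℝ := (∑ u, g u) / (k : ℝ) ^ N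

/-- Extension of a finite word by a fixed letter. -/
def padw {k N : ℕ} (z : Fin k) (u : Fin N → Fin k) (i : ℕ) : Fin k :=
  if h : i < N then u ⟨i, h⟩ else z

theorem padw_update {k N : ℕ} (z : Fin k) (u : Fin N → Fin k) (a : Fin N) (c : Fin k) :
    padw z (Function.update u a c) = Function.update (padw z u) a c := by
  funext i
  unfold padw
  by_cases h : i < N
  · by_cases hi : i = a
    · subst hi; simp
    · have : (⟨i, h⟩ : Fin N) ≠ a := fun h' => hi (by rw [← h'])
      simp [h, hi, this]
  · have : i ≠ a := fun h' => h (h' ▸ a.2)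
    simp [h, this]

theorem ew_mono {k N : ℕ} {f g : (Fin N → Fin k) → ℝ} (h : ∀ u, f u ≤ g u) :
    ew k N f ≤ ew k N g := by
  unfold ew
  gcongr with u
  exact h u

theorem ew_add {k N : ℕ} (f g : (Fin N → Fin k) → ℝ) :
    ew k N (fun u => f u + g u) = ew k N f + ew k N g := by
  simp only [ew, Finset.sum_add_distrib, add_div]

theorem ew_sub {k N : ℕ} (f g : (Fin N → Fin k) → ℝ) :
    ew k N (fun u => f u - g u) = ew k N f - ew k N g := by
  simp only [ew, Finset.sum_sub_distrib, sub_div]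

theorem ew_mul {k N : ℕ} (a : ℝ) (f : (Fin N → Fin k) → ℝ) :
    ew k N (fun u => a * f u) = a * ew k N f := by
  simp only [ew, ← Finset.mul_sum, mul_div_assoc]

theorem ew_sum {k N : ℕ} {ι : Type*} (s : Finset ι) (f : ι → (Fin N → Fin k) → ℝ) :
    ew k N (fun u => ∑ i ∈ s, f i u) = ∑ i ∈ s, ew k N (f i) := by
  simp only [ew]
  rw [Finset.sum_comm, Finset.sum_div]

theorem ew_const {k N : ℕ} (hk : k ≠ 0) (a : ℝ) : ew k N (fun _ => a) = a := by
  have hk' : (k : ℝ) ≠ 0 := by exact_mod_cast hk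
  simp [ew, hk']

theorem ew_sqrt_le {k N : ℕ} (hk : k ≠ 0) {f : (Fin N → Fin k) → ℝ} (hf : ∀ u, 0 ≤ f u) {V : ℝ}
    (h : ew k N f ≤ V) : ew k N (fun u => √(f u)) ≤ √V := by
  have hV : 0 ≤ V := by
    refine le_trans ?_ h
    rw [← ew_const (N := N) hk 0]
    exact ew_mono hf
  refine le_of_forall_pos_le_add fun ε hε => ?_
  have h1 : ew k N (fun u => 2 * (√V + ε) * √(f u)) ≤ ew k N (fun u => f u + (√V + ε) ^ 2) :=
    ew_mono fun u => by nlinarith [sq_nonneg (√(f u) - (√V + ε)), Real.sq_sqrt (hf u)]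
  rw [ew_mul, ew_add, ew_const hk] at h1
  have h2 := Real.sqrt_nonneg V
  have h3 := Real.sq_sqrt hV
  have : 0 < √V + ε := by linarith
  nlinarith

theorem ew_update {k N : ℕ} (hk : k ≠ 0) (a : Fin N) (f : (Fin N → Fin k) → ℝ) :
    ew k N f = ew k N (fun u => (∑ c, f (Function.update u a c)) / k) := by
  have hk' : (k : ℝ) ≠ 0 := by exact_mod_cast hk
  have inv : Function.Involutive (fun p : (Fin N → Fin k) × Fin k =>
      (Function.update p.1 a p.2, p.1 a)) := by
    rintro ⟨u, c⟩
    simp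
  have h := Fintype.sum_equiv inv.toPerm
    (fun p : (Fin N → Fin k) × Fin k => f (Function.update p.1 a p.2)) (fun p => f p.1)
    (fun p => rfl)
  rw [Fintype.sum_prod_type, Fintype.sum_prod_type] at h
  simp only [Finset.sum_const, Finset.card_univ, Fintype.card_fin, nsmul_eq_mul,
    ← Finset.mul_sum] at h
  unfold ew
  rw [← Finset.sum_div, h]
  field_simp

theorem ew_coincidence_at_le {k N : ℕ} (hk : k ≠ 0) (z : Fin k) (a : Fin N) {i j : ℕ}
    (hij : i < j) (L : ℕ) :
    ew k N (fun u => ∑ m ∈ Finset.range L, av k m (fun l =>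
        if pos (padw z u) l j = a ∧ padw z u (pos (padw z u) l i) = padw z u (pos (padw z u) l j)
        then 1 else 0)) ≤
      harmonic k * ew k N (fun u => av k L (fun l => if a ≤ pos (padw z u) l j then 1 else 0)) := by
  have hk' : (0 : ℝ) < k := by exact_mod_cast Nat.pos_of_ne_zero hk
  rw [ew_update hk a, ← ew_mul]
  refine ew_mono fun u => ?_
  rw [div_le_iff₀ hk', Finset.sum_comm]
  refine le_trans ?_ ((sum_av_unseen_le hk (padw z u) a j L).trans (le_of_eq (by ring)))
  refine Finset.sum_le_sum fun m _ => ?_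
  rw [← av_sum]
  refine av_mono fun l _ => ?_
  have hag : ∀ c, ∀ b < (a : ℕ), padw z u b = padw z (Function.update u a c) b := by
    intro c b hb
    rw [padw_update, Function.update_of_ne hb.ne]
  have hpt : ∀ c, (if pos (padw z (Function.update u a c)) l j = a ∧
      padw z (Function.update u a c) (pos (padw z (Function.update u a c)) l i) =
        padw z (Function.update u a c) (pos (padw z (Function.update u a c)) l j)
        then (1 : ℝ) else 0) ≤ if c = padw z u (pos (padw z u) l i) then
          (if a ≤ pos (padw z u) l j ∧ (unseen (padw z u) a j l).Nonempty then 1 else 0)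
          else 0 := by
    intro c
    split_ifs with h1 h2 h3 h3
    · exact le_rfl
    · exfalso
      apply h3
      have hm := min_pos_congr (hag c) l j
      refine ⟨by omega, ?_⟩
      rw [unseen_congr (hag c)]
      exact ⟨_, mem_unseen_of_pos_eq _ h1.1⟩
    · exfalso
      apply h2
      have hlt := pos_strictMono (padw z (Function.update u a c)) l hij
      have hm := min_pos_congr (hag c) l i
      have heq : pos (padw z u) l i = pos (padw z (Function.update u a c)) l i := by omega
      rw [heq, hag c _ (by omega), h1.2, h1.1, padw_update, Function.update_self]
    all_goals norm_num
  refine (Finset.sum_le_sum fun c _ => hpt c).trans ?_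
  rw [Finset.sum_ite_eq']
  simp

theorem ew_coincidence_le {k N : ℕ} (hk : k ≠ 0) (z : Fin k) {i j L : ℕ}
    (hij : i < j) (hN : L + j ≤ N) :
    ew k N (fun u => ∑ m ∈ Finset.range L, av k m (fun l =>
        if padw z u (pos (padw z u) l i) = padw z u (pos (padw z u) l j) then 1 else 0)) ≤
      harmonic k * (ew k N (fun u => av k L (fun l => (pos (padw z u) l j : ℝ))) + 1) := by
  have hH : (0 : ℝ) ≤ harmonic k := by
    have : (0 : ℚ) ≤ harmonic k := by unfold harmonic; positivity
    exact_mod_cast this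
  calc _ = ew k N (fun u => ∑ a : Fin N, ∑ m ∈ Finset.range L, av k m (fun l =>
        if pos (padw z u) l j = a ∧ padw z u (pos (padw z u) l i) = padw z u (pos (padw z u) l j)
        then 1 else 0)) := by
        congr 1
        funext u
        rw [Finset.sum_comm]
        refine Finset.sum_congr rfl fun m hm => ?_
        rw [← av_sum]
        refine av_congr fun l hl => ?_
        have hlt : pos (padw z u) l j < N := by
          have := pos_le (padw z u) l j
          have := Finset.mem_range.1 hm
          omega
        rw [Finset.sum_eq_single (⟨_, hlt⟩ : Fin N)]
        · simp
        · intro b _ hb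
          rw [if_neg]
          rintro ⟨h, -⟩
          exact hb (Fin.ext h.symm)
        · simp
    _ = ∑ a : Fin N, ew k N (fun u => ∑ m ∈ Finset.range L, av k m (fun l =>
        if pos (padw z u) l j = a ∧ padw z u (pos (padw z u) l i) = padw z u (pos (padw z u) l j)
        then 1 else 0)) := ew_sum _ _
    _ ≤ ∑ a : Fin N, harmonic k *
        ew k N (fun u => av k L (fun l => if a ≤ pos (padw z u) l j then 1 else 0)) :=
        Finset.sum_le_sum fun a _ => ew_coincidence_at_le hk z a hij L
    _ ≤ _ := by
        rw [← Finset.mul_sum, ← ew_sum]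
        refine mul_le_mul_of_nonneg_left ?_ hH
        have e1 : ∀ f : (Fin N → Fin k) → ℝ, ew k N f + 1 = ew k N (fun u => f u + 1) :=
          fun f => by rw [ew_add, ew_const hk]
        have e2 : ∀ f : List (Fin k) → ℝ, av k L f + 1 = av k L (fun l => f l + 1) :=
          fun f => by rw [av_add, av_const hk]
        rw [e1]
        refine ew_mono fun u => ?_
        rw [← av_sum, e2]
        refine av_mono fun l _ => ?_
        rw [Finset.sum_boole]
        have : (Finset.univ.filter fun a : Fin N => (a : ℕ) ≤ pos (padw z u) l j).card ≤
            (Finset.range (pos (padw z u) l j + 1)).card :=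
          Finset.card_le_card_of_injOn (fun a => (a : ℕ))
            (fun a ha => by simpa [Nat.lt_succ_iff] using ha) (Fin.val_injective.injOn)
        rw [Finset.card_range] at this
        exact_mod_cast this

/-! ### The idealized dynamics -/

theorem exists_ideal {k d : ℕ} (hd : d + 1 ≤ k) (a : ℕ → Fin k) :
    ∃ b : ℕ → Fin k, Set.InjOn b (Set.Iic d) ∧ ∀ j ≤ d, (∀ i < j, a i ≠ a j) → b j = a j := by
  classical
  let s : Finset (Fin (d + 1)) := Finset.univ.filter fun j => ∀ i < (j : ℕ), a i ≠ a j
  let f : Fin (d + 1) → Fin k := fun j => a j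
  have hinj : Set.InjOn f s := by
    intro x hx y hy hxy
    have hx' : ∀ i < (x : ℕ), a i ≠ a x := by simpa [s] using hx
    have hy' : ∀ i < (y : ℕ), a i ≠ a y := by simpa [s] using hy
    rcases lt_trichotomy (x : ℕ) y with h | h | h
    · exact absurd hxy (hy' _ h)
    · exact Fin.ext h
    · exact absurd hxy.symm (hx' _ h)
  obtain ⟨t, hst, ht⟩ := Finset.exists_superset_card_eq (s := s.image f) (n := d + 1)
    (Finset.card_image_le.trans ((Finset.card_le_univ s).trans (by simp))) (by simpa using hd)
  obtain ⟨g, hg⟩ := Finset.exists_equiv_extend_of_card_eq (α := Fin (d + 1)) (t := t)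
    (by simp [ht]) hst hinj
  refine ⟨fun j => if h : j < d + 1 then g ⟨j, h⟩ else ⟨0, by omega⟩, ?_, ?_⟩
  · intro x hx y hy hxy
    simp only [Set.mem_Iic] at hx hy
    have hx' : x < d + 1 := by omega
    have hy' : y < d + 1 := by omega
    simp only [hx', hy', dif_pos] at hxy
    have := g.injective (Subtype.ext hxy)
    simpa using this
  · intro j hj h
    have hj' : j < d + 1 := by omega
    simp only [hj', dif_pos]
    exact hg ⟨j, hj'⟩ (by simpa [s] using h)

/-- Letters at the particles, modified so as to be distinct for the particles `0, …, d`. -/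
noncomputable def idealLetter {k d : ℕ} (hd : d + 1 ≤ k) (a : ℕ → Fin k) : ℕ → Fin k :=
  (exists_ideal hd a).choose

/-- Increments of the idealized dynamics. -/
noncomputable def idealStep {k d : ℕ} (hd : d + 1 ≤ k) (w : ℕ → Fin k) (l : List (Fin k))
    (c : Fin k) (j : ℕ) : ℕ :=
  if j ≤ d ∧ idealLetter hd (fun j => w (pos w l j)) j = c then 1 else 0

/-- Positions of the particles in the idealized dynamics. -/
noncomputable def idealPos {k d : ℕ} (hd : d + 1 ≤ k) (w : ℕ → Fin k) : List (Fin k) → ℕ → ℕ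
  | [] => fun j => j
  | c :: l => pushStep (idealPos hd w l) (idealStep hd w l c)

theorem idealPos_strictMono {k d : ℕ} (hd : d + 1 ≤ k) (w : ℕ → Fin k) (l : List (Fin k)) :
    StrictMono (idealPos hd w l) := by
  cases l with
  | nil => exact strictMono_id
  | cons c l => exact pushStep_strictMono _ _

theorem run_idealStep {k d : ℕ} (hd : d + 1 ≤ k) (w : ℕ → Fin k) (l : List (Fin k)) :
    run (fun l c j => (idealStep hd w l c j : ℝ)) l = fun j => (idealPos hd w l j : ℝ) := by
  induction l with
  | nil => rfl
  | cons c l ih =>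
    funext j
    rw [run, ih, idealPos, ← rstep_cast]

/-- The generator of the idealized dynamics of particles `0, …, d`. -/
noncomputable def gen (k d : ℕ) (φ : (ℕ → ℕ) → ℝ) (x : ℕ → ℕ) : ℝ :=
  (1 - (d + 1) / k) * φ x + (∑ j ∈ Finset.range (d + 1), φ (pushStep x (Pi.single j 1))) / k

theorem pushStep_zero {x : ℕ → ℕ} (hx : StrictMono x) : pushStep x 0 = x := by
  funext j
  induction j with
  | zero => rfl
  | succ j ih =>
    have : x j < x (j + 1) := hx (Nat.lt_succ_self j)
    simp only [pushStep, ih, Pi.zero_apply]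
    omega

theorem sum_idealStep {k d : ℕ} (hd : d + 1 ≤ k) (w : ℕ → Fin k) (l : List (Fin k))
    (φ : (ℕ → ℕ) → ℝ) {x : ℕ → ℕ} (hx : StrictMono x) :
    (∑ c, φ (pushStep x (idealStep hd w l c))) / k = gen k d φ x := by
  have hk : (k : ℝ) ≠ 0 := by
    have : k ≠ 0 := by omega
    exact_mod_cast this
  set b := idealLetter hd (fun j => w (pos w l j)) with hb
  have hinj : Set.InjOn b (Set.Iic d) := (exists_ideal hd (fun j => w (pos w l j))).choose_spec.1
  have hinj' : Set.InjOn b (Finset.range (d + 1)) := by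
    refine hinj.mono ?_
    intro x hx
    simpa [Nat.lt_succ_iff] using hx
  have h1 : ∀ j ∈ Finset.range (d + 1), idealStep hd w l (b j) = Pi.single j 1 := by
    intro j hj
    have hj' : j ≤ d := by simpa [Nat.lt_succ_iff] using hj
    funext i
    rw [idealStep, ← hb]
    by_cases hi : i = j
    · subst hi; simp [hj']
    · rw [Pi.single_eq_of_ne hi, if_neg]
      rintro ⟨h2, h3⟩
      exact hi (hinj h2 hj' h3)
  have h2 : ∀ c, c ∉ (Finset.range (d + 1)).image b → idealStep hd w l c = 0 := by
    intro c hc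
    funext i
    rw [idealStep, ← hb, if_neg]
    · rfl
    rintro ⟨h2, h3⟩
    exact hc (Finset.mem_image.2 ⟨i, by simpa [Nat.lt_succ_iff] using h2, h3⟩)
  have h3 : ∑ j ∈ Finset.range (d + 1), φ (pushStep x (idealStep hd w l (b j))) =
      ∑ j ∈ Finset.range (d + 1), φ (pushStep x (Pi.single j 1)) :=
    Finset.sum_congr rfl fun j hj => by rw [h1 j hj]
  have h4 : ∑ c ∈ ((Finset.range (d + 1)).image b)ᶜ, φ (pushStep x (idealStep hd w l c)) =
      ∑ c ∈ ((Finset.range (d + 1)).image b)ᶜ, φ x :=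
    Finset.sum_congr rfl fun c hc => by
      rw [h2 c (Finset.mem_compl.1 hc), pushStep_zero hx]
  rw [← Finset.sum_add_sum_compl ((Finset.range (d + 1)).image b), Finset.sum_image hinj', h3, h4,
    Finset.sum_const, Finset.card_compl, Finset.card_image_of_injOn hinj', Finset.card_range,
    Fintype.card_fin, nsmul_eq_mul, gen, Nat.cast_sub hd]
  push_cast
  field_simp
  ring

theorem av_idealPos {k d : ℕ} (hd : d + 1 ≤ k) (w : ℕ → Fin k) (n : ℕ) (φ : (ℕ → ℕ) → ℝ) :
    av k n (fun l => φ (idealPos hd w l)) = (gen k d)^[n] φ id := by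
  induction n generalizing φ with
  | zero => rfl
  | succ n ih =>
    rw [Function.iterate_succ_apply, ← ih, av]
    refine av_congr fun l _ => ?_
    exact sum_idealStep hd w l φ (idealPos_strictMono hd w l)

theorem sum_idealStep_single {k d : ℕ} (hd : d + 1 ≤ k) (w : ℕ → Fin k) (l : List (Fin k))
    {j : ℕ} (hj : j ≤ d) : ∑ c, (idealStep hd w l c j : ℝ) = 1 := by
  simp [idealStep, hj]

theorem sum_sq_wordInc_sub_le {k d : ℕ} (hd : d + 1 ≤ k) (w : ℕ → Fin k) (l : List (Fin k))
    {j : ℕ} (hj : j ≤ d) :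
    ∑ c, (wordInc w l c j - idealStep hd w l c j) ^ 2 ≤
      2 * ∑ i ∈ Finset.range j, if w (pos w l i) = w (pos w l j) then (1 : ℝ) else 0 := by
  have hspec := (exists_ideal hd (fun j => w (pos w l j))).choose_spec.2 j hj
  by_cases h : ∀ i < j, w (pos w l i) ≠ w (pos w l j)
  · have h1 : idealLetter hd (fun j => w (pos w l j)) j = w (pos w l j) := hspec h
    refine le_trans (le_of_eq ?_) (mul_nonneg zero_le_two
      (Finset.sum_nonneg fun i _ => by split_ifs <;> norm_num))
    refine Finset.sum_eq_zero fun c _ => ?_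
    simp [wordInc, idealStep, hj, h1]
  · push Not at h
    obtain ⟨i, hi, hij⟩ := h
    have h2 : (1 : ℝ) ≤ ∑ i ∈ Finset.range j,
        if w (pos w l i) = w (pos w l j) then (1 : ℝ) else 0 := by
      refine le_trans (le_of_eq ?_) (Finset.single_le_sum
        (f := fun i => if w (pos w l i) = w (pos w l j) then (1 : ℝ) else 0)
        (fun i _ => by split_ifs <;> norm_num) (Finset.mem_range.2 hi))
      simp [hij]
    have h3 : ∑ c, (wordInc w l c j - idealStep hd w l c j) ^ 2 ≤
        ∑ c, (wordInc w l c j + idealStep hd w l c j) := by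
      refine Finset.sum_le_sum fun c _ => ?_
      unfold wordInc idealStep
      split_ifs <;> norm_num
    rw [Finset.sum_add_distrib, sum_wordInc, sum_idealStep_single hd w l hj] at h3
    linarith

/-- The true dynamics is close to the idealized one on average. -/
theorem ew_abs_pos_sub_ideal_le {k d L N : ℕ} (hd : d + 1 ≤ k) (hN : L + d ≤ N) (z : Fin k)
    {B : ℝ} (hB : ∀ (w : ℕ → Fin k), ∀ j ≤ d, av k L (fun l => (pos w l j : ℝ)) + 1 ≤ B) :
    |ew k N (fun u => av k L (fun l => (pos (padw z u) l d : ℝ))) -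
        (gen k d)^[L] (fun x => (x d : ℝ)) id| ≤
      4 * (d + 1) * √(2 * d * harmonic k * B / k) := by
  have hk : k ≠ 0 := by omega
  have hk' : (0 : ℝ) < k := by exact_mod_cast Nat.pos_of_ne_zero hk
  have hH : (0 : ℝ) ≤ harmonic k := by
    have : (0 : ℚ) ≤ harmonic k := by unfold harmonic; positivity
    exact_mod_cast this
  have hB0 : 0 ≤ B := by
    have h1 := hB (padw z (fun _ : Fin 0 => z)) 0 (Nat.zero_le _)
    have h2 : 0 ≤ av k L (fun l => (pos (padw z (fun _ : Fin 0 => z)) l 0 : ℝ)) :=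
      av_nonneg fun l _ => Nat.cast_nonneg _
    linarith
  set V : (Fin N → Fin k) → ℕ → ℝ := fun u j => 2 / k * ∑ i ∈ Finset.range j,
    ∑ m ∈ Finset.range L, av k m (fun l =>
      if padw z u (pos (padw z u) l i) = padw z u (pos (padw z u) l j) then 1 else 0) with hVdef
  have hV0 : ∀ u j, 0 ≤ V u j := fun u j => mul_nonneg (by positivity)
    (Finset.sum_nonneg fun i _ => Finset.sum_nonneg fun m _ => av_nonneg fun l _ => by
      split_ifs <;> norm_num)
  have hVb : ∀ j ≤ d, ew k N (fun u => V u j) ≤ 2 * d * harmonic k * B / k := by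
    intro j hj
    simp only [hVdef]
    rw [ew_mul, ew_sum]
    have : ∀ i ∈ Finset.range j, ew k N (fun u => ∑ m ∈ Finset.range L, av k m (fun l =>
        if padw z u (pos (padw z u) l i) = padw z u (pos (padw z u) l j) then 1 else 0)) ≤
        harmonic k * B := by
      intro i hi
      refine (ew_coincidence_le hk z (Finset.mem_range.1 hi) (by omega)).trans ?_
      refine mul_le_mul_of_nonneg_left ?_ hH
      rw [← ew_const (N := N) hk 1, ← ew_add, ← ew_const (N := N) hk B]
      exact ew_mono fun u => hB _ j hj
    have h2 := Finset.sum_le_sum this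
    rw [Finset.sum_const, Finset.card_range, nsmul_eq_mul] at h2
    have h3 : (j : ℝ) * (harmonic k * B) ≤ d * (harmonic k * B) := by
      have : (j : ℝ) ≤ d := by exact_mod_cast hj
      gcongr
    calc _ ≤ 2 / (k : ℝ) * (d * (harmonic k * B)) := by gcongr; exact h2.trans h3
      _ = _ := by ring
  rw [← ew_const (N := N) hk ((gen k d)^[L] (fun x => (x d : ℝ)) id), ← ew_sub]
  have hpt : ∀ u, |av k L (fun l => (pos (padw z u) l d : ℝ)) -
      (gen k d)^[L] (fun x => (x d : ℝ)) id| ≤ 4 * ∑ j ∈ Finset.range (d + 1), √(V u j) := by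
    intro u
    rw [← av_idealPos hd (padw z u), ← av_sub]
    refine (abs_av_le _ _).trans ?_
    have h := av_abs_run_sub_run_le hk (wordInc (padw z u))
      (fun l c j => (idealStep hd (padw z u) l c j : ℝ)) L d (V := V u)
      (by
        intro i hi l
        rw [Finset.sum_sub_distrib, sum_wordInc, sum_idealStep_single hd _ _ hi, sub_self])
      (by
        intro i hi
        simp only [hVdef]
        rw [Finset.sum_comm, Finset.mul_sum]
        refine Finset.sum_le_sum fun m _ => ?_
        rw [← av_sum, ← av_mul]
        refine av_mono fun l _ => ?_
        rw [div_le_iff₀ hk']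
        refine (sum_sq_wordInc_sub_le hd _ l hi).trans (le_of_eq ?_)
        field_simp)
    simp only [run_wordInc, run_idealStep] at h
    exact h
  have h4 : ew k N (fun u => 4 * ∑ j ∈ Finset.range (d + 1), √(V u j)) ≤
      4 * (d + 1) * √(2 * d * harmonic k * B / k) := by
    rw [ew_mul, ew_sum, mul_assoc]
    refine mul_le_mul_of_nonneg_left ?_ (by norm_num)
    refine (Finset.sum_le_sum fun j hj => ew_sqrt_le hk (fun u => hV0 u j)
      (hVb j (by simpa [Nat.lt_succ_iff] using hj))).trans (le_of_eq ?_)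
    rw [Finset.sum_const, Finset.card_range, nsmul_eq_mul]
    push_cast
    rfl
  rw [abs_le]
  constructor
  · have h5 := ew_mono (k := k) fun u => (abs_le.1 (hpt u)).1
    have h6 := ew_mul (k := k) (-1) (fun u => 4 * ∑ j ∈ Finset.range (d + 1), √(V u j))
    simp only [neg_one_mul] at h6
    linarith
  · exact (ew_mono fun u => (abs_le.1 (hpt u)).2).trans h4

/-! ### Upper bound by comparison with a stationary process -/

theorem pushStep_succ_eq {x e e' : ℕ → ℕ} (h0 : pushStep x e 1 = x 1 + e' 0)
    (h : ∀ j, e' (j + 1) = e (j + 2)) (j : ℕ) :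
    pushStep x e (j + 1) = pushStep (fun i => x (i + 1)) e' j := by
  induction j with
  | zero => exact h0
  | succ j ih =>
    have h1 : pushStep x e (j + 2) = max (x (j + 2) + e (j + 2)) (pushStep x e (j + 1) + 1) := rfl
    rw [h1, ih, pushStep, h]

theorem pushStep_mono {x y e : ℕ → ℕ} (h : x ≤ y) : pushStep x e ≤ pushStep y e := by
  intro j
  induction j with
  | zero => exact Nat.add_le_add_right (h 0) _
  | succ j ih => exact max_le_max (Nat.add_le_add_right (h _) _) (Nat.add_le_add_right ih _)

/-- Positions with a prescribed first particle and prescribed gaps. -/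
def ofGaps : ℕ → List ℕ → ℕ → ℕ
  | x, [] => fun j => x + j
  | x, n :: g => fun j => match j with
    | 0 => x
    | j + 1 => ofGaps (x + n + 1) g j

/-- Effect on the gaps of a push of the first particle. -/
def pushGaps : List ℕ → List ℕ
  | [] => []
  | 0 :: g => 0 :: pushGaps g
  | (n + 1) :: g => n :: g

/-- Effect on the gaps of a push of the particle `j + 1`. -/
def attGaps : ℕ → List ℕ → List ℕ
  | _, [] => []
  | 0, n :: g => (n + 1) :: pushGaps g
  | j + 1, n :: g => n :: attGaps j g

theorem length_pushGaps (g : List ℕ) : (pushGaps g).length = g.length := by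
  induction g with
  | nil => rfl
  | cons n g ih => cases n <;> simp [pushGaps, ih]

theorem length_attGaps (j : ℕ) (g : List ℕ) : (attGaps j g).length = g.length := by
  induction g generalizing j with
  | nil => simp [attGaps]
  | cons n g ih => cases j <;> simp [attGaps, ih, length_pushGaps]

theorem ofGaps_zero (x : ℕ) (g : List ℕ) : ofGaps x g 0 = x := by
  cases g <;> rfl

theorem ofGaps_last (x : ℕ) (g : List ℕ) : ofGaps x g g.length = x + g.length + g.sum := by
  induction g generalizing x with
  | nil => rfl
  | cons n g ih => simp only [List.length_cons, ofGaps, ih, List.sum_cons]; ring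

theorem ofGaps_strictMono (x : ℕ) (g : List ℕ) : StrictMono (ofGaps x g) := by
  refine strictMono_nat_of_lt_succ fun j => ?_
  induction g generalizing x j with
  | nil => simp [ofGaps]
  | cons n g ih =>
    cases j with
    | zero => simp only [ofGaps, ofGaps_zero]; omega
    | succ j => exact ih _ j

theorem pushStep_single_zero (x : ℕ) (g : List ℕ) :
    pushStep (ofGaps x g) (Pi.single 0 1) = ofGaps (x + 1) (pushGaps g) := by
  induction g generalizing x with
  | nil =>
    funext j
    induction j with
    | zero => rfl
    | succ j ih =>
      simp only [pushGaps] at ih ⊢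
      rw [pushStep, ih]
      simp only [ofGaps, Pi.single_apply]
      simp only [Nat.succ_ne_zero, if_false]
      omega
  | cons n g ih =>
    funext j
    cases n with
    | zero =>
      cases j with
      | zero => rfl
      | succ j =>
        rw [pushStep_succ_eq (e' := Pi.single 0 1)]
        · simp only [pushGaps, ofGaps]
          exact congrFun (ih (x + 0 + 1)) j
        · simp [pushStep, ofGaps, ofGaps_zero]
        · intro j
          simp
    | succ n =>
      cases j with
      | zero => rfl
      | succ j =>
        rw [pushStep_succ_eq (e' := 0)]
        · simp only [pushGaps, ofGaps]
          rw [pushStep_zero (ofGaps_strictMono _ g)]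
          congr 1
          omega
        · simp [pushStep, ofGaps, ofGaps_zero]
        · intro j
          simp

theorem pushStep_single_succ (x j : ℕ) (g : List ℕ) (hj : j < g.length) :
    pushStep (ofGaps x g) (Pi.single (j + 1) 1) = ofGaps x (attGaps j g) := by
  induction g generalizing x j with
  | nil => simp at hj
  | cons n g ih =>
    funext i
    cases j with
    | zero =>
      cases i with
      | zero => simp [pushStep, ofGaps, attGaps]
      | succ i =>
        rw [pushStep_succ_eq (e' := Pi.single 0 1)]
        · simp only [attGaps, ofGaps]
          exact congrFun (pushStep_single_zero (x + n + 1) g) i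
        · simp [pushStep, ofGaps, ofGaps_zero]
          omega
        · intro i
          simp
    | succ j =>
      cases i with
      | zero => simp [pushStep, ofGaps, attGaps]
      | succ i =>
        rw [pushStep_succ_eq (e' := Pi.single (j + 1) 1)]
        · simp only [attGaps, ofGaps]
          exact congrFun (ih (x + n + 1) j (by simpa using hj)) i
        · simp [pushStep, ofGaps, ofGaps_zero]
        · intro i
          simp [Pi.single_apply]

theorem ofGaps_replicate (x n : ℕ) : ofGaps x (List.replicate n 0) = fun j => x + j := by
  induction n generalizing x with
  | zero => rfl
  | succ n ih =>
    funext j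
    cases j with
    | zero => rfl
    | succ j =>
      simp only [List.replicate_succ, ofGaps, ih]
      omega

theorem ofGaps_replicate_le (x n : ℕ) (g : List ℕ) :
    ofGaps x (List.replicate n 0) ≤ ofGaps x g := by
  rw [ofGaps_replicate]
  intro j
  induction j with
  | zero => rw [ofGaps_zero]; rfl
  | succ j ih =>
    have : ofGaps x g j < ofGaps x g (j + 1) := ofGaps_strictMono x g (Nat.lt_succ_self j)
    simp only at ih ⊢
    omega

theorem gen_mono {k d : ℕ} (hd : d + 1 ≤ k) {φ ψ : (ℕ → ℕ) → ℝ} (h : φ ≤ ψ) :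
    gen k d φ ≤ gen k d ψ := by
  intro x
  have hk : (0 : ℝ) < k := by
    have : 0 < k := by omega
    exact_mod_cast this
  have h1 : (0 : ℝ) ≤ 1 - (d + 1) / k := by
    rw [sub_nonneg, div_le_one hk]
    exact_mod_cast hd
  unfold gen
  gcongr
  · exact h x
  · exact h _

/-- The generator with the first particle sped up by the factor `r`. -/
noncomputable def fastGen (k d : ℕ) (r : ℝ) (φ : (ℕ → ℕ) → ℝ) (x : ℕ → ℕ) : ℝ :=
  (1 - (r + d) / k) * φ x + r / k * φ (pushStep x (Pi.single 0 1)) +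
    (∑ j ∈ Finset.range d, φ (pushStep x (Pi.single (j + 1) 1))) / k

theorem gen_le_fastGen {k d : ℕ} {r : ℝ} (hr : 1 ≤ r) {φ : (ℕ → ℕ) → ℝ} (h : Monotone φ)
    (x : ℕ → ℕ) : gen k d φ x ≤ fastGen k d r φ x := by
  have h1 : φ x ≤ φ (pushStep x (Pi.single 0 1)) := h fun j => le_pushStep _ _ _
  have h2 : 0 ≤ (r - 1) / k * (φ (pushStep x (Pi.single 0 1)) - φ x) :=
    mul_nonneg (div_nonneg (by linarith) (by positivity)) (by linarith)
  unfold gen fastGen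
  rw [Finset.sum_range_succ', add_div]
  refine le_of_sub_nonneg (h2.trans (le_of_eq ?_))
  ring

theorem fastGen_monotone {k d : ℕ} {r : ℝ} (hr : 0 ≤ r) (hk : 0 < k) (hrk : r + d ≤ k)
    {φ : (ℕ → ℕ) → ℝ} (h : Monotone φ) : Monotone (fastGen k d r φ) := by
  intro x y hxy
  have hk' : (0 : ℝ) < k := by exact_mod_cast hk
  have h1 : (0 : ℝ) ≤ 1 - (r + d) / k := by
    rw [sub_nonneg, div_le_one hk']
    exact hrk
  unfold fastGen
  gcongr
  · exact h hxy
  · exact h (pushStep_mono hxy)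
  · exact h (pushStep_mono hxy)

theorem gen_iterate_le_fastGen {k d : ℕ} {r : ℝ} (hd : d + 1 ≤ k) (hr : 1 ≤ r)
    (hrk : r + d ≤ k) {φ : (ℕ → ℕ) → ℝ} (h : Monotone φ) (s : ℕ) :
    Monotone ((fastGen k d r)^[s] φ) ∧ (gen k d)^[s] φ ≤ (fastGen k d r)^[s] φ := by
  induction s with
  | zero => exact ⟨h, le_rfl⟩
  | succ s ih =>
    simp only [Function.iterate_succ_apply']
    exact ⟨fastGen_monotone (by linarith) (by omega) hrk ih.1,
      (gen_mono hd ih.2).trans (gen_le_fastGen hr ih.1)⟩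

/-- The generator of the gap process. -/
noncomputable def gapGen (k d : ℕ) (r : ℝ) (f : List ℕ → ℝ) (g : List ℕ) : ℝ :=
  (1 - (r + d) / k) * f g + r / k * f (pushGaps g) +
    (∑ j ∈ Finset.range d, f (attGaps j g)) / k

theorem fastGen_iterate_ofGaps {k d : ℕ} (hk : 0 < k) (r : ℝ) (s x : ℕ) (g : List ℕ)
    (hg : g.length = d) :
    (fastGen k d r)^[s] (fun x => (x d : ℝ)) (ofGaps x g) =
      x + d + s * r / k + (gapGen k d r)^[s] (fun g => (g.sum : ℝ)) g := by
  have hk' : (0 : ℝ) < k := by exact_mod_cast hk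
  induction s generalizing x g with
  | zero =>
    subst hg
    simp [ofGaps_last]
  | succ s ih =>
    simp only [Function.iterate_succ_apply']
    rw [fastGen, gapGen, pushStep_single_zero, ih _ _ hg, ih _ _ (by rw [length_pushGaps, hg])]
    have : ∀ j ∈ Finset.range d, (fastGen k d r)^[s] (fun x => (x d : ℝ))
        (pushStep (ofGaps x g) (Pi.single (j + 1) 1)) =
          (x + d + s * r / k) + (gapGen k d r)^[s] (fun g => (g.sum : ℝ)) (attGaps j g) := by
      intro j hj
      rw [pushStep_single_succ _ _ _ (by rw [hg]; exact Finset.mem_range.1 hj),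
        ih _ _ (by rw [length_attGaps, hg])]
    rw [Finset.sum_congr rfl this, Finset.sum_add_distrib, Finset.sum_const, Finset.card_range,
      nsmul_eq_mul]
    push_cast
    field_simp
    ring

open ENNReal in
/-- Integration of functions of `d` gaps against the product of the weights `wt`. -/
noncomputable def gapInt (wt : ℕ → ℝ≥0∞) : ℕ → (List ℕ → ℝ≥0∞) → ℝ≥0∞
  | 0, f => f []
  | d + 1, f => ∑' n, wt n * gapInt wt d (fun g => f (n :: g))

open ENNReal in
theorem gapInt_add (wt : ℕ → ℝ≥0∞) (d : ℕ) (f g : List ℕ → ℝ≥0∞) :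
    gapInt wt d (fun l => f l + g l) = gapInt wt d f + gapInt wt d g := by
  induction d generalizing f g with
  | zero => rfl
  | succ d ih => simp only [gapInt, ih, mul_add, ENNReal.tsum_add]

open ENNReal in
theorem gapInt_mul (wt : ℕ → ℝ≥0∞) (d : ℕ) (a : ℝ≥0∞) (f : List ℕ → ℝ≥0∞) :
    gapInt wt d (fun l => a * f l) = a * gapInt wt d f := by
  induction d generalizing f with
  | zero => rfl
  | succ d ih => simp only [gapInt, ih, ← ENNReal.tsum_mul_left, mul_left_comm]

open ENNReal in
theorem gapInt_sum (wt : ℕ → ℝ≥0∞) (d : ℕ) {ι : Type*} (s : Finset ι)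
    (f : ι → List ℕ → ℝ≥0∞) :
    gapInt wt d (fun l => ∑ i ∈ s, f i l) = ∑ i ∈ s, gapInt wt d (f i) := by
  classical
  induction s using Finset.induction_on with
  | empty => simpa using gapInt_mul wt d 0 (fun _ => 0)
  | insert i s hi ih => simp only [Finset.sum_insert hi, gapInt_add, ih]

open ENNReal in
theorem gapInt_mono (wt : ℕ → ℝ≥0∞) (d : ℕ) {f g : List ℕ → ℝ≥0∞}
    (h : ∀ l, l.length = d → f l ≤ g l) : gapInt wt d f ≤ gapInt wt d g := by
  induction d generalizing f g with
  | zero => exact h [] rfl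
  | succ d ih =>
    refine ENNReal.tsum_le_tsum fun n => ?_
    gcongr
    exact ih fun l hl => h _ (by simp [hl])

open ENNReal in
theorem gapInt_const {wt : ℕ → ℝ≥0∞} (hw : ∑' n, wt n = 1) (d : ℕ) (a : ℝ≥0∞) :
    gapInt wt d (fun _ => a) = a := by
  induction d with
  | zero => rfl
  | succ d ih => simp only [gapInt, ih, ENNReal.tsum_mul_right, hw, one_mul]

open ENNReal in
theorem gapInt_list_sum {wt : ℕ → ℝ≥0∞} (hw : ∑' n, wt n = 1) {m : ℝ≥0∞}
    (hm : ∑' n, wt n * n = m) (d : ℕ) :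
    gapInt wt d (fun l => (l.sum : ℝ≥0∞)) = d * m := by
  induction d with
  | zero => simp [gapInt]
  | succ d ih =>
    simp only [gapInt, List.sum_cons, Nat.cast_add, gapInt_add, gapInt_const hw, ih, mul_add,
      ENNReal.tsum_add, hm, ENNReal.tsum_mul_right, hw]
    push_cast
    ring

open ENNReal in
theorem gapInt_invariant {wt : ℕ → ℝ≥0∞} {r : ℝ≥0∞} (hr : ∀ n, r * wt (n + 1) = wt n) (d : ℕ)
    (f : List ℕ → ℝ≥0∞) :
    r * gapInt wt d (fun g => f (pushGaps g)) +
        ∑ j ∈ Finset.range d, gapInt wt d (fun g => f (attGaps j g)) =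
      (r + d) * gapInt wt d f := by
  induction d generalizing f with
  | zero => simp [gapInt, pushGaps]
  | succ d ih =>
    have h1 : r * gapInt wt (d + 1) (fun g => f (pushGaps g)) =
        r * (wt 0 * gapInt wt d (fun g => f (0 :: pushGaps g))) + gapInt wt (d + 1) f := by
      rw [gapInt, tsum_eq_zero_add' ENNReal.summable, mul_add, ← ENNReal.tsum_mul_left]
      congr 1
      rw [gapInt]
      refine tsum_congr fun n => ?_
      rw [← mul_assoc, hr]
      rfl
    have h2 : gapInt wt (d + 1) (fun g => f (attGaps 0 g)) =
        r * ∑' n, wt (n + 1) * gapInt wt d (fun g => f ((n + 1) :: pushGaps g)) := by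
      rw [gapInt, ← ENNReal.tsum_mul_left]
      refine tsum_congr fun n => ?_
      rw [← mul_assoc, hr]
      rfl
    have h3 : r * (wt 0 * gapInt wt d (fun g => f (0 :: pushGaps g))) +
        r * ∑' n, wt (n + 1) * gapInt wt d (fun g => f ((n + 1) :: pushGaps g)) =
        ∑' n, wt n * (r * gapInt wt d (fun g => f (n :: pushGaps g))) := by
      rw [← mul_add, ← tsum_eq_zero_add' (f := fun n => wt n *
        gapInt wt d (fun g => f (n :: pushGaps g))) ENNReal.summable, ← ENNReal.tsum_mul_left]
      exact tsum_congr fun n => mul_left_comm _ _ _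
    have h4 : ∑ j ∈ Finset.range d, gapInt wt (d + 1) (fun g => f (attGaps (j + 1) g)) =
        ∑' n, wt n * ∑ j ∈ Finset.range d, gapInt wt d (fun g => f (n :: attGaps j g)) := by
      simp only [gapInt, attGaps, Finset.mul_sum]
      rw [Summable.tsum_finsetSum fun _ _ => ENNReal.summable]
    rw [Finset.sum_range_succ', h1, h2, h4]
    calc _ = (r * (wt 0 * gapInt wt d (fun g => f (0 :: pushGaps g))) +
        r * ∑' n, wt (n + 1) * gapInt wt d (fun g => f ((n + 1) :: pushGaps g))) +
        (∑' n, wt n * ∑ j ∈ Finset.range d, gapInt wt d (fun g => f (n :: attGaps j g))) +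
        gapInt wt (d + 1) f := by ring
      _ = ∑' n, wt n * ((r + d) * gapInt wt d (fun g => f (n :: g))) + gapInt wt (d + 1) f := by
        rw [h3, ← ENNReal.tsum_add]
        congr 1
        refine tsum_congr fun n => ?_
        rw [← mul_add, ih (fun g => f (n :: g))]
      _ = _ := by
        simp only [mul_left_comm (wt _) (r + d), ENNReal.tsum_mul_left]
        rw [gapInt]
        push_cast
        ring

theorem gapGen_nonneg {k d : ℕ} {r : ℝ} (hr : 0 ≤ r) (hk : 0 < k) (hrk : r + d ≤ k)
    {f : List ℕ → ℝ} (h : ∀ g, 0 ≤ f g) (g : List ℕ) : 0 ≤ gapGen k d r f g := by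
  have hk' : (0 : ℝ) < k := by exact_mod_cast hk
  have h1 : (0 : ℝ) ≤ 1 - (r + d) / k := by
    rw [sub_nonneg, div_le_one hk']
    exact hrk
  have h2 := h g
  have h3 := h (pushGaps g)
  have h4 : 0 ≤ ∑ j ∈ Finset.range d, f (attGaps j g) := Finset.sum_nonneg fun j _ => h _
  unfold gapGen
  positivity

theorem gapInt_gapGen {k d : ℕ} {r : ℝ} (hr : 0 ≤ r) (hk : 0 < k) (hrk : r + d ≤ k)
    {wt : ℕ → ENNReal} (hw : ∀ n, ENNReal.ofReal r * wt (n + 1) = wt n)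
    {f : List ℕ → ℝ} (h : ∀ g, 0 ≤ f g) :
    gapInt wt d (fun g => ENNReal.ofReal (gapGen k d r f g)) =
      gapInt wt d (fun g => ENNReal.ofReal (f g)) := by
  have hk' : (0 : ℝ) < k := by exact_mod_cast hk
  have h1 : (0 : ℝ) ≤ 1 - (r + d) / k := by
    rw [sub_nonneg, div_le_one hk']
    exact hrk
  have h2 : ∀ g, ENNReal.ofReal (gapGen k d r f g) =
      ENNReal.ofReal (1 - (r + d) / k) * ENNReal.ofReal (f g) +
        ENNReal.ofReal (1 / k) * (ENNReal.ofReal r * ENNReal.ofReal (f (pushGaps g)) +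
          ∑ j ∈ Finset.range d, ENNReal.ofReal (f (attGaps j g))) := by
    intro g
    have h4 : 0 ≤ ∑ j ∈ Finset.range d, f (attGaps j g) := Finset.sum_nonneg fun j _ => h _
    have h5 := mul_nonneg hr (h (pushGaps g))
    rw [← ENNReal.ofReal_sum_of_nonneg fun j _ => h _, ← ENNReal.ofReal_mul hr,
      ← ENNReal.ofReal_add h5 h4, ← ENNReal.ofReal_mul h1, ← ENNReal.ofReal_mul (by positivity),
      ← ENNReal.ofReal_add (mul_nonneg h1 (h g)) (by positivity)]
    congr 1
    unfold gapGen
    ring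
  simp only [h2, gapInt_add, gapInt_mul, gapInt_sum]
  rw [gapInt_invariant hw d (fun g => ENNReal.ofReal (f g)), ← mul_assoc, ← add_mul]
  have h3 : ENNReal.ofReal (1 - (r + d) / k) + ENNReal.ofReal (1 / k) * (ENNReal.ofReal r + d) =
      1 := by
    rw [← ENNReal.ofReal_natCast, ← ENNReal.ofReal_add hr (by positivity),
      ← ENNReal.ofReal_mul (by positivity), ← ENNReal.ofReal_add h1 (by positivity),
      ← ENNReal.ofReal_one]
    congr 1
    field_simp
    ring
  rw [h3, one_mul]

theorem gen_iterate_le {k d : ℕ} {r : ℝ} (hd : d + 1 ≤ k) (hr : 1 < r) (hrk : r + d ≤ k)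
    (s : ℕ) :
    (gen k d)^[s] (fun x => (x d : ℝ)) id ≤ d + d / (r - 1) + r * s / k := by
  have hk : 0 < k := by omega
  have hr0 : 0 < r := by linarith
  have hr1 : 0 < r - 1 := by linarith
  have hφ : Monotone (fun x : ℕ → ℕ => (x d : ℝ)) := fun x y h => Nat.cast_le.2 (h d)
  obtain ⟨hmono, hle⟩ := gen_iterate_le_fastGen hd hr.le hrk hφ s
  have hid : (id : ℕ → ℕ) = ofGaps 0 (List.replicate d 0) := by
    rw [ofGaps_replicate]; funext j; simp
  refine (hle id).trans ?_
  set F := (gapGen k d r)^[s] (fun g => (g.sum : ℝ)) with hF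
  set wt : ℕ → ENNReal := fun n => ENNReal.ofReal ((1 - r⁻¹) * r⁻¹ ^ n) with hwt
  have hri : r⁻¹ < 1 := inv_lt_one_of_one_lt₀ hr
  have hri0 : 0 < r⁻¹ := by positivity
  have hp : 0 ≤ 1 - r⁻¹ := by linarith
  have hw : ∀ n, ENNReal.ofReal r * wt (n + 1) = wt n := by
    intro n
    rw [hwt, ← ENNReal.ofReal_mul hr0.le]
    congr 1
    rw [pow_succ]
    field_simp
  have hsum : ∑' n, wt n = 1 := by
    rw [hwt, ← ENNReal.ofReal_tsum_of_nonneg (fun n => by positivity)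
      ((summable_geometric_of_lt_one hri0.le hri).mul_left _), tsum_mul_left,
      tsum_geometric_of_lt_one hri0.le hri, mul_inv_cancel₀ (by linarith), ENNReal.ofReal_one]
  have hnorm : ‖r⁻¹‖ < 1 := by rwa [Real.norm_of_nonneg hri0.le]
  have hmean : ∑' n, wt n * n = ENNReal.ofReal (1 / (r - 1)) := by
    have h1 : ∀ n : ℕ, wt n * n = ENNReal.ofReal ((1 - r⁻¹) * (n * r⁻¹ ^ n)) := by
      intro n
      rw [hwt, ← ENNReal.ofReal_natCast, ← ENNReal.ofReal_mul (by positivity)]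
      congr 1
      ring
    simp only [h1]
    rw [← ENNReal.ofReal_tsum_of_nonneg (fun n => by positivity)
      (((hasSum_coe_mul_geometric_of_norm_lt_one hnorm).summable).mul_left _), tsum_mul_left,
      tsum_coe_mul_geometric_of_norm_lt_one hnorm]
    congr 1
    have : 1 - r⁻¹ ≠ 0 := by linarith
    field_simp
  have hinv : (∀ g, 0 ≤ F g) ∧
      gapInt wt d (fun g => ENNReal.ofReal (F g)) = d * ENNReal.ofReal (1 / (r - 1)) := by
    rw [← gapInt_list_sum hsum hmean, hF]
    clear hmono hle hF F
    induction s with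
    | zero => exact ⟨fun g => Nat.cast_nonneg _, by simp only [Function.iterate_zero, id,
        ENNReal.ofReal_natCast]⟩
    | succ s ih =>
      rw [Function.iterate_succ_apply']
      exact ⟨gapGen_nonneg hr0.le hk hrk ih.1, (gapInt_gapGen hr0.le hk hrk hw ih.1).trans ih.2⟩
  have hmin : ∀ g, g.length = d → F (List.replicate d 0) ≤ F g := by
    intro g hg
    have := hmono (ofGaps_replicate_le 0 d g)
    rw [fastGen_iterate_ofGaps hk _ _ _ _ hg, fastGen_iterate_ofGaps hk _ _ _ _ (by simp)] at this
    linarith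
  have h5 : ENNReal.ofReal (F (List.replicate d 0)) ≤ d * ENNReal.ofReal (1 / (r - 1)) := by
    rw [← hinv.2, ← gapInt_const hsum d (ENNReal.ofReal (F (List.replicate d 0)))]
    exact gapInt_mono wt d fun g hg => ENNReal.ofReal_le_ofReal (hmin g hg)
  rw [← ENNReal.ofReal_natCast, ← ENNReal.ofReal_mul (by positivity),
    ENNReal.ofReal_le_ofReal_iff (by positivity)] at h5
  rw [hid, fastGen_iterate_ofGaps hk _ _ _ _ (by simp)]
  rw [mul_one_div] at h5
  have h6 : (s : ℝ) * r / k = r * s / k := by ring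
  rw [← hF, h6, Nat.cast_zero]
  linarith

theorem gen_iterate_le_sqrt {k d : ℕ} (hd0 : 1 ≤ d) (hd : d + 2 ≤ k) (s : ℕ) :
    (gen k d)^[s] (fun x => (x d : ℝ)) id ≤ s / k + 2 * √(d * s / k) + 2 * d := by
  have hd' : (1 : ℝ) ≤ d := by exact_mod_cast hd0
  have hdk : (d : ℝ) + 2 ≤ k := by exact_mod_cast hd
  have hk : (0 : ℝ) < k := by linarith
  set t : ℝ := s / k with ht
  have hts : (d : ℝ) * s / k = d * t := by rw [ht]; ring
  have ht0 : 0 ≤ t := by positivity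
  rw [hts, Real.sqrt_mul (by positivity)]
  set a := √(d : ℝ) with ha
  set b := √t with hb
  have ha2 : a ^ 2 = d := Real.sq_sqrt (by positivity)
  have hb2 : b ^ 2 = t := Real.sq_sqrt ht0
  have ha0 : 0 < a := Real.sqrt_pos.2 (by linarith)
  have hb0 : 0 ≤ b := Real.sqrt_nonneg _
  by_cases h : a ≤ b
  · have hbp : 0 < b := by linarith
    have h1 : a / b ≤ 1 := (div_le_one hbp).2 h
    have h2 : 0 < a / b := by positivity
    have := gen_iterate_le (r := 1 + a / b) (by omega : d + 1 ≤ k) (by linarith) (by linarith) s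
    refine this.trans ?_
    have e1 : (d : ℝ) / (1 + a / b - 1) = a * b := by rw [add_sub_cancel_left, ← ha2]; field_simp
    have e2 : (1 + a / b) * s / k = t + a * b := by
      have : (1 + a / b) * s / k = (1 + a / b) * t := by rw [ht]; ring
      rw [this, ← hb2]; field_simp
    rw [e1, e2]
    linarith
  · push Not at h
    have := gen_iterate_le (r := 2) (by omega : d + 1 ≤ k) (by linarith) (by linarith) s
    refine this.trans ?_
    have e2 : (2 : ℝ) * s / k = 2 * t := by rw [ht]; ring
    rw [e2]
    have : t ≤ a * b := by rw [← hb2]; nlinarith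
    norm_num
    nlinarith [mul_nonneg ha0.le hb0]

/-! ### A determinantal formula for the idealized dynamics -/

section Determinant

open Polynomial

/-- The truncated binomial `C(X + j - y, j)`. -/
def eb (X j y : ℕ) : ℝ := if y ≤ X then ((X + j - y).choose j : ℝ) else 0

/-- Negated forward difference. -/
def nd (f : ℕ → ℝ) (y : ℕ) : ℝ := f y - f (y + 1)

theorem eb_of_lt {X y : ℕ} (j : ℕ) (h : X < y) : eb X j y = 0 := if_neg (by omega)

theorem nd_eb_succ (X j : ℕ) : nd (eb X (j + 1)) = eb X j := by
  funext y
  unfold nd eb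
  rcases lt_trichotomy y X with h | h | h
  · rw [if_pos (by omega), if_pos (by omega), if_pos (by omega),
      show X + (j + 1) - y = (X + j - y) + 1 by omega,
      show X + (j + 1) - (y + 1) = X + j - y by omega, Nat.choose_succ_succ]
    push_cast
    ring
  · subst h
    simp [show y + (j + 1) - y = j + 1 by omega]
  · rw [if_neg (by omega), if_neg (by omega), if_neg (by omega), sub_zero]

theorem nd_iterate_eb_self (X j : ℕ) : nd^[j] (eb X j) = eb X 0 := by
  induction j with
  | zero => rfl
  | succ j ih => rw [Function.iterate_succ_apply, nd_eb_succ, ih]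

theorem nd_iterate_eq_zero_of_lt {f : ℕ → ℝ} {X : ℕ} (hf : ∀ y, X < y → f y = 0) (i : ℕ) {y : ℕ}
    (h : X < y) : nd^[i] f y = 0 := by
  induction i generalizing y with
  | zero => exact hf y h
  | succ i ih => rw [Function.iterate_succ_apply', nd, ih h, ih (by omega), sub_zero]

theorem nd_iterate_eb_zero (X r : ℕ) {y : ℕ} (h : y + (r + 1) ≤ X) : nd^[r + 1] (eb X 0) y = 0 := by
  induction r generalizing y with
  | zero => simp [nd, eb, show y ≤ X by omega, show y + 1 ≤ X by omega]
  | succ r ih => rw [Function.iterate_succ_apply', nd, ih (by omega), ih (by omega), sub_zero]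

theorem nd_iterate_eb_of_lt (X : ℕ) {i j : ℕ} (hij : j < i) {y : ℕ} (h : y + (i - j) ≤ X) :
    nd^[i] (eb X j) y = 0 := by
  obtain ⟨r, rfl⟩ : ∃ r, i = (r + 1) + j := ⟨i - j - 1, by omega⟩
  rw [Function.iterate_add_apply, nd_iterate_eb_self]
  exact nd_iterate_eb_zero X r (by omega)

/-- Generating polynomial of the values of `nd^[i] (eb X j)` from `y` on. -/
noncomputable def qp (X i j y : ℕ) : ℝ[X] :=
  ∑ n ∈ Finset.range (X + 1), monomial n (nd^[i] (eb X j) (y + n) / (n.factorial : ℝ))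

theorem coeff_qp (X i j y n : ℕ) :
    (qp X i j y).coeff n = nd^[i] (eb X j) (y + n) / (n.factorial : ℝ) := by
  simp only [qp, finsetSum_coeff, coeff_monomial, Finset.sum_ite_eq', Finset.mem_range]
  split_ifs with h
  · rfl
  · rw [nd_iterate_eq_zero_of_lt (fun y hy => eb_of_lt j hy) i (by omega), zero_div]

theorem derivative_qp (X i j y : ℕ) : derivative (qp X i j y) = qp X i j (y + 1) := by
  ext n
  rw [coeff_derivative, coeff_qp, coeff_qp, Nat.factorial_succ,
    show y + (n + 1) = y + 1 + n by omega]
  have : (n.factorial : ℝ) ≠ 0 := by positivity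
  have : (n : ℝ) + 1 ≠ 0 := by positivity
  push_cast
  field_simp

theorem qp_succ_succ (X i j y : ℕ) :
    qp X i (j + 1) (y + 1) = qp X i (j + 1) y + (-1 : ℝ[X]) * qp X i j y := by
  ext n
  rw [neg_one_mul, coeff_add, coeff_neg]
  simp only [coeff_qp]
  rw [← nd_eb_succ X j, ← Function.iterate_succ_apply, Function.iterate_succ_apply', nd,
    show y + 1 + n = y + n + 1 by omega]
  ring

/-- The determinant attached to a configuration of particles `0, …, d`. -/
noncomputable def Dp (X d : ℕ) (x : ℕ → ℕ) : ℝ[X] :=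
  (Matrix.of fun i j : Fin (d + 1) => qp X i j (x j)).det

theorem Dp_congr {X d : ℕ} {x y : ℕ → ℕ} (h : ∀ j ≤ d, x j = y j) : Dp X d x = Dp X d y := by
  unfold Dp
  congr 1
  ext i j : 2
  simp only [Matrix.of_apply]
  rw [h j (by omega)]

theorem derivative_Dp (X d : ℕ) (x : ℕ → ℕ) :
    derivative (Dp X d x) = ∑ j ∈ Finset.range (d + 1), Dp X d (x + Pi.single j 1) := by
  rw [Finset.sum_range]
  simp only [Dp, Matrix.det_apply', Matrix.of_apply]
  rw [derivative_sum, Finset.sum_comm]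
  refine Finset.sum_congr rfl fun σ _ => ?_
  rw [← Finset.mul_sum]
  have h0 : ∀ p : ℝ[X], derivative (((Equiv.Perm.sign σ : ℤ) : ℝ[X]) * p) =
      ((Equiv.Perm.sign σ : ℤ) : ℝ[X]) * derivative p := fun p => by
    rw [derivative_mul, derivative_intCast, zero_mul, zero_add]
  rw [h0, derivative_prod_finset]
  congr 1
  refine Finset.sum_congr rfl fun j _ => ?_
  rw [derivative_qp, ← Finset.prod_erase_mul _ _ (Finset.mem_univ j)]
  congr 1
  · refine Finset.prod_congr rfl fun i hi => ?_
    have : (i : ℕ) ≠ j := fun h => (Finset.ne_of_mem_erase hi) (Fin.ext h)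
    simp [this]
  · simp

theorem Dp_update_succ {X d j : ℕ} (hj : j + 1 ≤ d) {x : ℕ → ℕ} (h : x (j + 1) = x j) :
    Dp X d (Function.update x (j + 1) (x (j + 1) + 1)) = Dp X d x := by
  unfold Dp
  set M := Matrix.of fun i j : Fin (d + 1) => qp X i j (x j) with hM
  have hne : (⟨j + 1, by omega⟩ : Fin (d + 1)) ≠ ⟨j, by omega⟩ := by simp
  rw [← Matrix.det_updateCol_add_smul_self M hne (-1)]
  congr 1
  ext i t : 2
  simp only [Matrix.of_apply, Matrix.updateCol_apply]
  split_ifs with ht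
  · subst ht
    simp only [Function.update_self, smul_eq_mul, hM, Matrix.of_apply]
    rw [qp_succ_succ, h]
  · have : (t : ℕ) ≠ j + 1 := fun h => ht (Fin.ext h)
    rw [Function.update_of_ne this, hM, Matrix.of_apply]

theorem Dp_add_single {X d i : ℕ} (hi : i ≤ d) {x : ℕ → ℕ} (hx : StrictMono x) :
    Dp X d (x + Pi.single i 1) = Dp X d (pushStep x (Pi.single i 1)) := by
  set y := pushStep x (Pi.single i 1) with hy
  have hle : ∀ j, y j ≤ x j + 1 := fun j => by
    refine pushStep_le hx (fun j => ?_) j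
    by_cases h : j = i <;> simp [h]
  have key : ∀ m, i ≤ m → m ≤ d →
      Dp X d (x + Pi.single i 1) = Dp X d (fun t => if t ≤ m then y t else x t) := by
    intro m him
    induction m, him using Nat.le_induction with
    | base =>
      intro _
      refine Dp_congr fun j _ => ?_
      split_ifs with hj
      · have : ∀ j ≤ i, y j = x j + (Pi.single i 1 : ℕ → ℕ) j := by
          intro j
          induction j with
          | zero => intro _; rfl
          | succ j ih =>
            intro hj
            rw [hy, pushStep, ← hy, ih (by omega), Pi.single_eq_of_ne (by omega : j ≠ i)]
            have := hx (Nat.lt_succ_self j)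
            simp only [Nat.succ_eq_add_one] at this
            omega
        rw [this j hj]; rfl
      · simp [show j ≠ i by omega]
    | succ m him ih =>
      intro hm
      rw [ih (by omega)]
      have h1 : y (m + 1) = max (x (m + 1)) (y m + 1) := by
        rw [hy, pushStep, Pi.single_eq_of_ne (by omega : m + 1 ≠ i), add_zero]
      have h2 := hle m
      have h3 : x m < x (m + 1) := hx (Nat.lt_succ_self m)
      by_cases h : y m + 1 ≤ x (m + 1)
      · refine Dp_congr fun j _ => ?_
        by_cases hj : j = m + 1
        · subst hj
          simp only [Nat.not_succ_le_self, if_false, le_refl, if_true]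
          omega
        · simp only [show j ≤ m ↔ j ≤ m + 1 by omega]
      · rw [← Dp_update_succ hm (x := fun t => if t ≤ m then y t else x t)]
        · refine Dp_congr fun j _ => ?_
          by_cases hj : j = m + 1
          · subst hj
            simp only [Function.update_self, Nat.not_succ_le_self, if_false, le_refl, if_true]
            omega
          · rw [Function.update_of_ne hj]
            simp only [show j ≤ m ↔ j ≤ m + 1 by omega]
        · simp only [Nat.not_succ_le_self, if_false, le_refl, if_true]
          omega
  rw [key d hi le_rfl]
  exact Dp_congr fun j hj => if_pos hj

theorem coeff_zero_Dp (X d : ℕ) {x : ℕ → ℕ} (hx : StrictMono x) :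
    (Dp X d x).coeff 0 = if x d ≤ X then 1 else 0 := by
  rw [← constantCoeff_apply, Dp, RingHom.map_det, RingHom.mapMatrix_apply]
  have hent : ∀ i j : Fin (d + 1),
      (Matrix.of fun i j : Fin (d + 1) => qp X i j (x j)).map (constantCoeff (R := ℝ)) i j =
        nd^[i] (eb X j) (x j) := fun i j => by
    simp [Matrix.map_apply, constantCoeff_apply, coeff_qp]
  split_ifs with h
  · have hx' : ∀ j ≤ d, x j + (d - j) ≤ x d := by
      intro j hj
      have := hx.add_le_nat (d - j) j
      rw [show d - j + j = d by omega] at this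
      omega
    rw [Matrix.det_of_isUpperTriangular]
    · refine Finset.prod_eq_one fun i _ => ?_
      rw [hent, nd_iterate_eb_self]
      have := hx' i (by omega)
      simp [eb, show x i ≤ X by omega]
    · intro i j hij
      have hij' : (j : ℕ) < i := hij
      rw [hent]
      exact nd_iterate_eb_of_lt X hij' (by have := hx' j (by omega); omega)
  · refine Matrix.det_eq_zero_of_column_eq_zero (Fin.last d) fun i => ?_
    rw [hent]
    exact nd_iterate_eq_zero_of_lt (fun y hy => eb_of_lt _ hy) _ (by simp; omega)

/-- Sum over all pushes of the particles `0, …, d`. -/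
def pushSum (d : ℕ) (φ : (ℕ → ℕ) → ℝ) (x : ℕ → ℕ) : ℝ :=
  ∑ j ∈ Finset.range (d + 1), φ (pushStep x (Pi.single j 1))

theorem factorial_mul_coeff_Dp (X d N : ℕ) {x : ℕ → ℕ} (hx : StrictMono x) :
    (N.factorial : ℝ) * (Dp X d x).coeff N =
      (pushSum d)^[N] (fun x => if x d ≤ X then 1 else 0) x := by
  induction N generalizing x with
  | zero => simp [coeff_zero_Dp X d hx]
  | succ N ih =>
    have h : (Dp X d x).coeff (N + 1) * (N + 1) =
        ∑ j ∈ Finset.range (d + 1), (Dp X d (pushStep x (Pi.single j 1))).coeff N := by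
      rw [← coeff_derivative, derivative_Dp, finsetSum_coeff]
      refine Finset.sum_congr rfl fun j hj => ?_
      rw [Dp_add_single (by simpa [Nat.lt_succ_iff] using hj) hx]
    rw [Function.iterate_succ_apply', pushSum, Nat.factorial_succ]
    simp only [← ih (pushStep_strictMono _ _)]
    rw [← Finset.mul_sum, ← h]
    push_cast
    ring

end Determinant

/-! ### Poissonization -/

/-- Poisson weights. -/
noncomputable def pw (θ : ℝ) (n : ℕ) : ℝ := Real.exp (-θ) * (θ ^ n / n.factorial)

theorem pw_nonneg {θ : ℝ} (hθ : 0 ≤ θ) (n : ℕ) : 0 ≤ pw θ n := by unfold pw; positivity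

theorem hasSum_pw (θ : ℝ) : HasSum (pw θ) 1 := by
  have h := (NormedSpace.expSeries_div_hasSum_exp (𝔸 := ℝ) θ).mul_left (Real.exp (-θ))
  rw [← Real.exp_eq_exp_ℝ, ← Real.exp_add, neg_add_cancel, Real.exp_zero] at h
  exact h

theorem pw_succ_mul {θ : ℝ} (hθ : θ ≠ 0) (n : ℕ) : pw θ (n + 1) * ((n + 1 : ℕ) / θ) = pw θ n := by
  unfold pw
  rw [Nat.factorial_succ]
  have : (n.factorial : ℝ) ≠ 0 := by positivity
  have : (n : ℝ) + 1 ≠ 0 := by positivity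
  push_cast
  field_simp
  ring

theorem gen_iterate_eq_sum (k d N : ℕ) (φ : (ℕ → ℕ) → ℝ) (x : ℕ → ℕ) :
    (gen k d)^[N] φ x = ∑ m ∈ Finset.range (N + 1),
      (N.choose m : ℝ) * (1 - ((d : ℝ) + 1) / k) ^ (N - m) * ((k : ℝ)⁻¹) ^ m *
        (pushSum d)^[m] φ x := by
  let V : Module.End ℝ ((ℕ → ℕ) → ℝ) :=
    { toFun := pushSum d
      map_add' := fun f g => by
        funext x
        simp [pushSum, Finset.sum_add_distrib]
      map_smul' := fun a f => by
        funext x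
        simp [pushSum, Finset.mul_sum] }
  have hU : gen k d = 
      ⇑((k : ℝ)⁻¹ • V + (1 - ((d : ℝ) + 1) / k) • 1 : Module.End ℝ ((ℕ → ℕ) → ℝ)) := by
    funext φ x
    change (1 - ((d : ℝ) + 1) / k) * φ x +
        (∑ j ∈ Finset.range (d + 1), φ (pushStep x (Pi.single j 1))) / k =
      (k : ℝ)⁻¹ * (∑ j ∈ Finset.range (d + 1), φ (pushStep x (Pi.single j 1))) +
        (1 - ((d : ℝ) + 1) / k) * φ x
    ring
  have hV : ∀ m, (pushSum d)^[m] φ = (V ^ m) φ := fun m => by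
    rw [Module.End.pow_apply]; rfl
  rw [hU, ← Module.End.pow_apply]
  rw [Commute.add_pow (by
    refine Commute.smul_left (Commute.smul_right ?_ _) _
    exact Commute.one_right V)]
  rw [LinearMap.sum_apply, Finset.sum_apply]
  refine Finset.sum_congr rfl fun m _ => ?_
  rw [hV, smul_pow, smul_pow, one_pow]
  have : ((N.choose m : ℕ) : Module.End ℝ ((ℕ → ℕ) → ℝ)) =
      ((N.choose m : ℕ) : ℝ) • (1 : Module.End ℝ ((ℕ → ℕ) → ℝ)) := by
    rw [← nsmul_one, ← Nat.cast_smul_eq_nsmul ℝ]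
  rw [this]
  simp only [smul_mul_smul_comm, mul_one, LinearMap.smul_apply, Pi.smul_apply, smul_eq_mul]
  ring

theorem hasSum_pw_mul_gen_iterate {k : ℕ} (hk : k ≠ 0) (d X : ℕ) {x : ℕ → ℕ} (hx : StrictMono x)
    (L : ℝ) :
    HasSum (fun N => pw L N * (gen k d)^[N] (fun x => if x d ≤ X then 1 else 0) x)
      (Real.exp (-((d + 1) * (L / k))) * (Dp X d x).eval (L / k)) := by
  have hk' : (k : ℝ) ≠ 0 := by exact_mod_cast hk
  set c : ℝ := 1 - ((d : ℝ) + 1) / k with hc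
  have h1 : HasSum (fun n => (L * c) ^ n / (n.factorial : ℝ)) (Real.exp (L * c)) := by
    rw [Real.exp_eq_exp_ℝ]
    exact NormedSpace.expSeries_div_hasSum_exp (𝔸 := ℝ) (L * c)
  have h2 : HasSum (fun n => (Dp X d x).coeff n * (L / k) ^ n) ((Dp X d x).eval (L / k)) := by
    rw [Polynomial.eval_eq_sum_range]
    refine hasSum_sum_of_ne_finset_zero fun n hn => ?_
    rw [Polynomial.coeff_eq_zero_of_natDegree_lt (by simpa using hn), zero_mul]
  have hn1 : Summable fun n => ‖(L * c) ^ n / (n.factorial : ℝ)‖ := h1.summable.norm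
  have hn2 : Summable fun n => ‖(Dp X d x).coeff n * (L / k) ^ n‖ := h2.summable.norm
  have h3 := (summable_norm_sum_mul_antidiagonal_of_summable_norm hn2 hn1).of_norm.hasSum
  rw [← tsum_mul_tsum_eq_tsum_sum_antidiagonal_of_summable_norm hn2 hn1, h1.tsum_eq, h2.tsum_eq]
    at h3
  have h4 := h3.mul_left (Real.exp (-L))
  have hs : Real.exp (-L) * (Polynomial.eval (L / k) (Dp X d x) * Real.exp (L * c)) =
      Real.exp (-((d + 1) * (L / k))) * (Dp X d x).eval (L / k) := by
    rw [mul_comm (Polynomial.eval _ _), ← mul_assoc, ← Real.exp_add]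
    congr 2
    rw [hc]
    field_simp
    ring
  rw [hs] at h4
  suffices key : ∀ N, pw L N * (gen k d)^[N] (fun x => if x d ≤ X then 1 else 0) x =
      Real.exp (-L) * ∑ kl ∈ Finset.HasAntidiagonal.antidiagonal N,
        (Dp X d x).coeff kl.1 * (L / k) ^ kl.1 * ((L * c) ^ kl.2 / (kl.2.factorial : ℝ)) by
    simpa only [key] using h4
  intro N
  rw [gen_iterate_eq_sum, pw, Finset.Nat.sum_antidiagonal_eq_sum_range_succ_mk, mul_assoc,
    Finset.mul_sum]
  congr 1
  refine Finset.sum_congr rfl fun m hm => ?_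
  have hm' : m ≤ N := by simpa [Nat.lt_succ_iff] using hm
  rw [← factorial_mul_coeff_Dp X d m hx, Nat.cast_choose ℝ hm', ← hc]
  have e1 : (N.factorial : ℝ) ≠ 0 := by positivity
  have e2 : (m.factorial : ℝ) ≠ 0 := by positivity
  have e3 : ((N - m).factorial : ℝ) ≠ 0 := by positivity
  have e4 : L ^ N = L ^ m * L ^ (N - m) := by rw [← pow_add]; congr 1; omega
  simp only []
  rw [e4, mul_pow, div_pow, inv_pow]
  field_simp

theorem exp_mul_eval_Dp (X d : ℕ) (x : ℕ → ℕ) (θ : ℝ) :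
    Real.exp (-((d + 1) * θ)) * (Dp X d x).eval θ =
      (Matrix.of fun i j : Fin (d + 1) =>
        ∑ n ∈ Finset.range (X + 1), pw θ n * nd^[i] (eb X j) (x j + n)).det := by
  rw [Dp, ← Polynomial.coe_evalRingHom, RingHom.map_det, RingHom.mapMatrix_apply]
  have : Real.exp (-((d + 1) * θ)) = Real.exp (-θ) ^ Fintype.card (Fin (d + 1)) := by
    rw [← Real.exp_nat_mul, Fintype.card_fin]
    congr 1
    push_cast
    ring
  rw [this, ← Matrix.det_smul]
  congr 1
  ext i j
  simp only [Matrix.smul_apply, Matrix.map_apply, Matrix.of_apply, smul_eq_mul, qp,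
    Polynomial.coe_evalRingHom, Polynomial.eval_finsetSum, Polynomial.eval_monomial,
    Finset.mul_sum, pw]
  refine Finset.sum_congr rfl fun n _ => ?_
  ring

/-! ### Poisson expectations and Charlier polynomials -/

/-- Functions of at most exponential growth. -/
def ExpBdd (f : ℕ → ℝ) : Prop := ∃ C r : ℝ, 0 ≤ C ∧ 1 ≤ r ∧ ∀ y, |f y| ≤ C * r ^ y

namespace ExpBdd

theorem mono {f g : ℕ → ℝ} (hg : ExpBdd g) (h : ∀ y, |f y| ≤ |g y|) : ExpBdd f := by
  obtain ⟨C, r, hC, hr, hb⟩ := hg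
  exact ⟨C, r, hC, hr, fun y => (h y).trans (hb y)⟩

theorem const (a : ℝ) : ExpBdd fun _ => a :=
  ⟨|a|, 1, abs_nonneg a, le_rfl, fun y => by simp⟩

theorem natCast : ExpBdd fun y => (y : ℝ) := by
  refine ⟨1, 2, zero_le_one, one_le_two, fun y => ?_⟩
  rw [one_mul, abs_of_nonneg (Nat.cast_nonneg y)]
  beta_reduce
  exact_mod_cast (Nat.lt_two_pow_self (n := y)).le

theorem add {f g : ℕ → ℝ} (hf : ExpBdd f) (hg : ExpBdd g) : ExpBdd fun y => f y + g y := by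
  obtain ⟨C, r, hC, hr, hb⟩ := hf
  obtain ⟨C', r', hC', hr', hb'⟩ := hg
  refine ⟨C + C', max r r', add_nonneg hC hC', hr.trans (le_max_left _ _), fun y => ?_⟩
  refine (abs_add_le _ _).trans ?_
  rw [add_mul]
  have h1 : r ^ y ≤ max r r' ^ y := pow_le_pow_left₀ (by linarith) (le_max_left _ _) _
  have h2 : r' ^ y ≤ max r r' ^ y := pow_le_pow_left₀ (by linarith) (le_max_right _ _) _
  exact add_le_add ((hb y).trans (mul_le_mul_of_nonneg_left h1 hC))
    ((hb' y).trans (mul_le_mul_of_nonneg_left h2 hC'))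

theorem mul {f g : ℕ → ℝ} (hf : ExpBdd f) (hg : ExpBdd g) : ExpBdd fun y => f y * g y := by
  obtain ⟨C, r, hC, hr, hb⟩ := hf
  obtain ⟨C', r', hC', hr', hb'⟩ := hg
  refine ⟨C * C', r * r', mul_nonneg hC hC', one_le_mul_of_one_le_of_one_le hr hr', fun y => ?_⟩
  rw [abs_mul, mul_pow, show C * C' * (r ^ y * r' ^ y) = C * r ^ y * (C' * r' ^ y) by ring]
  exact mul_le_mul (hb y) (hb' y) (abs_nonneg _) (by positivity)

theorem const_mul {f : ℕ → ℝ} (hf : ExpBdd f) (a : ℝ) : ExpBdd fun y => a * f y :=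
  (const a).mul hf

theorem neg {f : ℕ → ℝ} (hf : ExpBdd f) : ExpBdd fun y => -f y :=
  hf.mono fun y => by rw [abs_neg]

theorem sub {f g : ℕ → ℝ} (hf : ExpBdd f) (hg : ExpBdd g) : ExpBdd fun y => f y - g y := by
  simpa only [sub_eq_add_neg] using hf.add hg.neg

theorem sum {ι : Type*} {s : Finset ι} {f : ι → ℕ → ℝ} (hf : ∀ i ∈ s, ExpBdd (f i)) :
    ExpBdd fun y => ∑ i ∈ s, f i y := by
  classical
  induction s using Finset.induction_on with
  | empty => simpa using const 0
  | insert a s ha ih =>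
    simp only [Finset.sum_insert ha]
    exact (hf a (Finset.mem_insert_self _ _)).add
      (ih fun i hi => hf i (Finset.mem_insert_of_mem hi))

theorem succ {f : ℕ → ℝ} (hf : ExpBdd f) : ExpBdd fun y => f (y + 1) := by
  obtain ⟨C, r, hC, hr, hb⟩ := hf
  refine ⟨C * r, r, by positivity, hr, fun y => (hb _).trans_eq (by ring)⟩

theorem pred {f : ℕ → ℝ} (hf : ExpBdd f) : ExpBdd fun y => f (y - 1) := by
  obtain ⟨C, r, hC, hr, hb⟩ := hf
  refine ⟨C, r, hC, hr, fun y => (hb _).trans ?_⟩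
  exact mul_le_mul_of_nonneg_left (pow_le_pow_right₀ hr (Nat.sub_le _ _)) hC

theorem indicator (p : ℕ → Prop) [DecidablePred p] : ExpBdd fun y => if p y then 1 else 0 :=
  (const 1).mono fun y => by split_ifs <;> simp

theorem summable {f : ℕ → ℝ} (hf : ExpBdd f) (θ : ℝ) : Summable fun y => pw θ y * f y := by
  obtain ⟨C, r, hC, hr, hb⟩ := hf
  have h1 := ((NormedSpace.expSeries_div_summable (𝔸 := ℝ) (|θ| * r)).mul_left
    (Real.exp (-θ) * C))
  refine Summable.of_norm_bounded h1 fun y => ?_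
  rw [Real.norm_eq_abs, abs_mul, pw, abs_mul, abs_div, abs_pow, abs_of_pos (Real.exp_pos _),
    Nat.abs_cast, mul_pow]
  calc Real.exp (-θ) * (|θ| ^ y / (y.factorial : ℝ)) * |f y|
      ≤ Real.exp (-θ) * (|θ| ^ y / (y.factorial : ℝ)) * (C * r ^ y) :=
        mul_le_mul_of_nonneg_left (hb y) (by positivity)
    _ = _ := by ring

end ExpBdd

/-- Expectation under the Poisson distribution. -/
noncomputable def pe (θ : ℝ) (f : ℕ → ℝ) : ℝ := ∑' y, pw θ y * f y

theorem pe_add {f g : ℕ → ℝ} (θ : ℝ) (hf : ExpBdd f) (hg : ExpBdd g) :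
    pe θ (fun y => f y + g y) = pe θ f + pe θ g := by
  simp only [pe, mul_add]
  exact (hf.summable θ).tsum_add (hg.summable θ)

theorem pe_sub {f g : ℕ → ℝ} (θ : ℝ) (hf : ExpBdd f) (hg : ExpBdd g) :
    pe θ (fun y => f y - g y) = pe θ f - pe θ g := by
  simp only [pe, mul_sub]
  exact (hf.summable θ).tsum_sub (hg.summable θ)

theorem pe_const_mul (θ a : ℝ) (f : ℕ → ℝ) : pe θ (fun y => a * f y) = a * pe θ f := by
  simp only [pe, mul_left_comm _ a]
  exact tsum_mul_left

theorem pe_one (θ : ℝ) : pe θ (fun _ => 1) = 1 := by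
  simpa [pe] using (hasSum_pw θ).tsum_eq

theorem pe_sum {ι : Type*} {s : Finset ι} {f : ι → ℕ → ℝ} (θ : ℝ) (hf : ∀ i ∈ s, ExpBdd (f i)) :
    pe θ (fun y => ∑ i ∈ s, f i y) = ∑ i ∈ s, pe θ (f i) := by
  simp only [pe, Finset.mul_sum]
  exact Summable.tsum_finsetSum fun i hi => (hf i hi).summable θ

theorem pe_mono {f g : ℕ → ℝ} {θ : ℝ} (hθ : 0 ≤ θ) (hf : ExpBdd f) (hg : ExpBdd g)
    (h : ∀ y, f y ≤ g y) : pe θ f ≤ pe θ g :=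
  (hf.summable θ).tsum_le_tsum (fun y => mul_le_mul_of_nonneg_left (h y) (pw_nonneg hθ y))
    (hg.summable θ)

theorem pe_nonneg {f : ℕ → ℝ} {θ : ℝ} (hθ : 0 ≤ θ) (h : ∀ y, 0 ≤ f y) : 0 ≤ pe θ f :=
  tsum_nonneg fun y => mul_nonneg (pw_nonneg hθ y) (h y)

theorem pe_pred {θ : ℝ} (hθ : θ ≠ 0) {f : ℕ → ℝ} (hf : ExpBdd f) :
    pe θ (fun y => y / θ * f (y - 1)) = pe θ f := by
  unfold pe
  have h : ExpBdd fun y : ℕ => (y : ℝ) / θ * f (y - 1) := by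
    simpa only [div_eq_inv_mul, mul_assoc] using (ExpBdd.natCast.mul hf.pred).const_mul θ⁻¹
  rw [(h.summable θ).tsum_eq_zero_add]
  simp only [Nat.cast_zero, zero_div, zero_mul, mul_zero, zero_add, Nat.add_sub_cancel]
  refine tsum_congr fun y => ?_
  rw [← mul_assoc, pw_succ_mul hθ]

/-- Charlier polynomials. -/
noncomputable def ch (θ : ℝ) : ℕ → ℕ → ℝ
  | 0, _ => 1
  | i + 1, y => ch θ i y - y / θ * ch θ i (y - 1)

theorem expBdd_ch (θ : ℝ) (i : ℕ) : ExpBdd (ch θ i) := by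
  induction i with
  | zero => exact ExpBdd.const 1
  | succ i ih =>
    refine ih.sub ?_
    simpa only [div_eq_inv_mul, mul_assoc] using (ExpBdd.natCast.mul ih.pred).const_mul θ⁻¹

theorem pe_mul_ch_succ {θ : ℝ} (hθ : θ ≠ 0) {f : ℕ → ℝ} (hf : ExpBdd f) (i : ℕ) :
    pe θ (fun y => f y * ch θ (i + 1) y) = pe θ (fun y => nd f y * ch θ i y) := by
  have h1 : ∀ y, f y * ch θ (i + 1) y =
      f y * ch θ i y - y / θ * (f (y - 1 + 1) * ch θ i (y - 1)) := by
    intro y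
    cases y with
    | zero => simp [ch]
    | succ y => simp only [ch, Nat.add_sub_cancel]; ring
  have hc := expBdd_ch θ i
  have hs := hf.succ.mul hc
  simp only [h1]
  rw [pe_sub θ (hf.mul hc), pe_pred hθ hs, ← pe_sub θ (hf.mul hc) hs]
  · simp only [nd, sub_mul]
  · simpa only [div_eq_inv_mul, mul_assoc] using (ExpBdd.natCast.mul hs.pred).const_mul θ⁻¹

theorem ExpBdd.nd {f : ℕ → ℝ} (hf : ExpBdd f) : ExpBdd (nd f) := hf.sub hf.succ

theorem pe_mul_ch {θ : ℝ} (hθ : θ ≠ 0) {f : ℕ → ℝ} (hf : ExpBdd f) (i : ℕ) :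
    pe θ (fun y => f y * ch θ i y) = pe θ (nd^[i] f) := by
  induction i generalizing f with
  | zero => simp [ch]
  | succ i ih => rw [pe_mul_ch_succ hθ hf, ih hf.nd, Function.iterate_succ_apply]

theorem ch_succ_sub (θ : ℝ) (i y : ℕ) :
    ch θ i (y + 1) - ch θ i y = -(i / θ) * ch θ (i - 1) y := by
  induction i generalizing y with
  | zero => simp [ch]
  | succ i ih =>
    have h1 : (y : ℝ) / θ * (ch θ i y - ch θ i (y - 1)) =
        -((i : ℝ) / θ) * (y / θ * ch θ (i - 1) (y - 1)) := by
      cases y with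
      | zero => simp
      | succ y => rw [Nat.add_sub_cancel, ih]; ring
    have h2 : (i : ℝ) / θ * ch θ i y =
        i / θ * (ch θ (i - 1) y - y / θ * ch θ (i - 1) (y - 1)) := by
      cases i with
      | zero => simp
      | succ i => rfl
    have h3 := ih y
    simp only [ch, Nat.add_sub_cancel]
    push_cast
    rw [add_div, add_div]
    linear_combination h3 + h2 - h1

theorem natCast_mul_ch {θ : ℝ} (hθ : θ ≠ 0) (i y : ℕ) :
    y * ch θ i y = -θ * ch θ (i + 1) y + (θ + i) * ch θ i y - i * ch θ (i - 1) y := by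
  have h1 : (y : ℝ) / θ * (ch θ i y - ch θ i (y - 1)) =
      -((i : ℝ) / θ) * (y / θ * ch θ (i - 1) (y - 1)) := by
    cases y with
    | zero => simp
    | succ y => rw [Nat.add_sub_cancel, ch_succ_sub θ]; ring
  have h2 : (i : ℝ) / θ * ch θ i y =
      i / θ * (ch θ (i - 1) y - y / θ * ch θ (i - 1) (y - 1)) := by
    cases i with
    | zero => simp
    | succ i => rfl
  have e : (y : ℝ) = θ * (y / θ) := by field_simp
  have e' : (i : ℝ) = θ * (i / θ) := by field_simp
  simp only [ch]
  linear_combination θ * h1 - θ * h2 + (ch θ i y) * e + (ch θ (i - 1) y - ch θ i y) * e'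

theorem pe_ch_mul_ch {θ : ℝ} (hθ : θ ≠ 0) (i j : ℕ) :
    pe θ (fun y => ch θ i y * ch θ j y) = if i = j then (i.factorial : ℝ) / θ ^ i else 0 := by
  have h0 : ∀ i, pe θ (fun y => 1 * ch θ (i + 1) y) = 0 := fun i => by
    rw [pe_mul_ch_succ hθ (ExpBdd.const 1)]
    simp [nd, pe]
  induction i generalizing j with
  | zero =>
    cases j with
    | zero => simpa [ch] using pe_one θ
    | succ j => rw [if_neg (by omega)]; exact h0 j
  | succ i ih =>
    cases j with
    | zero =>
      rw [if_neg (by omega), ← h0 i]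
      simp [ch]
    | succ j =>
      have h1 : ∀ y, nd (ch θ (i + 1)) y = ((i + 1 : ℕ) : ℝ) / θ * ch θ i y := fun y => by
        have := ch_succ_sub θ (i + 1) y
        rw [Nat.add_sub_cancel] at this
        rw [nd]
        linarith
      rw [pe_mul_ch_succ hθ (expBdd_ch θ _)]
      simp only [h1, mul_assoc]
      rw [pe_const_mul, ih]
      simp only [Nat.add_right_cancel_iff]
      split_ifs
      · rw [Nat.factorial_succ]
        push_cast
        field_simp
        ring
      · simp

/-- Normalized Charlier functions, with signs making the recurrence positive. -/
noncomputable def cp (θ : ℝ) (i y : ℕ) : ℝ := (-1) ^ i * √(θ ^ i / i.factorial) * ch θ i y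

theorem expBdd_cp (θ : ℝ) (i : ℕ) : ExpBdd (cp θ i) := (expBdd_ch θ i).const_mul _

theorem pe_cp_mul_cp {θ : ℝ} (hθ : 0 < θ) (i j : ℕ) :
    pe θ (fun y => cp θ i y * cp θ j y) = if i = j then 1 else 0 := by
  have : ∀ y, cp θ i y * cp θ j y = ((-1) ^ i * √(θ ^ i / i.factorial) *
      ((-1) ^ j * √(θ ^ j / j.factorial))) * (ch θ i y * ch θ j y) := fun y => by
    unfold cp; ring
  simp only [this]
  rw [pe_const_mul, pe_ch_mul_ch hθ.ne']
  split_ifs with h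
  · subst h
    have h1 : √(θ ^ i / i.factorial) * √(θ ^ i / i.factorial) = θ ^ i / i.factorial :=
      Real.mul_self_sqrt (by positivity)
    have h2 : ((-1 : ℝ) ^ i) * (-1) ^ i = 1 := by rw [← mul_pow]; simp
    calc _ = ((-1 : ℝ) ^ i * (-1) ^ i) * (√(θ ^ i / i.factorial) * √(θ ^ i / i.factorial)) *
          ((i.factorial : ℝ) / θ ^ i) := by ring
      _ = 1 := by
        rw [h1, h2]
        have : (i.factorial : ℝ) ≠ 0 := by positivity
        field_simp
  · simp

theorem sqrt_pow_div_factorial_succ {θ : ℝ} (hθ : 0 < θ) (i : ℕ) :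
    √(θ * (i + 1)) * √(θ ^ (i + 1) / (i + 1).factorial) = θ * √(θ ^ i / i.factorial) ∧
      √(θ * (i + 1)) * √(θ ^ i / i.factorial) = (i + 1) * √(θ ^ (i + 1) / (i + 1).factorial) := by
  have h : √(θ ^ (i + 1) / (i + 1).factorial) = √(θ ^ i / i.factorial) * √(θ / (i + 1)) := by
    rw [← Real.sqrt_mul (by positivity), Nat.factorial_succ]
    congr 1
    push_cast
    field_simp
    ring
  have h1 : √(θ * (i + 1)) * √(θ / (i + 1)) = θ := by
    rw [← Real.sqrt_mul (by positivity)]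
    rw [show θ * (i + 1) * (θ / (i + 1)) = θ * θ by field_simp]
    exact Real.sqrt_mul_self hθ.le
  have h2 : √(θ * (i + 1)) = ((i : ℝ) + 1) * √(θ / (i + 1)) := by
    have h3 : √(θ / (i + 1)) * √(θ / (i + 1)) = θ / (i + 1) := Real.mul_self_sqrt (by positivity)
    have h4 : √(θ / (i + 1)) ≠ 0 := by positivity
    refine mul_right_cancel₀ h4 ?_
    rw [h1, mul_assoc, h3]
    field_simp
  constructor
  · rw [h]; linear_combination √(θ ^ i / i.factorial) * h1
  · rw [h]; linear_combination √(θ ^ i / i.factorial) * h2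

theorem natCast_mul_cp {θ : ℝ} (hθ : 0 < θ) (i y : ℕ) :
    y * cp θ i y = √(θ * (i + 1)) * cp θ (i + 1) y + (θ + i) * cp θ i y +
      √(θ * i) * cp θ (i - 1) y := by
  have h1 := natCast_mul_ch hθ.ne' i y
  have h2 := (sqrt_pow_div_factorial_succ hθ i).1
  have h3 : (-1 : ℝ) ^ i * √(θ ^ i / i.factorial) * (i * ch θ (i - 1) y) =
      -(√(θ * i) * cp θ (i - 1) y) := by
    cases i with
    | zero => simp
    | succ i =>
      have h4 := (sqrt_pow_div_factorial_succ hθ i).2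
      simp only [Nat.add_sub_cancel, cp]
      push_cast at h4 ⊢
      rw [pow_succ]
      linear_combination ((-1) ^ i * ch θ i y) * h4
  unfold cp at h3 ⊢
  rw [pow_succ]
  linear_combination ((-1) ^ i * √(θ ^ i / i.factorial)) * h1 +
    ((-1) ^ i * ch θ (i + 1) y) * h2 - h3

/-! ### Bounding the determinant by a trace -/

theorem Matrix.PosSemidef.det_le_exp_trace_sub {n : Type*} [Fintype n] [DecidableEq n]
    {A : Matrix n n ℝ} (hA : A.PosSemidef) : A.det ≤ Real.exp (A.trace - Fintype.card n) := by
  rw [hA.1.det_eq_prod_eigenvalues, hA.1.trace_eq_sum_eigenvalues]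
  have : ∑ i, ((hA.1.eigenvalues i : ℝ)) - (Fintype.card n : ℝ) =
      ∑ i, (hA.1.eigenvalues i - 1) := by
    rw [Finset.sum_sub_distrib]; simp
  simp only [RCLike.ofReal_real_eq_id, id]
  rw [this, Real.exp_sum]
  refine Finset.prod_le_prod (fun i _ => hA.eigenvalues_nonneg i) fun i _ => ?_
  have := Real.add_one_le_exp (hA.1.eigenvalues i - 1)
  linarith

/-- The truncated binomial as a function of the shifted variable. -/
def gb (X j y : ℕ) : ℝ := if y ≤ X then ((X - y).choose j : ℝ) else 0

theorem eb_add (X j y : ℕ) : eb X j (j + y) = gb X j y := by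
  unfold eb gb
  by_cases h : j + y ≤ X
  · rw [if_pos h, if_pos (by omega), show X + j - (j + y) = X - y by omega]
  · rw [if_neg h]
    split_ifs
    · rw [Nat.choose_eq_zero_of_lt (by omega), Nat.cast_zero]
    · rfl

theorem nd_iterate_comp_add (f : ℕ → ℝ) (i j n : ℕ) :
    nd^[i] f (j + n) = nd^[i] (fun y => f (j + y)) n := by
  induction i generalizing n with
  | zero => rfl
  | succ i ih =>
    simp only [Function.iterate_succ_apply', nd]
    rw [ih, ← ih (n + 1), add_assoc]

theorem expBdd_gb (X j : ℕ) : ExpBdd (gb X j) := by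
  refine (ExpBdd.const (X.choose j : ℝ)).mono fun y => ?_
  unfold gb
  split_ifs
  · rw [Nat.abs_cast, Nat.abs_cast]
    exact_mod_cast Nat.choose_le_choose j (Nat.sub_le _ _)
  · simp

theorem sum_pw_mul_nd_iterate {θ : ℝ} (hθ : θ ≠ 0) (X i j : ℕ) :
    ∑ n ∈ Finset.range (X + 1), pw θ n * nd^[i] (eb X j) (j + n) =
      pe θ (fun y => gb X j y * ch θ i y) := by
  rw [pe_mul_ch hθ (expBdd_gb X j), pe, tsum_eq_sum (s := Finset.range (X + 1))]
  · refine Finset.sum_congr rfl fun n _ => ?_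
    rw [nd_iterate_comp_add]
    simp only [eb_add]
  · intro n hn
    rw [nd_iterate_eq_zero_of_lt (f := gb X j) (X := X) (fun y hy => if_neg (by omega)) i
      (by simpa using hn), mul_zero]

theorem exists_choose_eq_sum_ch {θ : ℝ} (hθ : 0 < θ) (X j : ℕ) :
    ∃ t : ℕ → ℝ, (∀ i, j < i → t i = 0) ∧ t j = θ ^ j / j.factorial ∧
      ∀ n, j < n → ∀ y, gb X j y = ∑ i ∈ Finset.range n, t i *
        ((if y ≤ X then 1 else 0) * ch θ i y) := by
  induction j with
  | zero =>
    refine ⟨Pi.single 0 1, fun i hi => by simp [hi.ne'], by simp, fun n hn y => ?_⟩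
    rw [Finset.sum_eq_single_of_mem 0 (Finset.mem_range.2 hn) (fun i _ hi => by simp [hi])]
    simp [gb, ch]
  | succ j ih =>
    obtain ⟨t, ht0, htj, ht⟩ := ih
    refine ⟨fun i => ((if i = 0 then 0 else θ * t (i - 1)) + (X - j - θ - i) * t i +
      (i + 1) * t (i + 1)) / (j + 1), fun i hi => ?_, ?_, fun n hn y => ?_⟩
    · simp only [ht0 i (by omega), ht0 (i + 1) (by omega), ht0 (i - 1) (by omega)]
      simp
    · simp only [ht0 (j + 1) (by omega), ht0 (j + 1 + 1) (by omega), Nat.add_sub_cancel, htj,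
        Nat.factorial_succ]
      have : (j.factorial : ℝ) ≠ 0 := by positivity
      have : (j : ℝ) + 1 ≠ 0 := by positivity
      push_cast
      field_simp
      ring
    · by_cases hy : y ≤ X
      · have hj1 : ((j : ℝ) + 1) ≠ 0 := by positivity
        have h1 : ((j : ℝ) + 1) * gb X (j + 1) y = (X - y - j) * gb X j y := by
          simp only [gb, if_pos hy]
          have h2 := Nat.choose_succ_right_eq (X - y) j
          by_cases h3 : j ≤ X - y
          · have h4 : (((X - y - j : ℕ) : ℝ)) = X - y - j := by
              rw [Nat.cast_sub h3, Nat.cast_sub hy]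
            have h2' : ((X - y).choose (j + 1) : ℝ) * (j + 1) =
                ((X - y).choose j : ℝ) * ((X - y - j : ℕ) : ℝ) := by exact_mod_cast h2
            rw [← h4]; linarith
          · rw [Nat.choose_eq_zero_of_lt (by omega : X - y < j),
              Nat.choose_eq_zero_of_lt (by omega : X - y < j + 1)]
            simp
        have h5 := ht n (by omega) y
        simp only [if_pos hy, one_mul] at h5 ⊢
        refine mul_left_cancel₀ hj1 ?_
        rw [h1, h5, Finset.mul_sum, Finset.mul_sum]
        have h6 : ∀ i, ((X : ℝ) - y - j) * (t i * ch θ i y) =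
            θ * t i * ch θ (i + 1) y + (X - j - θ - i) * t i * ch θ i y +
              i * t i * ch θ (i - 1) y := fun i => by
          linear_combination (-t i) * natCast_mul_ch hθ.ne' i y
        have h7 : ∀ i : ℕ, ((j : ℝ) + 1) * (((if i = 0 then 0 else θ * t (i - 1)) +
            (X - j - θ - i) * t i + (i + 1) * t (i + 1)) / (j + 1) * ch θ i y) =
            (if i = 0 then 0 else θ * t (i - 1)) * ch θ i y + (X - j - θ - i) * t i * ch θ i y +
              (i + 1) * t (i + 1) * ch θ i y := fun i => by
          field_simp
        simp only [h6, h7, Finset.sum_add_distrib]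
        obtain ⟨n, rfl⟩ : ∃ m, n = m + 1 := ⟨n - 1, by omega⟩
        have e1 : ∑ i ∈ Finset.range (n + 1), θ * t i * ch θ (i + 1) y =
            ∑ i ∈ Finset.range (n + 1), (if i = 0 then 0 else θ * t (i - 1)) * ch θ i y := by
          rw [Finset.sum_range_succ, ht0 n (by omega), Finset.sum_range_succ' _ n]
          simp
        have e2 : ∑ i ∈ Finset.range (n + 1), (i : ℝ) * t i * ch θ (i - 1) y =
            ∑ i ∈ Finset.range (n + 1), ((i : ℝ) + 1) * t (i + 1) * ch θ i y := by
          rw [Finset.sum_range_succ', Finset.sum_range_succ _ n, ht0 (n + 1) (by omega)]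
          simp
        rw [e1, e2]
      · simp [gb, hy]

/-- The truncated Gram matrix of the normalized Charlier functions. -/
noncomputable def gram (θ : ℝ) (X d : ℕ) : Matrix (Fin (d + 1)) (Fin (d + 1)) ℝ :=
  Matrix.of fun i j => pe θ fun y => (if y ≤ X then 1 else 0) * (cp θ i y * cp θ j y)

theorem det_pe_gb_mul_ch {θ : ℝ} (hθ : 0 < θ) (X d : ℕ) :
    (Matrix.of fun i j : Fin (d + 1) => pe θ fun y => gb X j y * ch θ i y).det =
      (gram θ X d).det := by
  choose t ht0 htj ht using exists_choose_eq_sum_ch hθ X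
  set G : Matrix (Fin (d + 1)) (Fin (d + 1)) ℝ :=
    Matrix.of fun i j => pe θ fun y => (if y ≤ X then 1 else 0) * (ch θ i y * ch θ j y) with hG
  set T : Matrix (Fin (d + 1)) (Fin (d + 1)) ℝ := Matrix.of fun i j => t j i with hT
  set s : Fin (d + 1) → ℝ := fun i => (-1) ^ (i : ℕ) * √(θ ^ (i : ℕ) / (i : ℕ).factorial) with hs
  have h1 : (Matrix.of fun i j : Fin (d + 1) => pe θ fun y => gb X j y * ch θ i y) = G * T := by
    ext i j
    rw [Matrix.mul_apply, Matrix.of_apply]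
    have : ∀ y, gb X j y * ch θ i y = ∑ l ∈ Finset.range (d + 1),
        t j l * ((if y ≤ X then 1 else 0) * (ch θ i y * ch θ l y)) := fun y => by
      rw [ht j (d + 1) (by omega) y, Finset.sum_mul]
      refine Finset.sum_congr rfl fun l _ => ?_
      ring
    simp only [this]
    rw [pe_sum, Finset.sum_range]
    · refine Finset.sum_congr rfl fun l _ => ?_
      rw [pe_const_mul, hG, hT, Matrix.of_apply, Matrix.of_apply, mul_comm]
    · intro l _
      exact ((ExpBdd.indicator _).mul ((expBdd_ch θ _).mul (expBdd_ch θ _))).const_mul _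
  have h2 : T.det = ∏ i, s i * s i := by
    rw [Matrix.det_of_isUpperTriangular]
    · refine Finset.prod_congr rfl fun i _ => ?_
      rw [hT, Matrix.of_apply, htj, hs]
      have e1 : √(θ ^ (i : ℕ) / (i : ℕ).factorial) * √(θ ^ (i : ℕ) / (i : ℕ).factorial) =
        θ ^ (i : ℕ) / (i : ℕ).factorial := Real.mul_self_sqrt (by positivity)
      have e2 : ((-1 : ℝ) ^ (i : ℕ)) * (-1) ^ (i : ℕ) = 1 := by rw [← mul_pow]; simp
      simp only []
      rw [mul_mul_mul_comm, e1, e2, one_mul]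
    · intro i j hij
      exact ht0 j i hij
  have h3 : gram θ X d = Matrix.diagonal s * G * Matrix.diagonal s := by
    ext i j
    rw [Matrix.mul_diagonal, Matrix.diagonal_mul, hG, gram, Matrix.of_apply, Matrix.of_apply,
      mul_right_comm, ← pe_const_mul]
    congr 1
    funext y
    simp only [cp, hs]
    ring
  rw [h1, h3, Matrix.det_mul, Matrix.det_mul, Matrix.det_mul, h2, Matrix.det_diagonal,
    Finset.prod_mul_distrib]
  ring

theorem gram_posSemidef {θ : ℝ} (hθ : 0 ≤ θ) (X d : ℕ) : (gram θ X d).PosSemidef := by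
  refine Matrix.PosSemidef.of_dotProduct_mulVec_nonneg ?_ fun v => ?_
  · ext i j
    simp only [Matrix.conjTranspose_apply, gram, Matrix.of_apply, star_trivial]
    congr 1
    funext y
    ring
  · have : star v ⬝ᵥ (gram θ X d).mulVec v = pe θ fun y => (if y ≤ X then 1 else 0) *
        ((∑ i, v i * cp θ i y) * (∑ i, v i * cp θ i y)) := by
      have e : ∀ y, (if y ≤ X then (1 : ℝ) else 0) *
          ((∑ i, v i * cp θ i y) * (∑ i, v i * cp θ i y)) =
          ∑ i, ∑ j, v i * v j * ((if y ≤ X then 1 else 0) * (cp θ i y * cp θ j y)) := fun y => by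
        rw [Finset.sum_mul_sum, Finset.mul_sum]
        refine Finset.sum_congr rfl fun i _ => ?_
        rw [Finset.mul_sum]
        refine Finset.sum_congr rfl fun j _ => ?_
        ring
      have hb : ∀ i j : Fin (d + 1), ExpBdd fun y => v i * v j *
          ((if y ≤ X then 1 else 0) * (cp θ i y * cp θ j y)) := fun i j =>
        ((ExpBdd.indicator _).mul ((expBdd_cp θ _).mul (expBdd_cp θ _))).const_mul _
      simp only [e]
      rw [pe_sum θ fun i _ => ExpBdd.sum fun j _ => hb i j, dotProduct]
      refine Finset.sum_congr rfl fun i _ => ?_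
      rw [pe_sum θ fun j _ => hb i j, Matrix.mulVec, dotProduct, Finset.mul_sum]
      refine Finset.sum_congr rfl fun j _ => ?_
      rw [pe_const_mul, gram, Matrix.of_apply, Pi.star_apply, star_trivial]
      ring
    rw [this]
    refine pe_nonneg hθ fun y => mul_nonneg ?_ (mul_self_nonneg _)
    split_ifs <;> simp

theorem det_gram_le {θ : ℝ} (hθ : 0 < θ) (X d : ℕ) :
    (gram θ X d).det ≤ Real.exp (-∑ i ∈ Finset.range (d + 1),
      pe θ fun y => (if X < y then 1 else 0) * cp θ i y ^ 2) := by
  refine (gram_posSemidef hθ.le X d).det_le_exp_trace_sub.trans_eq ?_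
  congr 1
  have h : ∀ i : ℕ, (pe θ fun y => (if y ≤ X then 1 else 0) * (cp θ i y * cp θ i y)) =
      1 - pe θ fun y => (if X < y then 1 else 0) * cp θ i y ^ 2 := fun i => by
    have h1 := pe_cp_mul_cp hθ i i
    rw [if_pos rfl] at h1
    have hb : ∀ (p : ℕ → Prop) [DecidablePred p], ExpBdd fun y =>
        (if p y then 1 else 0) * (cp θ i y * cp θ i y) := fun p _ =>
      (ExpBdd.indicator _).mul ((expBdd_cp θ _).mul (expBdd_cp θ _))
    simp only [sq]
    rw [eq_sub_iff_add_eq, ← pe_add θ (hb _) (hb _)]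
    refine Eq.trans ?_ h1
    congr 1
    funext y
    by_cases hy : y ≤ X
    · simp [hy, not_lt.2 hy]
    · simp [hy, not_le.1 hy]
  rw [Matrix.trace, Finset.sum_range]
  simp only [Matrix.diag_apply, gram, Matrix.of_apply, h, Finset.sum_sub_distrib]
  simp

/-- The Poissonized law of the particle `d` of the idealized dynamics. -/
theorem hasSum_pw_mul_gen_iterate_le {k : ℕ} (hk : k ≠ 0) (d X : ℕ) {L : ℝ} (hL : 0 < L) :
    ∃ S, HasSum (fun N => pw L N * (gen k d)^[N] (fun x => if x d ≤ X then 1 else 0) id) S ∧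
      S ≤ Real.exp (-∑ i ∈ Finset.range (d + 1),
        pe (L / k) fun y => (if X < y then 1 else 0) * cp (L / k) i y ^ 2) := by
  have hθ : 0 < L / k := by positivity
  refine ⟨_, hasSum_pw_mul_gen_iterate hk d X strictMono_id L, ?_⟩
  rw [exp_mul_eval_Dp]
  simp only [id, sum_pw_mul_nd_iterate hθ.ne']
  rw [det_pe_gb_mul_ch hθ]
  exact det_gram_le hθ X d

/-! ### Test functions supported on a block of Charlier functions -/

/-- The coefficients of multiplication by `y - ξ` on a block of Charlier functions. -/
noncomputable def jac (θ ξ : ℝ) (a : ℕ) (v : ℕ → ℝ) (t : ℕ) : ℝ :=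
  √(θ * (a + t)) * v (t - 1) + (θ + (a + t) - ξ) * v t + √(θ * (a + t + 1)) * v (t + 1)

theorem sub_mul_sum_cp {θ : ℝ} (hθ : 0 < θ) (ξ : ℝ) (a h : ℕ) {v : ℕ → ℝ} (hv0 : v 0 = 0)
    (hv : ∀ t, h ≤ t → v t = 0) (y : ℕ) :
    (y - ξ) * ∑ t ∈ Finset.range (h + 1), v t * cp θ (a + t) y =
      ∑ t ∈ Finset.range (h + 1), jac θ ξ a v t * cp θ (a + t) y := by
  have h1 : ∀ t : ℕ, (y - ξ) * (v t * cp θ (a + t) y) =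
      √(θ * (a + t + 1)) * v t * cp θ (a + (t + 1)) y + (θ + (a + t) - ξ) * v t * cp θ (a + t) y +
        √(θ * (a + t)) * v t * cp θ (a + t - 1) y := fun t => by
    have := natCast_mul_cp hθ (a + t) y
    push_cast at this
    rw [← add_assoc a t 1]
    linear_combination v t * this
  have e1 : ∑ t ∈ Finset.range (h + 1), √(θ * (a + t + 1)) * v t * cp θ (a + (t + 1)) y =
      ∑ t ∈ Finset.range (h + 1), √(θ * (a + t)) * v (t - 1) * cp θ (a + t) y := by
    rw [Finset.sum_range_succ, hv h le_rfl, Finset.sum_range_succ' _ h]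
    simp [hv0, add_assoc]
  have e2 : ∑ t ∈ Finset.range (h + 1), √(θ * (a + t)) * v t * cp θ (a + t - 1) y =
      ∑ t ∈ Finset.range (h + 1), √(θ * (a + t + 1)) * v (t + 1) * cp θ (a + t) y := by
    rw [Finset.sum_range_succ', Finset.sum_range_succ _ h, hv (h + 1) (by omega), hv0]
    simp only [mul_zero, zero_mul, add_zero]
    refine Finset.sum_congr rfl fun t _ => ?_
    rw [show a + (t + 1) - 1 = a + t by omega]
    push_cast
    rw [add_assoc (a : ℝ)]
  rw [Finset.mul_sum]
  simp only [h1, Finset.sum_add_distrib, jac, add_mul]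
  rw [e1, e2]

theorem pe_sum_cp_mul_sum_cp {θ : ℝ} (hθ : 0 < θ) (a n : ℕ) (v u : ℕ → ℝ) :
    pe θ (fun y => (∑ t ∈ Finset.range n, v t * cp θ (a + t) y) *
      ∑ t ∈ Finset.range n, u t * cp θ (a + t) y) = ∑ t ∈ Finset.range n, v t * u t := by
  have hb : ∀ s t, ExpBdd fun y => v s * cp θ (a + s) y * (u t * cp θ (a + t) y) := fun s t =>
    ((expBdd_cp θ _).const_mul _).mul ((expBdd_cp θ _).const_mul _)
  simp only [Finset.sum_mul_sum]
  rw [pe_sum θ fun s _ => ExpBdd.sum fun t _ => hb s t]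
  refine Finset.sum_congr rfl fun s hs => ?_
  rw [pe_sum θ fun t _ => hb s t, Finset.sum_eq_single_of_mem s hs]
  · simp only [mul_mul_mul_comm]
    rw [pe_const_mul, pe_cp_mul_cp hθ, if_pos rfl, mul_one]
  · intro t _ hts
    simp only [mul_mul_mul_comm]
    rw [pe_const_mul, pe_cp_mul_cp hθ, if_neg (by omega), mul_zero]

theorem sq_le_mul_sum_pe {θ ξ : ℝ} (hθ : 0 < θ) {X : ℕ} (hX : ∀ y : ℕ, y ≤ X → (y : ℝ) ≤ ξ)
    (a h : ℕ) {v : ℕ → ℝ} (hv0 : v 0 = 0) (hv : ∀ t, h ≤ t → v t = 0)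
    (hN : 0 < ∑ t ∈ Finset.range (h + 1), v t * jac θ ξ a v t) :
    (∑ t ∈ Finset.range (h + 1), v t * jac θ ξ a v t) ^ 2 ≤
      (∑ t ∈ Finset.range (h + 1), jac θ ξ a v t ^ 2) *
      ((∑ t ∈ Finset.range (h + 1), v t ^ 2) * ∑ t ∈ Finset.range (h + 1),
        pe θ fun y => (if X < y then 1 else 0) * cp θ (a + t) y ^ 2) := by
  set u := jac θ ξ a v with hu
  set f : ℕ → ℝ := fun y => ∑ t ∈ Finset.range (h + 1), v t * cp θ (a + t) y with hf
  set g : ℕ → ℝ := fun y => ∑ t ∈ Finset.range (h + 1), u t * cp θ (a + t) y with hg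
  have hfg : ∀ y : ℕ, (y - ξ) * f y = g y := sub_mul_sum_cp hθ ξ a h hv0 hv
  have hfb : ExpBdd f := ExpBdd.sum fun t _ => (expBdd_cp θ _).const_mul _
  have hgb : ExpBdd g := ExpBdd.sum fun t _ => (expBdd_cp θ _).const_mul _
  have hib : ExpBdd fun y => if X < y then (1 : ℝ) else 0 := ExpBdd.indicator _
  set N := ∑ t ∈ Finset.range (h + 1), v t * u t with hNdef
  set Q := ∑ t ∈ Finset.range (h + 1), u t ^ 2 with hQ
  have hNpe : pe θ (fun y => f y * g y) = N := pe_sum_cp_mul_sum_cp hθ a (h + 1) v u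
  have hQpe : pe θ (fun y => g y * g y) = Q := by
    rw [hQ]
    simp only [sq]
    exact pe_sum_cp_mul_sum_cp hθ a (h + 1) u u
  set κ := pe θ (fun y => (if X < y then 1 else 0) * (f y * f y)) with hκ
  have hpt : ∀ s : ℝ, 0 < s → N ≤ s / 2 * κ + 1 / (2 * s) * Q := by
    intro s hs
    rw [← hNpe, ← hQpe, hκ, ← pe_const_mul, ← pe_const_mul,
      ← pe_add θ ((hib.mul (hfb.mul hfb)).const_mul _) ((hgb.mul hgb).const_mul _)]
    refine pe_mono hθ.le (hfb.mul hgb)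
      (((hib.mul (hfb.mul hfb)).const_mul _).add ((hgb.mul hgb).const_mul _)) fun y => ?_
    by_cases hy : X < y
    · simp only [if_pos hy, one_mul]
      have : 0 ≤ (s * f y - g y) ^ 2 / (2 * s) := by positivity
      have e : (s * f y - g y) ^ 2 / (2 * s) =
        s / 2 * (f y * f y) + 1 / (2 * s) * (g y * g y) - f y * g y := by field_simp; ring
      linarith
    · simp only [if_neg hy, zero_mul, mul_zero, zero_add]
      have h1 : f y * g y ≤ 0 := by
        rw [← hfg, show f y * ((y - ξ) * f y) = (y - ξ) * (f y) ^ 2 by ring]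
        exact mul_nonpos_of_nonpos_of_nonneg (by linarith [hX y (not_lt.1 hy)]) (sq_nonneg _)
      have : 0 ≤ 1 / (2 * s) * (g y * g y) := mul_nonneg (by positivity) (mul_self_nonneg _)
      linarith
  have hQ0 : 0 ≤ Q := Finset.sum_nonneg fun t _ => sq_nonneg _
  have hQpos : 0 < Q := by
    rcases hQ0.lt_or_eq with hq | hq
    · exact hq
    · exfalso
      have hu0 : ∀ t ∈ Finset.range (h + 1), u t = 0 := fun t ht => by
        have := (Finset.sum_eq_zero_iff_of_nonneg (fun t _ => sq_nonneg (u t))).1 hq.symm t ht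
        simpa using this
      have : N = 0 := Finset.sum_eq_zero fun t ht => by rw [hu0 t ht, mul_zero]
      linarith
  have h1 : N ^ 2 ≤ Q * κ := by
    have h2 := hpt (Q / N) (by positivity)
    have h3 : Q / N / 2 * κ + 1 / (2 * (Q / N)) * Q = (Q * κ) / (2 * N) + N / 2 := by
      field_simp
    rw [h3] at h2
    have h4 : N / 2 ≤ Q * κ / (2 * N) := by linarith
    rw [le_div_iff₀ (by positivity)] at h4
    linarith
  refine h1.trans (mul_le_mul_of_nonneg_left ?_ hQ0)
  have hcb : ∀ t, ExpBdd fun y => (if X < y then (1 : ℝ) else 0) * cp θ (a + t) y ^ 2 := fun t => by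
    simp only [sq]
    exact hib.mul ((expBdd_cp θ _).mul (expBdd_cp θ _))
  rw [← pe_sum θ fun t _ => hcb t, ← pe_const_mul, hκ]
  refine pe_mono hθ.le (hib.mul (hfb.mul hfb)) ((ExpBdd.sum fun t _ => hcb t).const_mul _)
    fun y => ?_
  have hi : (0 : ℝ) ≤ if X < y then 1 else 0 := by split_ifs <;> norm_num
  rw [← Finset.mul_sum, mul_left_comm (∑ t ∈ Finset.range (h + 1), v t ^ 2)]
  refine mul_le_mul_of_nonneg_left ?_ hi
  rw [← sq]
  exact Finset.sum_mul_sq_le_sq_mul_sq _ _ _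

/-- A bump on `{0, …, h}`. -/
noncomputable def bump (h t : ℕ) : ℝ := if t ≤ h then (t : ℝ) ^ 2 * ((h : ℝ) - t) ^ 2 else 0

/-- Second difference of the bump. -/
noncomputable def bumpDiff (h t : ℕ) : ℝ := bump h (t - 1) + bump h (t + 1) - 2 * bump h t

theorem bump_nonneg (h t : ℕ) : 0 ≤ bump h t := by
  unfold bump; split_ifs <;> positivity

theorem bump_zero (h : ℕ) : bump h 0 = 0 := by simp [bump]

theorem bump_of_le {h t : ℕ} (ht : h ≤ t) : bump h t = 0 := by
  unfold bump
  split_ifs with h1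
  · rw [le_antisymm h1 ht]; simp
  · rfl

theorem bump_le (m t : ℕ) : bump (4 * m) t ≤ 16 * (m : ℝ) ^ 4 := by
  unfold bump
  split_ifs with h
  · have h1 : (t : ℝ) ≤ 4 * m := by exact_mod_cast h
    have h2 : (0 : ℝ) ≤ t := Nat.cast_nonneg t
    have h3 : (t : ℝ) * (4 * m - t) ≤ 4 * (m : ℝ) ^ 2 := by nlinarith [sq_nonneg ((t : ℝ) - 2 * m)]
    have h4 : 0 ≤ (t : ℝ) * (4 * m - t) := mul_nonneg h2 (by linarith)
    push_cast
    calc (t : ℝ) ^ 2 * (4 * m - t) ^ 2 = (t * (4 * m - t)) ^ 2 := by ring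
      _ ≤ (4 * (m : ℝ) ^ 2) ^ 2 := pow_le_pow_left₀ h4 h3 2
      _ = _ := by ring
  · positivity

theorem abs_bumpDiff_le {m : ℕ} (hm : 1 ≤ m) {t : ℕ} (ht : t ≤ 4 * m) :
    |bumpDiff (4 * m) t| ≤ 34 * (m : ℝ) ^ 2 := by
  have hm' : (1 : ℝ) ≤ m := by exact_mod_cast hm
  rcases Nat.eq_zero_or_pos t with rfl | h0
  · rw [bumpDiff, bump_zero, bump, if_pos (by omega)]
    push_cast
    rw [abs_of_nonneg (by nlinarith [sq_nonneg (4 * (m : ℝ) - 1)])]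
    nlinarith
  rcases ht.eq_or_lt with rfl | h1
  · rw [bumpDiff, bump_of_le le_rfl, bump_of_le (Nat.le_succ _), bump, if_pos (by omega),
      Nat.cast_sub h0]
    push_cast
    rw [abs_of_nonneg (by nlinarith [sq_nonneg ((4 * (m : ℝ) - 1))])]
    nlinarith
  · rw [bumpDiff, bump, bump, bump, if_pos (by omega), if_pos (by omega), if_pos (by omega),
      Nat.cast_sub h0]
    push_cast
    have h2 : (t : ℝ) ≤ 4 * m := by exact_mod_cast ht
    have h3 : (0 : ℝ) ≤ t := Nat.cast_nonneg t
    have e : ((t : ℝ) - 1) ^ 2 * (4 * m - (t - 1)) ^ 2 + (t + 1) ^ 2 * (4 * m - (t + 1)) ^ 2 -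
        2 * (t ^ 2 * (4 * m - t) ^ 2) = 32 * (m : ℝ) ^ 2 - 12 * (t * (4 * m - t)) + 2 := by ring
    rw [e, abs_le]
    have h4 : (t : ℝ) * (4 * m - t) ≤ 4 * (m : ℝ) ^ 2 := by nlinarith [sq_nonneg ((t : ℝ) - 2 * m)]
    have h5 : 0 ≤ (t : ℝ) * (4 * m - t) := mul_nonneg h3 (by linarith)
    constructor <;> nlinarith

theorem le_sum_bump_sq {m : ℕ} :
    162 * (m : ℝ) ^ 9 ≤ ∑ t ∈ Finset.range (4 * m + 1), bump (4 * m) t ^ 2 := by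
  have h1 : ∑ t ∈ Finset.Icc m (3 * m), bump (4 * m) t ^ 2 ≤
      ∑ t ∈ Finset.range (4 * m + 1), bump (4 * m) t ^ 2 := by
    refine Finset.sum_le_sum_of_subset_of_nonneg (fun t ht => ?_) fun t _ _ => sq_nonneg _
    simp only [Finset.mem_Icc, Finset.mem_range] at ht ⊢
    omega
  have h2 : ∑ t ∈ Finset.Icc m (3 * m), (81 * (m : ℝ) ^ 8) ≤
      ∑ t ∈ Finset.Icc m (3 * m), bump (4 * m) t ^ 2 := by
    refine Finset.sum_le_sum fun t ht => ?_
    rw [Finset.mem_Icc] at ht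
    have h3 : (m : ℝ) ≤ t := by exact_mod_cast ht.1
    have h4 : (t : ℝ) ≤ 3 * m := by exact_mod_cast ht.2
    rw [bump, if_pos (by omega)]
    push_cast
    have h5 : 3 * (m : ℝ) ^ 2 ≤ t * (4 * m - t) := by nlinarith
    calc (81 : ℝ) * (m : ℝ) ^ 8 = (3 * (m : ℝ) ^ 2) ^ 4 := by ring
      _ ≤ ((t : ℝ) * (4 * m - t)) ^ 4 := pow_le_pow_left₀ (by positivity) h5 4
      _ = _ := by ring
  rw [Finset.sum_const, Nat.card_Icc, nsmul_eq_mul] at h2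
  have h3 : ((3 * m + 1 - m : ℕ) : ℝ) = 2 * m + 1 := by
    rw [show 3 * m + 1 - m = 2 * m + 1 by omega]; push_cast; ring
  rw [h3] at h2
  have : 0 ≤ 81 * (m : ℝ) ^ 8 := by positivity
  nlinarith

/-- The contribution of one block to the trace. -/
theorem block_le {θ σ : ℝ} (hθ : 0 < θ) {X : ℕ} (hX : ∀ y : ℕ, y ≤ X → (y : ℝ) ≤ θ + σ)
    {a m : ℕ} (hm : 1 ≤ m) {z : ℝ} (hz : z = 2 * √(θ * a) - σ) (hz0 : 0 < z)
    (h1 : 40 * √(θ * a) / m ^ 2 ≤ z) (h2 : 20 * (√(θ * (a + 4 * m + 1)) - √(θ * a)) ≤ 3 * z)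
    (h3 : 40 * (a + 4 * m) ≤ z) :
    1 / 50 ≤ ∑ t ∈ Finset.range (4 * m + 1),
      pe θ fun y => (if X < y then 1 else 0) * cp θ (a + t) y ^ 2 := by
  have hm' : (1 : ℝ) ≤ m := by exact_mod_cast hm
  set h := 4 * m with hh
  have hhr : (h : ℝ) = 4 * m := by rw [hh]; push_cast; ring
  set A := √(θ * a) with hA
  set B := √(θ * (a + 4 * m + 1)) with hB
  have hA0 : 0 ≤ A := Real.sqrt_nonneg _
  have hAB : A ≤ B := Real.sqrt_le_sqrt (by nlinarith)
  set v := bump h with hv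
  set u := jac θ (θ + σ) a v with hu
  set S := ∑ t ∈ Finset.range (h + 1), v t ^ 2 with hS
  have hS1 : 162 * (m : ℝ) ^ 9 ≤ S := le_sum_bump_sq
  have hSpos : 0 < S := lt_of_lt_of_le (by positivity) hS1
  have hrt : ∀ t : ℕ, A ≤ √(θ * (a + t)) := fun t =>
    Real.sqrt_le_sqrt (mul_le_mul_of_nonneg_left (by simp) hθ.le)
  have hrt' : ∀ t : ℕ, t ≤ h + 1 → √(θ * (a + t)) ≤ B := fun t ht => by
    refine Real.sqrt_le_sqrt (mul_le_mul_of_nonneg_left ?_ hθ.le)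
    have : (t : ℝ) ≤ h + 1 := by exact_mod_cast ht
    rw [hhr] at this
    linarith
  have hut : ∀ t, u t = A * bumpDiff h t + (z + (a + t)) * v t +
      (√(θ * (a + t)) - A) * v (t - 1) + (√(θ * (a + (t + 1 : ℕ))) - A) * v (t + 1) := fun t => by
    rw [hu, jac, bumpDiff, hz]
    push_cast
    rw [add_assoc (a : ℝ)]
    ring
  have hD : ∀ t ∈ Finset.range (h + 1), |bumpDiff h t| ≤ 34 * (m : ℝ) ^ 2 := fun t ht =>
    abs_bumpDiff_le hm (by simpa [Nat.lt_succ_iff] using ht)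
  have hcard : ((h + 1 : ℕ) : ℝ) ≤ 5 * m := by push_cast; rw [hhr]; linarith
  have hm0 : (0 : ℝ) < m := by linarith
  -- sum of `|Δ| v`
  have hDv : ∑ t ∈ Finset.range (h + 1), |bumpDiff h t| * v t ≤ 17 / m ^ 2 * S := by
    have e1 : ∑ t ∈ Finset.range (h + 1), |bumpDiff h t| * v t ≤
        ∑ t ∈ Finset.range (h + 1), 34 * (m : ℝ) ^ 2 * (16 * (m : ℝ) ^ 4) :=
      Finset.sum_le_sum fun t ht => mul_le_mul (hD t ht) (bump_le m t) (bump_nonneg _ _)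
        (by positivity)
    rw [Finset.sum_const, Finset.card_range, nsmul_eq_mul] at e1
    have e2 : ((h + 1 : ℕ) : ℝ) * (34 * (m : ℝ) ^ 2 * (16 * (m : ℝ) ^ 4)) ≤
        5 * m * (34 * (m : ℝ) ^ 2 * (16 * (m : ℝ) ^ 4)) :=
      mul_le_mul_of_nonneg_right hcard (by positivity)
    have e3 : 17 / (m : ℝ) ^ 2 * (162 * (m : ℝ) ^ 9) ≤ 17 / m ^ 2 * S :=
      mul_le_mul_of_nonneg_left hS1 (by positivity)
    have e4 : 17 / (m : ℝ) ^ 2 * (162 * (m : ℝ) ^ 9) = 2754 * (m : ℝ) ^ 7 := by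
      field_simp; norm_num
    have e5 : (0 : ℝ) ≤ (m : ℝ) ^ 7 := by positivity
    nlinarith
  have hDD : ∑ t ∈ Finset.range (h + 1), bumpDiff h t ^ 2 ≤ 36 / m ^ 4 * S := by
    have e1 : ∑ t ∈ Finset.range (h + 1), bumpDiff h t ^ 2 ≤
        ∑ t ∈ Finset.range (h + 1), (34 * (m : ℝ) ^ 2) ^ 2 :=
      Finset.sum_le_sum fun t ht => by
        rw [← sq_abs]
        exact pow_le_pow_left₀ (abs_nonneg _) (hD t ht) 2
    rw [Finset.sum_const, Finset.card_range, nsmul_eq_mul] at e1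
    have e2 : ((h + 1 : ℕ) : ℝ) * (34 * (m : ℝ) ^ 2) ^ 2 ≤ 5 * m * (34 * (m : ℝ) ^ 2) ^ 2 :=
      mul_le_mul_of_nonneg_right hcard (by positivity)
    have e3 : 36 / (m : ℝ) ^ 4 * (162 * (m : ℝ) ^ 9) ≤ 36 / m ^ 4 * S :=
      mul_le_mul_of_nonneg_left hS1 (by positivity)
    have e4 : 36 / (m : ℝ) ^ 4 * (162 * (m : ℝ) ^ 9) = 5832 * (m : ℝ) ^ 5 := by
      field_simp; norm_num
    have e5 : (0 : ℝ) ≤ (m : ℝ) ^ 5 := by positivity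
    nlinarith
  -- lower bound for the numerator
  have hNlow : 23 / 40 * z * S ≤ ∑ t ∈ Finset.range (h + 1), v t * u t := by
    have e1 : ∀ t ∈ Finset.range (h + 1), z * v t ^ 2 - A * (|bumpDiff h t| * v t) ≤ v t * u t := by
      intro t _
      have hv1 := bump_nonneg h t
      have hv2 := bump_nonneg h (t - 1)
      have hv3 := bump_nonneg h (t + 1)
      have ha0 : (0 : ℝ) ≤ a := Nat.cast_nonneg a
      have ht0 : (0 : ℝ) ≤ t := Nat.cast_nonneg t
      have k1 : -(A * |bumpDiff h t|) ≤ A * bumpDiff h t := by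
        have := neg_abs_le (bumpDiff h t)
        nlinarith
      have k2 : z * v t ≤ (z + (a + t)) * v t :=
        mul_le_mul_of_nonneg_right (by linarith) hv1
      have k3 : 0 ≤ (√(θ * (a + t)) - A) * v (t - 1) :=
        mul_nonneg (sub_nonneg.2 (hrt t)) hv2
      have k4 : 0 ≤ (√(θ * (a + (t + 1 : ℕ))) - A) * v (t + 1) :=
        mul_nonneg (sub_nonneg.2 (hrt _)) hv3
      have k5 : z * v t - A * |bumpDiff h t| ≤ u t := by rw [hut]; linarith
      have := mul_le_mul_of_nonneg_left k5 hv1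
      calc _ = v t * (z * v t - A * |bumpDiff h t|) := by ring
        _ ≤ _ := this
    have e2 := Finset.sum_le_sum e1
    rw [Finset.sum_sub_distrib, ← Finset.mul_sum, ← Finset.mul_sum] at e2
    have e3 := mul_le_mul_of_nonneg_left hDv hA0
    have e4 : A * (17 / m ^ 2 * S) ≤ 17 / 40 * z * S := by
      calc A * (17 / m ^ 2 * S) = 17 / 40 * (40 * A / m ^ 2) * S := by ring
        _ ≤ _ := by gcongr
    rw [← hS] at e2
    linarith
  have hNpos : 0 < ∑ t ∈ Finset.range (h + 1), v t * u t := lt_of_lt_of_le (by positivity) hNlow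
  -- upper bound for the denominator
  have hQup : ∑ t ∈ Finset.range (h + 1), u t ^ 2 ≤ 5 * z ^ 2 * S := by
    have e1 : ∀ t ∈ Finset.range (h + 1), u t ^ 2 ≤ 4 * (A ^ 2 * bumpDiff h t ^ 2 +
        (41 / 40 * z) ^ 2 * v t ^ 2 + (B - A) ^ 2 * v (t - 1) ^ 2 +
          (B - A) ^ 2 * v (t + 1) ^ 2) := by
      intro t ht
      have ht' : t ≤ h := by simpa [Nat.lt_succ_iff] using ht
      have k0 : ∀ p q r s : ℝ, (p + q + r + s) ^ 2 ≤ 4 * (p ^ 2 + q ^ 2 + r ^ 2 + s ^ 2) := by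
        intro p q r s
        nlinarith [sq_nonneg (p - q), sq_nonneg (p - r), sq_nonneg (p - s), sq_nonneg (q - r),
          sq_nonneg (q - s), sq_nonneg (r - s)]
      rw [hut]
      refine (k0 _ _ _ _).trans ?_
      simp only [mul_pow]
      have htr : (t : ℝ) ≤ 4 * m := by rw [← hhr]; exact_mod_cast ht'
      have k1 : (z + (a + t)) ^ 2 ≤ (41 / 40 * z) ^ 2 := by
        refine pow_le_pow_left₀ (by positivity) ?_ 2
        linarith
      have k2 : (√(θ * (a + t)) - A) ^ 2 ≤ (B - A) ^ 2 :=
        pow_le_pow_left₀ (sub_nonneg.2 (hrt t)) (by linarith [hrt' t (by omega)]) 2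
      have k3 : (√(θ * (a + (t + 1 : ℕ))) - A) ^ 2 ≤ (B - A) ^ 2 :=
        pow_le_pow_left₀ (sub_nonneg.2 (hrt _)) (by linarith [hrt' (t + 1) (by omega)]) 2
      rw [← mul_pow (41 / 40) z]
      gcongr
    have e2 := Finset.sum_le_sum e1
    simp only [← Finset.mul_sum, Finset.sum_add_distrib] at e2
    have e3 : ∑ t ∈ Finset.range (h + 1), v (t - 1) ^ 2 ≤ S := by
      rw [Finset.sum_range_succ', hS, Finset.sum_range_succ _ h]
      simp [hv, bump_zero, bump_of_le]
    have e4 : ∑ t ∈ Finset.range (h + 1), v (t + 1) ^ 2 ≤ S := by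
      rw [Finset.sum_range_succ, hS, Finset.sum_range_succ' _ h]
      simp [hv, bump_zero, bump_of_le]
    have hBA : B - A ≤ 3 / 20 * z := by linarith
    have hBA2 : (B - A) ^ 2 ≤ (3 / 20 * z) ^ 2 := pow_le_pow_left₀ (by linarith) hBA 2
    have e5 : A ^ 2 * ∑ t ∈ Finset.range (h + 1), bumpDiff h t ^ 2 ≤ (6 / 40 * z) ^ 2 * S := by
      calc A ^ 2 * ∑ t ∈ Finset.range (h + 1), bumpDiff h t ^ 2
          ≤ A ^ 2 * (36 / m ^ 4 * S) := mul_le_mul_of_nonneg_left hDD (sq_nonneg _)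
        _ = (6 / 40 * (40 * A / m ^ 2)) ^ 2 * S := by field_simp; norm_num
        _ ≤ (6 / 40 * z) ^ 2 * S := by gcongr
    have e6 : (B - A) ^ 2 * ∑ t ∈ Finset.range (h + 1), v (t - 1) ^ 2 ≤ (3 / 20 * z) ^ 2 * S :=
      mul_le_mul hBA2 e3 (Finset.sum_nonneg fun _ _ => sq_nonneg _) (sq_nonneg _)
    have e7 : (B - A) ^ 2 * ∑ t ∈ Finset.range (h + 1), v (t + 1) ^ 2 ≤ (3 / 20 * z) ^ 2 * S :=
      mul_le_mul hBA2 e4 (Finset.sum_nonneg fun _ _ => sq_nonneg _) (sq_nonneg _)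
    have e8 : 0 ≤ z ^ 2 * S := by positivity
    have e9 : ∀ c : ℝ, (c * z) ^ 2 * S = c ^ 2 * (z ^ 2 * S) := fun c => by ring
    rw [← hS] at e2
    rw [e9] at e2 e5 e6 e7
    rw [mul_assoc]
    refine e2.trans ?_
    clear_value S
    generalize z ^ 2 * S = P at *
    linarith
  have key := sq_le_mul_sum_pe hθ hX a h (bump_zero h) (fun t ht => bump_of_le ht) hNpos
  set K := ∑ t ∈ Finset.range (h + 1),
      pe θ fun y => (if X < y then 1 else 0) * cp θ (a + t) y ^ 2 with hK
  have hK0 : 0 ≤ K := Finset.sum_nonneg fun t _ => pe_nonneg hθ.le fun y =>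
    mul_nonneg (by split_ifs <;> simp) (sq_nonneg _)
  have f1 : (23 / 40 * z * S) ^ 2 ≤ 5 * z ^ 2 * S * (S * K) :=
    (pow_le_pow_left₀ (by positivity) hNlow 2).trans
      (key.trans (mul_le_mul_of_nonneg_right hQup (by positivity)))
  have f2 : z ^ 2 * S ^ 2 * (1 / 50) ≤ z ^ 2 * S ^ 2 * K := by
    have e1 : (23 / 40 * z * S) ^ 2 = 529 / 1600 * (z ^ 2 * S ^ 2) := by ring
    have e2 : 5 * z ^ 2 * S * (S * K) = 5 * (z ^ 2 * S ^ 2 * K) := by ring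
    have e3 : 0 ≤ z ^ 2 * S ^ 2 := by positivity
    rw [e1, e2] at f1
    linarith
  exact le_of_mul_le_mul_left f2 (by positivity)

/-- The trace sum for a level `R` steps below the edge. -/
theorem div_le_sum_pe {θ : ℝ} (hθ : 0 < θ) {d m R : ℕ} (hm : 1 ≤ m) (hmd : m ^ 3 ≤ d)
    (hdθ : (d : ℝ) * m ^ 4 ≤ θ) (hR : 25 * R ≤ m ^ 2) {X : ℕ}
    (hX : ∀ y : ℕ, y ≤ X → (y : ℝ) ≤ θ + (2 * √(θ * d) - 50 * R * √(θ * d) / m ^ 2)) :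
    (R : ℝ) / 50 ≤ ∑ i ∈ Finset.range (d + 1),
      pe θ fun y => (if X < y then 1 else 0) * cp θ i y ^ 2 := by
  have hterm : ∀ i, 0 ≤ pe θ fun y => (if X < y then 1 else 0) * cp θ i y ^ 2 := fun i =>
    pe_nonneg hθ.le fun y => mul_nonneg (by split_ifs <;> norm_num) (sq_nonneg _)
  have hm' : (1 : ℝ) ≤ m := by exact_mod_cast hm
  have hm0 : (0 : ℝ) < m := by linarith
  have hmd' : (m : ℝ) ^ 3 ≤ d := by exact_mod_cast hmd
  have hd0 : (0 : ℝ) < d := lt_of_lt_of_le (by positivity) hmd'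
  have hR' : 25 * (R : ℝ) ≤ m ^ 2 := by exact_mod_cast hR
  have hRm : (R : ℝ) / m ^ 2 ≤ 1 / 25 := by
    rw [div_le_iff₀ (by positivity)]; linarith
  set W := √(θ * d) with hW
  have hWpos : 0 < W := Real.sqrt_pos.2 (by positivity)
  have hW2 : W ^ 2 = θ * d := Real.sq_sqrt (by positivity)
  have hdW : (d : ℝ) * m ^ 2 ≤ W := by
    refine Real.le_sqrt_of_sq_le ?_
    calc ((d : ℝ) * m ^ 2) ^ 2 = d * m ^ 4 * d := by ring
      _ ≤ θ * d := by gcongr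
  have hsize : R * (4 * m + 1) ≤ d := by
    refine le_trans ?_ hmd
    calc R * (4 * m + 1) ≤ R * (25 * m) := Nat.mul_le_mul_left _ (by omega)
      _ = 25 * R * m := by ring
      _ ≤ m ^ 2 * m := Nat.mul_le_mul_right _ hR
      _ = m ^ 3 := by ring
  have hloc : ∀ r ≤ R, (r : ℝ) / 50 ≤ ∑ i ∈ Finset.Ico (d - r * (4 * m + 1)) d,
      pe θ fun y => (if X < y then 1 else 0) * cp θ i y ^ 2 := by
    intro r hr
    induction r with
    | zero => simp
    | succ r ih =>
      have ih := ih (Nat.le_of_succ_le hr)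
      have hle : (r + 1) * (4 * m + 1) ≤ d := (Nat.mul_le_mul_right _ hr).trans hsize
      have he : (r + 1) * (4 * m + 1) = r * (4 * m + 1) + (4 * m + 1) := by ring
      set a := d - (r + 1) * (4 * m + 1) with ha
      have hb : d - r * (4 * m + 1) = a + (4 * m + 1) := by omega
      rw [← Finset.sum_Ico_consecutive _ (Nat.le_add_right a (4 * m + 1)) (by omega :
        a + (4 * m + 1) ≤ d), ← hb, Finset.sum_Ico_eq_sum_range, hb, Nat.add_sub_cancel_left]
      have hRpos : 1 ≤ R := by omega
      have hRpos' : (1 : ℝ) ≤ R := by exact_mod_cast hRpos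
      set ε := 5 * (R : ℝ) / m ^ 2 with hε
      have hε5 : ε ≤ 1 / 5 := by rw [hε, mul_div_assoc]; linarith
      have hε0 : 0 ≤ ε := by positivity
      have haR : (d : ℝ) * (1 - ε) ≤ a := by
        have h1 : (a : ℝ) = d - (r + 1) * (4 * m + 1) := by
          rw [ha, Nat.cast_sub hle]; push_cast; ring
        have h2 : ((r : ℝ) + 1) * (4 * m + 1) ≤ R * (5 * m) := by
          have : (r : ℝ) + 1 ≤ R := by exact_mod_cast hr
          exact mul_le_mul this (by linarith) (by positivity) (by positivity)
        have h3 : (R : ℝ) * (5 * m) = m ^ 3 * ε := by rw [hε]; field_simp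
        have h4 : (m : ℝ) ^ 3 * ε ≤ d * ε := by gcongr
        rw [h1]
        linarith
      have had : (a : ℝ) + 4 * m + 1 ≤ d := by
        have : a + 4 * m + 1 ≤ d := by omega
        exact_mod_cast this
      have hA1 : W * (1 - ε) ≤ √(θ * a) := by
        refine Real.le_sqrt_of_sq_le ?_
        calc (W * (1 - ε)) ^ 2 = θ * (d * (1 - ε)) * (1 - ε) := by rw [mul_pow, hW2]; ring
          _ ≤ θ * (d * (1 - ε)) * 1 := by
            refine mul_le_mul_of_nonneg_left (by linarith) ?_
            exact mul_nonneg hθ.le (mul_nonneg hd0.le (by linarith))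
          _ ≤ θ * a := by rw [mul_one]; gcongr
      have hA2 : √(θ * a) ≤ W := Real.sqrt_le_sqrt (mul_le_mul_of_nonneg_left (by linarith) hθ.le)
      have hA2' := Real.sq_sqrt (show 0 ≤ θ * a by positivity)
      set A := √(θ * a) with hA
      have hAW : 4 / 5 * W ≤ A := by
        have := mul_le_mul_of_nonneg_left hε5 hWpos.le
        linarith
      set z := 2 * A - (2 * W - 50 * R * W / m ^ 2) with hz
      have hz1 : 40 * (W / m ^ 2) * R ≤ z := by
        have e1 : 50 * R * W / m ^ 2 = 10 * (ε * W) := by rw [hε]; field_simp; norm_num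
        have e2 : 40 * (W / m ^ 2) * R = 8 * (ε * W) := by rw [hε]; field_simp; norm_num
        rw [hz, e1, e2]
        linarith
      have hWm : 0 < W / m ^ 2 := by positivity
      have hz2 : 40 * (W / m ^ 2) ≤ z := le_trans (by nlinarith) hz1
      have hB : √(θ * (a + 4 * m + 1)) ≤ A + 6 * (W / m ^ 2) := by
        refine Real.sqrt_le_iff.2 ⟨by positivity, ?_⟩
        have e1 : W * (W / m ^ 2) = θ * d / m ^ 2 := by rw [← hW2]; ring
        have e2 : θ * m ≤ θ * d / m ^ 2 := by
          rw [le_div_iff₀ (by positivity)]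
          calc θ * m * m ^ 2 = θ * (m : ℝ) ^ 3 := by ring
            _ ≤ θ * d := by gcongr
        have e3 : θ * (4 * m + 1) ≤ θ * (5 * m) :=
          mul_le_mul_of_nonneg_left (by linarith) hθ.le
        have e4 : 4 / 5 * W * (W / m ^ 2) ≤ A * (W / m ^ 2) := by gcongr
        have e5 : 0 ≤ θ * m := by positivity
        have e6 : 0 ≤ (W / m ^ 2) ^ 2 := sq_nonneg _
        have e7 : (A + 6 * (W / m ^ 2)) ^ 2 =
          A ^ 2 + 12 * (A * (W / m ^ 2)) + 36 * (W / m ^ 2) ^ 2 := by ring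
        have e8 : θ * (a + 4 * m + 1) = θ * a + θ * (4 * m + 1) := by ring
        have e9 : 4 / 5 * W * (W / m ^ 2) = 4 / 5 * (W * (W / m ^ 2)) := by ring
        have e10 : θ * (5 * m) = 5 * (θ * m) := by ring
        rw [e7, e8, hA2']
        linarith
      have hblock := block_le hθ hX hm (z := z) rfl (by linarith)
        (by
          refine le_trans ?_ hz2
          rw [mul_div_assoc]
          gcongr)
        (by linarith)
        (by
          have e1 : (d : ℝ) ≤ W / m ^ 2 := by rw [le_div_iff₀ (by positivity)]; exact hdW
          linarith)
      push_cast
      have : ((r : ℝ) + 1) / 50 = 1 / 50 + r / 50 := by ring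
      rw [this]
      refine add_le_add hblock ?_
      rwa [← hb]
  refine (hloc R le_rfl).trans (Finset.sum_le_sum_of_subset_of_nonneg ?_ fun i _ _ => hterm i)
  intro i hi
  simp only [Finset.mem_Ico, Finset.mem_range] at hi ⊢
  omega

theorem pe_natCast {θ : ℝ} (hθ : 0 < θ) : pe θ (fun y => (y : ℝ)) = θ := by
  have h := pe_pred hθ.ne' (ExpBdd.const 1)
  have e : ∀ y : ℕ, (y : ℝ) / θ * 1 = θ⁻¹ * y := fun y => by ring
  simp only [e] at h
  rw [pe_const_mul, pe_one] at h
  field_simp at h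
  exact h

theorem pe_natCast_sq {θ : ℝ} (hθ : 0 < θ) : pe θ (fun y => (y : ℝ) ^ 2) = θ ^ 2 + θ := by
  have h := pe_pred hθ.ne' ExpBdd.natCast
  have e : ∀ y : ℕ, (y : ℝ) / θ * (y - 1 : ℕ) = θ⁻¹ * ((y : ℝ) ^ 2 - y) := fun y => by
    cases y with
    | zero => simp
    | succ y => simp only [Nat.add_sub_cancel]; push_cast; ring
  simp only [e] at h
  have hs : ExpBdd fun y : ℕ => (y : ℝ) ^ 2 := by
    simpa only [sq] using ExpBdd.natCast.mul ExpBdd.natCast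
  rw [pe_const_mul, pe_sub θ hs ExpBdd.natCast, pe_natCast hθ] at h
  field_simp at h
  linarith

theorem expBdd_sub_sq (c : ℝ) : ExpBdd fun y : ℕ => ((y : ℝ) - c) ^ 2 := by
  simpa only [sq] using (ExpBdd.natCast.sub (ExpBdd.const c)).mul (ExpBdd.natCast.sub (ExpBdd.const c))

theorem pe_sub_sq {θ : ℝ} (hθ : 0 < θ) : pe θ (fun y => ((y : ℝ) - θ) ^ 2) = θ := by
  have e : ∀ y : ℕ, ((y : ℝ) - θ) ^ 2 = (y : ℝ) ^ 2 + (θ ^ 2 * 1 - 2 * θ * y) := fun y => by ring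
  have hs : ExpBdd fun y : ℕ => (y : ℝ) ^ 2 := by
    simpa only [sq] using ExpBdd.natCast.mul ExpBdd.natCast
  simp only [e]
  rw [pe_add θ hs (((ExpBdd.const 1).const_mul _).sub (ExpBdd.natCast.const_mul _)),
    pe_sub θ ((ExpBdd.const 1).const_mul _) (ExpBdd.natCast.const_mul _), pe_const_mul,
    pe_const_mul, pe_one, pe_natCast hθ, pe_natCast_sq hθ]
  ring

/-- Pointwise layer-cake bound for the depth of `q` below `Q`. -/
theorem sub_le_layers {Q q u : ℝ} (hu : 0 ≤ u) (n : ℕ) :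
    Q - q ≤ u * (1 + ∑ R ∈ Finset.range n, if q ≤ Q - (R + 1) * u then (1 : ℝ) else 0) ∨
      (q ≤ Q - n * u ∧ (n : ℝ) ≤ ∑ R ∈ Finset.range n, if q ≤ Q - (R + 1) * u then 1 else 0) := by
  induction n with
  | zero =>
    by_cases h : q ≤ Q
    · right; simpa using h
    · left; simp; linarith
  | succ n ih =>
    rw [Finset.sum_range_succ]
    rcases ih with ih | ⟨h1, h2⟩
    · left
      refine ih.trans (mul_le_mul_of_nonneg_left ?_ hu)
      have : (0 : ℝ) ≤ if q ≤ Q - (n + 1) * u then 1 else 0 := by split_ifs <;> norm_num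
      linarith
    · by_cases h : q ≤ Q - (n + 1) * u
      · right
        rw [if_pos h]
        push_cast
        exact ⟨h, by linarith⟩
      · left
        rw [if_neg h]
        have := mul_le_mul_of_nonneg_left h2 hu
        linarith

theorem sub_le_layers_add {Q q u θ x s : ℝ} (hu : 0 ≤ u) {n : ℕ} (hn : Q - n * u ≤ θ + u)
    (hx : x ≤ q) (hs : 0 < s) :
    Q - q ≤ u * (1 + ∑ R ∈ Finset.range n, if q ≤ Q - (R + 1) * u then (1 : ℝ) else 0) +
      (s / 2 * (θ - x) ^ 2 + 1 / (2 * s) * if q ≤ Q - n * u then 1 else 0) := by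
  rcases sub_le_layers (Q := Q) (q := q) hu n with h | ⟨h1, h2⟩
  · have : (0 : ℝ) ≤ if q ≤ Q - n * u then 1 else 0 := by split_ifs <;> norm_num
    have h3 : 0 ≤ s / 2 * (θ - x) ^ 2 + 1 / (2 * s) * if q ≤ Q - n * u then 1 else 0 := by positivity
    linarith
  · rw [if_pos h1]
    have h3 := mul_le_mul_of_nonneg_left h2 hu
    have h4 : θ - x ≤ s / 2 * (θ - x) ^ 2 + 1 / (2 * s) * 1 := by
      have : 0 ≤ (s * (θ - x) - 1) ^ 2 / (2 * s) := by positivity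
      have e : (s * (θ - x) - 1) ^ 2 / (2 * s) =
        s / 2 * (θ - x) ^ 2 + 1 / (2 * s) * 1 - (θ - x) := by field_simp; ring
      linarith
    linarith

theorem sum_exp_le (n : ℕ) :
    ∑ R ∈ Finset.range n, Real.exp (-((R + 1 : ℕ) / 50 : ℝ)) ≤
      50 * (1 - Real.exp (-(n / 50 : ℝ))) := by
  induction n with
  | zero => simp
  | succ n ih =>
    rw [Finset.sum_range_succ]
    have h1 : Real.exp (-(n / 50 : ℝ)) = Real.exp (1 / 50) * Real.exp (-((n + 1 : ℕ) / 50 : ℝ)) := by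
      rw [← Real.exp_add]; congr 1; push_cast; ring
    have h2 : (1 / 50 : ℝ) + 1 ≤ Real.exp (1 / 50) := Real.add_one_le_exp _
    have h3 := mul_le_mul_of_nonneg_right h2 (Real.exp_pos (-((n + 1 : ℕ) / 50 : ℝ))).le
    linarith

theorem pushStep_le_add {x y e : ℕ → ℕ} {c d : ℕ} (h : ∀ j ≤ d, x j ≤ y j + c) :
    ∀ j ≤ d, pushStep x e j ≤ pushStep y e j + c := by
  intro j hj
  induction j with
  | zero => have := h 0 hj; simp only [pushStep]; omega
  | succ j ih =>
    have h1 := ih (by omega)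
    have h2 := h _ hj
    simp only [pushStep]
    omega

theorem gen_iterate_le_add {k d : ℕ} (hd : d + 1 ≤ k) (s : ℕ) {c : ℕ} {x y : ℕ → ℕ}
    (h : ∀ j ≤ d, x j ≤ y j + c) :
    (gen k d)^[s] (fun x => (x d : ℝ)) x ≤ (gen k d)^[s] (fun x => (x d : ℝ)) y + c := by
  have hk : (0 : ℝ) < k := by
    have : 0 < k := by omega
    exact_mod_cast this
  have hdk : ((d : ℝ) + 1) / k ≤ 1 := by
    rw [div_le_one hk]; exact_mod_cast hd
  induction s generalizing x y with
  | zero => simp only [Function.iterate_zero, id]; exact_mod_cast h d le_rfl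
  | succ s ih =>
    simp only [Function.iterate_succ', Function.comp, gen] at ih ⊢
    have h1 := mul_le_mul_of_nonneg_left (ih h) (sub_nonneg.2 hdk)
    have h2 := Finset.sum_le_sum fun j (_ : j ∈ Finset.range (d + 1)) =>
      ih (pushStep_le_add (e := Pi.single j 1) h)
    rw [Finset.sum_add_distrib, Finset.sum_const, Finset.card_range, nsmul_eq_mul] at h2
    have h3 := div_le_div_of_nonneg_right h2 hk.le
    rw [add_div] at h3
    have e : (c : ℝ) = (1 - ((d : ℝ) + 1) / k) * c + ((d + 1 : ℕ) : ℝ) * c / k := by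
      push_cast; field_simp; ring
    linarith

theorem gen_iterate_add_le {k d : ℕ} (hd : d + 1 ≤ k) (l s : ℕ) :
    (gen k d)^[l + s] (fun x => (x d : ℝ)) id ≤
      (gen k d)^[l] (fun x => (x d : ℝ)) id + (gen k d)^[s] (fun x => (x d : ℝ)) id - d := by
  have hk : k ≠ 0 := by omega
  let w : ℕ → Fin k := fun _ => ⟨0, by omega⟩
  rw [Function.iterate_add_apply, ← av_idealPos hd w, ← av_idealPos hd w l (fun x => (x d : ℝ))]
  have h : ∀ t : List (Fin k), t.length = l →
      (gen k d)^[s] (fun x => (x d : ℝ)) (idealPos hd w t) ≤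
        (idealPos hd w t d : ℝ) + ((gen k d)^[s] (fun x => (x d : ℝ)) id - d) := fun t _ => by
    have hm := idealPos_strictMono hd w t
    have h1 : ∀ j ≤ d, idealPos hd w t j ≤ id j + (idealPos hd w t d - d) := fun j hj => by
      have h2 := hm.add_le_nat (d - j) j
      rw [Nat.sub_add_cancel hj] at h2
      simp only [id]
      omega
    have h3 := gen_iterate_le_add hd s h1
    have h4 : d ≤ idealPos hd w t d := hm.id_le d
    rw [Nat.cast_sub h4] at h3
    linarith
  refine (av_mono h).trans ?_
  rw [av_add, av_const hk]
  linarith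

theorem add_div_le_gen_iterate {k d : ℕ} (hd : d + 1 ≤ k) (N s : ℕ) :
    (gen k d)^[N] (fun x => (x d : ℝ)) id + s / k ≤
      (gen k d)^[N + s] (fun x => (x d : ℝ)) id := by
  have hk : k ≠ 0 := by omega
  have hk' : (0 : ℝ) < k := by exact_mod_cast Nat.pos_of_ne_zero hk
  let w : ℕ → Fin k := fun _ => ⟨0, by omega⟩
  induction s with
  | zero => simp
  | succ s ih =>
    rw [← add_assoc, Function.iterate_succ_apply,
      ← av_idealPos hd w (N + s) (gen k d fun x => (x d : ℝ))]
    rw [← av_idealPos hd w (N + s) (fun x => (x d : ℝ))] at ih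
    have h : ∀ t : List (Fin k), t.length = N + s → (idealPos hd w t d : ℝ) + 1 / k ≤
        gen k d (fun x => (x d : ℝ)) (idealPos hd w t) := fun t _ => by
      generalize idealPos hd w t = x
      have h1 : ∑ j ∈ Finset.range (d + 1), ((x d : ℝ) + if j = d then 1 else 0) ≤
          ∑ j ∈ Finset.range (d + 1), (pushStep x (Pi.single j 1) d : ℝ) := by
        refine Finset.sum_le_sum fun j _ => ?_
        have h2 := add_le_pushStep x (Pi.single j 1) d
        rw [Pi.single_apply] at h2
        by_cases hj : j = d
        · rw [if_pos hj]
          rw [if_pos hj.symm] at h2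
          exact_mod_cast h2
        · rw [if_neg hj]
          rw [if_neg (Ne.symm hj)] at h2
          simp only [add_zero] at h2 ⊢
          exact_mod_cast h2
      rw [Finset.sum_add_distrib, Finset.sum_const, Finset.card_range, nsmul_eq_mul,
        Finset.sum_ite_eq' (Finset.range (d + 1)) d, if_pos (Finset.self_mem_range_succ d)] at h1
      have h3 := div_le_div_of_nonneg_right h1 hk'.le
      have e : (((d + 1 : ℕ) : ℝ) * x d + 1) / k = ((d : ℝ) + 1) / k * x d + 1 / k := by
        push_cast; ring
      rw [e] at h3
      unfold gen
      linarith
    refine le_trans ?_ (av_mono h)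
    rw [av_add, av_const hk]
    push_cast
    rw [add_div]
    linarith

theorem gen_iterate_sub_sq {k : ℕ} (hk : k ≠ 0) (d : ℕ) (c : ℝ) (N : ℕ) {x : ℕ → ℕ}
    (hx : StrictMono x) :
    (gen k d)^[N] (fun x => (c - x 0) ^ 2) x = (c - x 0 - N / k) ^ 2 + N * (1 / k - 1 / k ^ 2) := by
  have hk' : (k : ℝ) ≠ 0 := by exact_mod_cast hk
  induction N generalizing x with
  | zero => simp
  | succ N ih =>
    rw [Function.iterate_succ_apply', gen, ih hx]
    simp only [ih (pushStep_strictMono _ _)]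
    rw [Finset.sum_range_succ']
    simp only [pushStep, Pi.single_apply]
    simp only [Finset.sum_const, Finset.card_range, nsmul_eq_mul, if_false,
      (Nat.succ_ne_zero _).symm, add_zero, if_true]
    push_cast
    field_simp
    ring

theorem sqrt_abs_le {L : ℝ} (hL : 0 < L) (v : ℝ) : √|v| ≤ √√L * (1 + v ^ 2 / L) := by
  have hs : 0 < √L := Real.sqrt_pos.2 hL
  set t := |v| / √L with ht
  have ht0 : 0 ≤ t := by positivity
  have e1 : |v| = √L * t := by rw [ht]; field_simp
  have e2 : v ^ 2 / L = t ^ 2 := by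
    rw [ht, div_pow, sq_abs, Real.sq_sqrt hL.le]
  rw [e2, e1, Real.sqrt_mul hs.le]
  refine mul_le_mul_of_nonneg_left ?_ (Real.sqrt_nonneg _)
  refine Real.sqrt_le_iff.2 ⟨by positivity, ?_⟩
  nlinarith [sq_nonneg (t - 1), sq_nonneg (t ^ 2)]

theorem gen_iterate_le_near {k d : ℕ} (hd0 : 1 ≤ d) (hd : d + 2 ≤ k) {L : ℕ} (hL : 1 ≤ L) (N : ℕ) :
    (gen k d)^[N] (fun x => (x d : ℝ)) id ≤ (gen k d)^[L] (fun x => (x d : ℝ)) id +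
      ((N : ℝ) - L) / k + 2 * √(d / k) * (√√L * (1 + ((N : ℝ) - L) ^ 2 / L)) + 2 * d := by
  have hL' : (0 : ℝ) < L := by exact_mod_cast hL
  have h0 : 0 ≤ 2 * √((d : ℝ) / k) * (√√L * (1 + ((N : ℝ) - L) ^ 2 / L)) := by positivity
  have hd' : (0 : ℝ) ≤ d := Nat.cast_nonneg d
  rcases le_total L N with h | h
  · obtain ⟨s, rfl⟩ := Nat.exists_eq_add_of_le h
    have h1 := gen_iterate_add_le (by omega : d + 1 ≤ k) L s
    have h2 := gen_iterate_le_sqrt hd0 hd s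
    have h3 := sqrt_abs_le hL' (s : ℝ)
    have e : √((d : ℝ) * s / k) = √((d : ℝ) / k) * √|(s : ℝ)| := by
      rw [abs_of_nonneg (Nat.cast_nonneg s), ← Real.sqrt_mul (by positivity)]
      congr 1; ring
    have h4 := mul_le_mul_of_nonneg_left h3 (Real.sqrt_nonneg ((d : ℝ) / k))
    rw [e] at h2
    push_cast
    rw [add_sub_cancel_left]
    linarith
  · obtain ⟨s, rfl⟩ := Nat.exists_eq_add_of_le h
    have h1 := add_div_le_gen_iterate (by omega : d + 1 ≤ k) N s
    push_cast at h0 ⊢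
    have e : ((N : ℝ) - (N + s)) / k = -(s / k) := by ring
    rw [e]
    linarith

/-- Lower bound for the mean position of the last particle of the idealized dynamics. -/
theorem le_gen_iterate {k d m L : ℕ} (hd0 : 1 ≤ d) (hd : d + 2 ≤ k) (hL : 1 ≤ L) (hm : 1 ≤ m)
    (hmd : m ^ 3 ≤ d) (hdθ : (d : ℝ) * m ^ 4 ≤ L / k) {s : ℝ} (hs : 0 < s) :
    (L : ℝ) / k + 2 * √(L / k * d) - (gen k d)^[L] (fun x => (x d : ℝ)) id ≤
      51 * (50 * √(L / k * d) / m ^ 2) + (s / 2 * (L / k) +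
        1 / (2 * s) * Real.exp (-((m ^ 2 / 25 : ℕ) / 50 : ℝ))) + 4 * √(d / k) * √√L + 2 * d := by
  have hk : k ≠ 0 := by omega
  have hk' : (0 : ℝ) < k := by exact_mod_cast Nat.pos_of_ne_zero hk
  have hL' : (0 : ℝ) < L := by exact_mod_cast hL
  have hm' : (0 : ℝ) < m := by exact_mod_cast hm
  have hd1 : d + 1 ≤ k := by omega
  let w : ℕ → Fin k := fun _ => ⟨0, by omega⟩
  set θ : ℝ := L / k with hθ
  have hθ0 : 0 < θ := by positivity
  set W := √(θ * d) with hW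
  have hW0 : 0 ≤ W := Real.sqrt_nonneg _
  set n := m ^ 2 / 25 with hn
  set u := 50 * W / (m : ℝ) ^ 2 with hu
  have hu0 : 0 ≤ u := by positivity
  set Q := θ + 2 * W with hQ
  have hnu : Q - n * u ≤ θ + u := by
    have h1 : m ^ 2 < 25 * (n + 1) := by omega
    have h2 : (m : ℝ) ^ 2 ≤ 25 * (n + 1) := by exact_mod_cast h1.le
    have h3 : 2 * W ≤ (n + 1) * u := by
      rw [hu, mul_div_assoc', le_div_iff₀ (by positivity)]
      have := mul_le_mul_of_nonneg_left h2 hW0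
      linarith
    rw [hQ]
    linarith
  have hlev : ∀ R ≤ n, 0 ≤ Q - R * u := fun R hR => by
    have h1 : 25 * R ≤ m ^ 2 := by omega
    have h2 : 25 * (R : ℝ) ≤ m ^ 2 := by exact_mod_cast h1
    have h3 : R * u ≤ 2 * W := by
      rw [hu, mul_div_assoc', div_le_iff₀ (by positivity)]
      have := mul_le_mul_of_nonneg_left h2 hW0
      linarith
    rw [hQ]
    linarith
  set f : ℕ → ℕ → ℝ := fun R N => av k N fun l =>
    if (idealPos hd1 w l d : ℝ) ≤ Q - R * u then 1 else 0 with hf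
  have hfb : ∀ R, ExpBdd (f R) := fun R => by
    refine (ExpBdd.const 1).mono fun N => ?_
    have h0 : 0 ≤ f R N := av_nonneg fun l _ => by split_ifs <;> norm_num
    have h1 : f R N ≤ 1 := by
      rw [← av_const hk N 1]
      exact av_mono fun l _ => by split_ifs <;> norm_num
    rw [abs_of_nonneg h0, abs_one]
    exact h1
  have htail : ∀ R ≤ n, pe L (f R) ≤ Real.exp (-(R / 50 : ℝ)) := fun R hR => by
    set X := ⌊Q - R * u⌋₊ with hX
    obtain ⟨S, hS, hSle⟩ := hasSum_pw_mul_gen_iterate_le hk d X hL'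
    have e : pe L (f R) = S := by
      rw [← hS.tsum_eq, pe]
      refine tsum_congr fun N => ?_
      rw [← av_idealPos hd1 w]
      congr 1
      refine av_congr fun l _ => ?_
      simp only [hX, Nat.le_floor_iff (hlev R hR)]
    rw [e]
    refine hSle.trans (Real.exp_le_exp.2 (neg_le_neg ?_))
    refine div_le_sum_pe hθ0 hm hmd hdθ (by omega) fun y hy => ?_
    rw [Nat.le_floor_iff (hlev R hR)] at hy
    refine hy.trans (le_of_eq ?_)
    rw [hQ, hu]
    ring
  have hsq : ∀ N : ℕ, av k N (fun l => (θ - idealPos hd1 w l 0) ^ 2) =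
      (1 / k ^ 2) * ((N : ℝ) - L) ^ 2 + (1 / k - 1 / k ^ 2) * N := fun N => by
    rw [av_idealPos hd1 w N (fun x => (θ - x 0) ^ 2), gen_iterate_sub_sq hk d θ N strictMono_id,
      hθ]
    simp only [id]
    push_cast
    field_simp
    ring
  set bL := (gen k d)^[L] (fun x => (x d : ℝ)) id with hbL
  have hpt : ∀ N : ℕ, (Q - bL - 2 * d) * 1 - (1 / k * ((N : ℝ) - L) +
      2 * √(d / k) * √√L * (1 + 1 / L * ((N : ℝ) - L) ^ 2)) ≤
      u * (1 + ∑ R ∈ Finset.range n, f (R + 1) N) + (s / 2 * ((1 / k ^ 2) * ((N : ℝ) - L) ^ 2 +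
        (1 / k - 1 / k ^ 2) * N) + 1 / (2 * s) * f n N) := fun N => by
    have h1 := gen_iterate_le_near hd0 hd hL N
    rw [← av_idealPos hd1 w] at h1
    have h2 : av k N (fun l => Q - idealPos hd1 w l d) ≤ av k N fun l =>
        u * (1 + ∑ R ∈ Finset.range n,
          if (idealPos hd1 w l d : ℝ) ≤ Q - (R + 1 : ℕ) * u then (1 : ℝ) else 0) +
        (s / 2 * (θ - idealPos hd1 w l 0) ^ 2 +
          1 / (2 * s) * if (idealPos hd1 w l d : ℝ) ≤ Q - n * u then 1 else 0) := by
      refine av_mono fun l _ => ?_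
      have h3 : (idealPos hd1 w l 0 : ℝ) ≤ idealPos hd1 w l d := by
        exact_mod_cast (idealPos_strictMono hd1 w l).monotone (Nat.zero_le d)
      have := sub_le_layers_add hu0 hnu h3 hs
      push_cast
      exact this
    rw [av_sub, av_const hk, av_add, av_mul, av_add, av_const hk, av_sum, av_add, av_mul, av_mul,
      hsq] at h2
    have e1 : ((N : ℝ) - L) ^ 2 / L = 1 / L * ((N : ℝ) - L) ^ 2 := by ring
    have e2 : ((N : ℝ) - L) / k = 1 / k * ((N : ℝ) - L) := by ring
    rw [e1, e2] at h1
    simp only [hf]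
    linarith
  have hid : ExpBdd fun N : ℕ => (N : ℝ) - L := ExpBdd.natCast.sub (ExpBdd.const _)
  have hsqb := expBdd_sub_sq (L : ℝ)
  have hfs : ExpBdd fun N => ∑ R ∈ Finset.range n, f (R + 1) N := ExpBdd.sum fun R _ => hfb _
  have hpe := pe_mono hL'.le (((ExpBdd.const 1).const_mul _).sub ((hid.const_mul _).add
    (((ExpBdd.const 1).add (hsqb.const_mul _)).const_mul _)))
    ((((ExpBdd.const 1).add hfs).const_mul _).add
      ((((hsqb.const_mul _).add (ExpBdd.natCast.const_mul _)).const_mul _).add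
        ((hfb n).const_mul _))) hpt
  rw [pe_sub _ ((ExpBdd.const 1).const_mul _) ((hid.const_mul _).add
      (((ExpBdd.const 1).add (hsqb.const_mul _)).const_mul _)), pe_const_mul, pe_one,
    pe_add _ (hid.const_mul _) (((ExpBdd.const 1).add (hsqb.const_mul _)).const_mul _),
    pe_const_mul, pe_const_mul, pe_add _ (ExpBdd.const 1) (hsqb.const_mul _), pe_one, pe_const_mul,
    pe_sub_sq hL', pe_add _ (((ExpBdd.const 1).add hfs).const_mul _)
      ((((hsqb.const_mul _).add (ExpBdd.natCast.const_mul _)).const_mul _).add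
        ((hfb n).const_mul _)), pe_const_mul, pe_add _ (ExpBdd.const 1) hfs, pe_one,
    pe_sum _ (fun R _ => hfb _),
    pe_add _ (((hsqb.const_mul _).add (ExpBdd.natCast.const_mul _)).const_mul _)
      ((hfb n).const_mul _), pe_const_mul, pe_const_mul,
    pe_add _ (hsqb.const_mul _) (ExpBdd.natCast.const_mul _), pe_const_mul, pe_const_mul,
    pe_sub_sq hL', pe_natCast hL', pe_sub _ ExpBdd.natCast (ExpBdd.const _), pe_natCast hL'] at hpe
  have hc : pe (L : ℝ) (fun _ => (L : ℝ)) = L := by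
    have := pe_const_mul (L : ℝ) (L : ℝ) (fun _ => 1)
    rw [pe_one] at this
    simpa using this
  rw [hc] at hpe
  have hsum : ∑ R ∈ Finset.range n, pe L (f (R + 1)) ≤ 50 := by
    refine (Finset.sum_le_sum fun R hR => htail (R + 1) (Finset.mem_range.1 hR)).trans
      ((sum_exp_le n).trans ?_)
    have := (Real.exp_pos (-(n / 50 : ℝ))).le
    linarith
  have h1 := mul_le_mul_of_nonneg_left hsum hu0
  have h2 := mul_le_mul_of_nonneg_left (htail n le_rfl) (by positivity : 0 ≤ 1 / (2 * s))
  have e1 : (1 / (k : ℝ) ^ 2 * L + (1 / k - 1 / k ^ 2) * L) = θ := by rw [hθ]; ring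
  have e2 : (1 : ℝ) / L * L = 1 := by field_simp
  rw [e1, e2] at hpe
  linarith

theorem mul_exp_div_le (m : ℕ) : m * Real.exp (-((m ^ 2 / 25 : ℕ) / 50 : ℝ)) ≤ 20 := by
  set n := m ^ 2 / 25 with hn
  have h1 : m ^ 2 ≤ 25 * (n + 1) := by omega
  have h2 : (m : ℝ) ^ 2 ≤ 25 * (n + 1) := by exact_mod_cast h1
  have h3 := Real.add_one_le_exp (n / 50 : ℝ)
  rw [Real.exp_neg, ← div_eq_mul_inv, div_le_iff₀ (Real.exp_pos _)]
  nlinarith [sq_nonneg ((m : ℝ) - 20)]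

/-- The edge of the idealized dynamics, from below. -/
theorem le_gen_iterate_of_cube_le {k d L : ℕ} (hd0 : 1 ≤ d) (hd : d + 2 ≤ k) (hdk : d ^ 3 ≤ k)
    (hkL : k ^ 3 ≤ L) {p : ℝ} (hp : 0 < p) (hpd : p ^ 3 = d) :
    (L : ℝ) / k + 2 * √(L / k * d) - (gen k d)^[L] (fun x => (x d : ℝ)) id ≤
      √(L / k * d) * (10244 / p ^ 2 + 6 * √((d : ℝ) ^ 3 / k)) := by
  have hk : 0 < k := by omega
  have hk' : (1 : ℝ) ≤ k := by exact_mod_cast hk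
  have hk0 : (0 : ℝ) < k := by linarith
  have hL : 1 ≤ L := (Nat.one_le_pow _ _ hk).trans hkL
  have hL' : (0 : ℝ) < L := by exact_mod_cast hL
  have hd' : (1 : ℝ) ≤ d := by exact_mod_cast hd0
  have hdk' : (d : ℝ) ^ 3 ≤ k := by exact_mod_cast hdk
  have hkL' : (k : ℝ) ^ 3 ≤ L := by exact_mod_cast hkL
  have hp1 : 1 ≤ p := by
    by_contra h
    have := pow_lt_one₀ hp.le (not_le.1 h) (by norm_num : 3 ≠ 0)
    linarith
  set m := ⌊p⌋₊ with hm
  have hm1 : 1 ≤ m := (Nat.one_le_floor_iff _).2 hp1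
  have hmp : (m : ℝ) ≤ p := Nat.floor_le hp.le
  have hpm : p ≤ 2 * m := by
    have h1 := Nat.lt_floor_add_one p
    have h2 : (1 : ℝ) ≤ m := by exact_mod_cast hm1
    rw [← hm] at h1
    linarith
  have hm0 : (0 : ℝ) < m := by exact_mod_cast hm1
  have hmd : (m : ℝ) ^ 3 ≤ d := by rw [← hpd]; gcongr
  have hmd1 : (m : ℝ) ≤ d := le_trans (by
    have : (1 : ℝ) ≤ m := by exact_mod_cast hm1
    nlinarith [sq_nonneg ((m : ℝ) - 1)]) hmd
  have hkθ : (k : ℝ) ^ 2 ≤ L / k := by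
    rw [le_div_iff₀ hk0]
    calc (k : ℝ) ^ 2 * k = (k : ℝ) ^ 3 := by ring
      _ ≤ (L : ℝ) := hkL'
  have hdθ : (d : ℝ) * m ^ 4 ≤ L / k := by
    calc (d : ℝ) * m ^ 4 = (d : ℝ) * ((m : ℝ) ^ 3 * m) := by ring
      _ ≤ (d : ℝ) * ((d : ℝ) * d) := by gcongr
      _ = (d : ℝ) ^ 3 := by ring
      _ ≤ (k : ℝ) := hdk'
      _ ≤ (k : ℝ) ^ 2 := le_self_pow₀ hk' (by norm_num)
      _ ≤ (L : ℝ) / k := hkθ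
  set θ : ℝ := L / k with hθ
  have hθ0 : 0 < θ := by positivity
  set W := √(θ * d) with hW
  have hW0 : 0 < W := Real.sqrt_pos.2 (by positivity)
  have hW2 : W ^ 2 = θ * d := Real.sq_sqrt (by positivity)
  set s := W / (θ * m ^ 2) with hs
  have hs0 : 0 < s := by positivity
  have h := le_gen_iterate hd0 hd hL hm1 (by exact_mod_cast hmd) hdθ hs0
  rw [← hθ, ← hW] at h
  set q := W / (m : ℝ) ^ 2 with hq
  have hq0 : 0 < q := by positivity
  set e := Real.exp (-((m ^ 2 / 25 : ℕ) / 50 : ℝ)) with he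
  have he0 : 0 < e := Real.exp_pos _
  have t1 : 50 * W / (m : ℝ) ^ 2 = 50 * q := by rw [hq]; ring
  have t2 : s / 2 * θ = q / 2 := by rw [hs, hq]; field_simp
  have t3 : 1 / (2 * s) * e ≤ 10 * q := by
    have e1 : 1 / (2 * s) * e = q * ((m : ℝ) ^ 3 * (m * e) / (2 * d)) := by
      have : θ = W ^ 2 / d := by rw [hW2]; field_simp
      rw [hs, hq, this]
      field_simp
    rw [e1, mul_comm 10]
    refine mul_le_mul_of_nonneg_left ?_ hq0.le
    rw [div_le_iff₀ (by positivity)]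
    calc (m : ℝ) ^ 3 * (m * e) ≤ d * 20 :=
          mul_le_mul hmd (mul_exp_div_le m) (by positivity) (by positivity)
      _ = 10 * (2 * d) := by ring
  have t4 : q ≤ W * (4 / p ^ 2) := by
    rw [hq, div_eq_mul_inv]
    refine mul_le_mul_of_nonneg_left ?_ hW0.le
    rw [inv_eq_one_div, div_le_div_iff₀ (by positivity) (by positivity)]
    have : p ^ 2 ≤ (2 * (m : ℝ)) ^ 2 := pow_le_pow_left₀ hp.le hpm 2
    linarith
  have hWA : W * √((d : ℝ) ^ 3 / k) = d ^ 2 * (√L / k) := by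
    rw [hW, ← Real.sqrt_mul (by positivity), hθ,
      show (L : ℝ) / k * d * (d ^ 3 / k) = L * (d ^ 2 / k) ^ 2 by ring, Real.sqrt_mul hL'.le,
      Real.sqrt_sq (by positivity)]
    ring
  have hkL2 : (k : ℝ) ≤ √L := by
    refine Real.le_sqrt_of_sq_le (le_trans ?_ hkL')
    exact pow_le_pow_right₀ hk' (by norm_num)
  have hd2 : (d : ℝ) ≤ d ^ 2 := le_self_pow₀ hd' (by norm_num)
  have t5 : (d : ℝ) ≤ W * √((d : ℝ) ^ 3 / k) := by
    rw [hWA]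
    have : 1 ≤ √(L : ℝ) / k := by rw [le_div_iff₀ hk0]; linarith
    exact hd2.trans (le_mul_of_one_le_right (sq_nonneg _) this)
  have t6 : √((d : ℝ) / k) * √√L ≤ W * √((d : ℝ) ^ 3 / k) := by
    rw [hWA, ← Real.sqrt_mul (by positivity)]
    refine Real.sqrt_le_iff.2 ⟨by positivity, ?_⟩
    have e1 : (d : ℝ) / k * √L = d * (√L / k) := by ring
    have e2 : ((d : ℝ) ^ 2 * (√L / k)) ^ 2 = d ^ 4 * (√L / k) * (√L / k) := by ring
    have e3 : 1 ≤ √(L : ℝ) / k := by rw [le_div_iff₀ hk0]; linarith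
    have e4 : (d : ℝ) ≤ d ^ 4 := le_self_pow₀ hd' (by norm_num)
    rw [e1, e2]
    have e5 : (0 : ℝ) ≤ √L / k := by positivity
    calc (d : ℝ) * (√L / k) ≤ (d : ℝ) ^ 4 * (√L / k) := mul_le_mul_of_nonneg_right e4 e5
      _ ≤ (d : ℝ) ^ 4 * (√L / k) * (√L / k) := le_mul_of_one_le_right (by positivity) e3
  rw [t1, t2] at h
  have t7 : W * (10244 / p ^ 2 + 6 * √((d : ℝ) ^ 3 / k)) =
    2561 * (W * (4 / p ^ 2)) + 6 * (W * √((d : ℝ) ^ 3 / k)) := by ring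
  rw [t7]
  linarith

theorem sqrt_sq_mul_log_le {k d : ℕ} (hk : 1 ≤ k) (hd0 : 1 ≤ d) {p : ℝ} (hp : 0 < p)
    (hpd : p ^ 3 = d) :
    √((d : ℝ) ^ 2 * (1 + Real.log k) / k) ≤ 19 / p ^ 2 + √((d : ℝ) ^ 3 / k) := by
  have hk' : (1 : ℝ) ≤ k := by exact_mod_cast hk
  have hk0 : (0 : ℝ) < k := by linarith
  have hd' : (1 : ℝ) ≤ d := by exact_mod_cast hd0
  set l := 1 + Real.log k with hl
  have hl1 : 1 ≤ l := by have := Real.log_nonneg hk'; linarith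
  have hp1 : 1 ≤ p := by
    by_contra h
    have := pow_lt_one₀ hp.le (not_le.1 h) (by norm_num : 3 ≠ 0)
    linarith
  rcases le_total l d with h | h
  · have h1 : √((d : ℝ) ^ 2 * l / k) ≤ √((d : ℝ) ^ 3 / k) := by
      refine Real.sqrt_le_sqrt (div_le_div_of_nonneg_right ?_ hk0.le)
      calc (d : ℝ) ^ 2 * l ≤ (d : ℝ) ^ 2 * d := by gcongr
        _ = (d : ℝ) ^ 3 := by ring
    have : 0 ≤ 19 / p ^ 2 := by positivity
    linarith
  · have h1 : √((d : ℝ) ^ 2 * l / k) ≤ 19 / p ^ 2 := by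
      refine Real.sqrt_le_iff.2 ⟨by positivity, ?_⟩
      have h2 : l ^ 5 ≤ 361 * k := by
        have h3 := Real.pow_div_factorial_le_exp l (by linarith) 5
        rw [hl, Real.exp_add, Real.exp_log hk0, ← hl] at h3
        have h4 := Real.exp_one_lt_d9
        have h5 : Real.exp 1 * k ≤ 3 * k := by gcongr; linarith
        have h6 : ((Nat.factorial 5 : ℕ) : ℝ) = 120 := by norm_num [Nat.factorial]
        rw [h6, div_le_iff₀ (by norm_num)] at h3
        linarith
      have h7 : p ^ 4 ≤ l ^ 2 := by
        have : p ^ 2 ≤ d := by rw [← hpd]; exact pow_le_pow_right₀ hp1 (by norm_num)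
        calc p ^ 4 = (p ^ 2) ^ 2 := by ring
          _ ≤ l ^ 2 := pow_le_pow_left₀ (by positivity) (this.trans h) 2
      rw [div_pow, div_le_div_iff₀ hk0 (by positivity)]
      calc (d : ℝ) ^ 2 * l * (p ^ 2) ^ 2 = d ^ 2 * l * p ^ 4 := by ring
        _ ≤ l ^ 2 * l * l ^ 2 := by gcongr
        _ = l ^ 5 := by ring
        _ ≤ 361 * k := h2
        _ = 19 ^ 2 * k := by norm_num
    have : 0 ≤ √((d : ℝ) ^ 3 / k) := Real.sqrt_nonneg _
    linarith

theorem padw_succ_eq {k N : ℕ} (hk : 0 < k) (u : Fin N → Fin k) :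
    (fun i => if h : i < N then (u ⟨i, h⟩ : ℕ) + 1 else 1) =
      fun i => ((padw (⟨0, hk⟩ : Fin k) u i : Fin k) : ℕ) + 1 := by
  funext i
  unfold padw
  split_ifs <;> rfl

theorem Pd_padw {k N L : ℕ} (hk : 0 < k) (d : ℕ) (u : Fin N → Fin k) (v : Fin L → Fin k) :
    Pd d L (fun i => if h : i < N then (u ⟨i, h⟩ : ℕ) + 1 else 1)
        (fun i => if h : i < L then (v ⟨i, h⟩ : ℕ) + 1 else 1) =
      pos (padw (⟨0, hk⟩ : Fin k) u) (hist (padw (⟨0, hk⟩ : Fin k) v) L) d := by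
  have hf : Function.Injective (fun c : Fin k => (c : ℕ) + 1) := fun a b h => by
    simpa [Fin.ext_iff] using h
  rw [Pd_eq_pos, padw_succ_eq hk, padw_succ_eq hk, hist_map (fun c : Fin k => (c : ℕ) + 1),
    pos_map _ hf]

theorem EE_eq_ew {k L : ℕ} (hk : 0 < k) (d : ℕ) :
    EE k (L + d) L (fun w w' => (Pd d L w w' : ℝ) - (Pd 0 L w w' : ℝ)) =
      ew k (L + d) (fun u => av k L (fun l => (pos (padw (⟨0, hk⟩ : Fin k) u) l d : ℝ))) -
        L / k := by
  have h1 : ew k (L + d) (fun _ => (L : ℝ) / k) = L / k := ew_const hk.ne' _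
  rw [← h1, ← ew_sub]
  unfold EE ew
  rw [mul_comm ((k : ℝ) ^ (L + d)), ← div_div, Finset.sum_div]
  congr 1
  refine Finset.sum_congr rfl fun u _ => ?_
  beta_reduce
  rw [← av_pos_zero hk.ne' (padw (⟨0, hk⟩ : Fin k) u), ← av_sub, ← av_hist L (⟨0, hk⟩ : Fin k)]
  simp only [Pd_padw hk]
  rfl

/-- The mean shift `E[P_d(L) - P_0(L)]`. -/
noncomputable def meanShift (k d L : ℕ) : ℝ :=
  EE k (L + d) L (fun w w' => (Pd d L w w' : ℝ) - (Pd 0 L w w' : ℝ))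

theorem meanShift_nonneg {k L : ℕ} (hk : 0 < k) (d : ℕ) : 0 ≤ meanShift k d L := by
  rw [meanShift, EE_eq_ew hk, sub_nonneg, ← ew_const (N := L + d) hk.ne' ((L : ℝ) / k)]
  refine ew_mono fun u => ?_
  rw [← av_pos_zero hk.ne' (padw (⟨0, hk⟩ : Fin k) u)]
  refine av_mono fun l _ => ?_
  exact_mod_cast (pos_strictMono _ l).monotone (Nat.zero_le d)

theorem meanShift_le_of_av_le {k d L : ℕ} (hk : 0 < k) {B : ℝ}
    (hB : ∀ w : ℕ → Fin k, av k L (fun l => (pos w l d : ℝ)) ≤ B) :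
    meanShift k d L ≤ B - L / k := by
  rw [meanShift, EE_eq_ew hk]
  refine sub_le_sub_right ?_ _
  rw [← ew_const (N := L + d) hk.ne' B]
  exact ew_mono fun u => hB _

theorem meanShift_le_add {k L : ℕ} (hk : 0 < k) (d : ℕ) : meanShift k d L ≤ L + d := by
  have h := meanShift_le_of_av_le (d := d) (L := L) (B := L + d) hk fun w => by
    rw [← av_const hk.ne' L ((L : ℝ) + d)]
    refine av_mono fun l hl => ?_
    have := pos_le w l d
    rw [hl] at this
    exact_mod_cast this
  have : (0 : ℝ) ≤ L / k := by positivity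
  linarith

theorem av_pos_le {k : ℕ} (hk : 0 < k) (w : ℕ → Fin k) (L j : ℕ) :
    av k L (fun l => (pos w l j : ℝ)) ≤ j + L / k + 4 * (j + 1) * √(L / k) := by
  have h1 := av_abs_pos_sub_le hk.ne' w L j
  have h2 : av k L (fun l => (pos w l j : ℝ) - (j + L / k)) ≤
      av k L (fun l => |(pos w l j : ℝ) - (j + L / k)|) := av_mono fun l _ => le_abs_self _
  rw [av_sub, av_const hk.ne'] at h2
  linarith

theorem meanShift_le_sqrt {k L : ℕ} (hk : 0 < k) (d : ℕ) :
    meanShift k d L ≤ d + 4 * (d + 1) * √(L / k) := by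
  have := meanShift_le_of_av_le hk fun w => av_pos_le hk w L d
  linarith

theorem abs_meanShift_sub_gen_le {k d L : ℕ} (hd0 : 1 ≤ d) (hdk : 16 * d ^ 2 < k) (hkL : k ^ 3 ≤ L) :
    |meanShift k d L + L / k - (gen k d)^[L] (fun x => (x d : ℝ)) id| ≤
      40 * (√(L / k * d) * √((d : ℝ) ^ 2 * (1 + Real.log k) / k)) := by
  have hk : 0 < k := by omega
  have hdd : d ≤ d ^ 2 := Nat.le_self_pow (by norm_num) d
  have hk1 : (1 : ℝ) ≤ k := by exact_mod_cast hk
  have hk0 : (0 : ℝ) < k := by linarith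
  have hd' : (1 : ℝ) ≤ d := by exact_mod_cast hd0
  have hkL' : (k : ℝ) ^ 3 ≤ L := by exact_mod_cast hkL
  set θ : ℝ := L / k with hθ
  have hkθ : (k : ℝ) ^ 2 ≤ θ := by
    rw [hθ, le_div_iff₀ hk0]
    linarith [show (k : ℝ) ^ 2 * k = (k : ℝ) ^ 3 by ring]
  have hθ0 : 0 < θ := lt_of_lt_of_le (by positivity) hkθ
  set r := √θ with hr
  have hr2 : r ^ 2 = θ := Real.sq_sqrt hθ0.le
  have hkr : (k : ℝ) ≤ r := Real.le_sqrt_of_sq_le hkθ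
  have hdr : 16 * (d : ℝ) ≤ r := by
    have : (16 * d : ℕ) ≤ k := by omega
    have : 16 * (d : ℝ) ≤ k := by exact_mod_cast this
    linarith
  have hB : ∀ w : ℕ → Fin k, ∀ j ≤ d, av k L (fun l => (pos w l j : ℝ)) + 1 ≤ 11 * θ := by
    intro w j hj
    have hj' : (j : ℝ) ≤ d := by exact_mod_cast hj
    have h1 := av_pos_le hk w L j
    rw [← hθ, ← hr] at h1
    have h2 : 4 * ((j : ℝ) + 1) * r ≤ r * r :=
      mul_le_mul_of_nonneg_right (by linarith) (Real.sqrt_nonneg _)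
    nlinarith
  have h := ew_abs_pos_sub_ideal_le (N := L + d) (by omega) le_rfl (⟨0, hk⟩ : Fin k) hB
  rw [meanShift, EE_eq_ew hk, ← hθ, sub_add_cancel]
  refine h.trans ?_
  set l := 1 + Real.log k with hl
  have hH : (harmonic k : ℝ) ≤ l := harmonic_le_one_add_log k
  have hH0 : (0 : ℝ) ≤ harmonic k := by
    have : (0 : ℚ) ≤ harmonic k := by unfold harmonic; positivity
    exact_mod_cast this
  have hl0 : 0 ≤ l := hH0.trans hH
  have e1 : √(2 * d * harmonic k * (11 * θ) / k) ≤ 5 * √(θ * d * l / k) := by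
    refine Real.sqrt_le_iff.2 ⟨by positivity, ?_⟩
    rw [mul_pow, Real.sq_sqrt (by positivity)]
    calc 2 * d * harmonic k * (11 * θ) / k ≤ 2 * d * l * (11 * θ) / k := by gcongr
      _ = 22 * (θ * d * l / k) := by ring
      _ ≤ 5 ^ 2 * (θ * d * l / k) := mul_le_mul_of_nonneg_right (by norm_num) (by positivity)
  have e2 : √(θ * d) * √((d : ℝ) ^ 2 * l / k) = d * √(θ * d * l / k) := by
    rw [← Real.sqrt_mul (by positivity),
      show θ * d * ((d : ℝ) ^ 2 * l / k) = d ^ 2 * (θ * d * l / k) by ring,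
      Real.sqrt_mul (by positivity), Real.sqrt_sq (by positivity)]
  rw [e2]
  calc 4 * ((d : ℝ) + 1) * √(2 * d * harmonic k * (11 * θ) / k)
      ≤ (8 * d) * (5 * √(θ * d * l / k)) :=
        mul_le_mul (by linarith) e1 (Real.sqrt_nonneg _) (by positivity)
    _ = 40 * (d * √(θ * d * l / k)) := by ring

theorem sqrt_mul_sqrt_cube {k d L : ℕ} :
    √((L : ℝ) / k * d) * √((d : ℝ) ^ 3 / k) = d ^ 2 * (√L / k) := by
  rw [← Real.sqrt_mul (by positivity),
    show (L : ℝ) / k * d * (d ^ 3 / k) = L * (d ^ 2 / k) ^ 2 by ring, Real.sqrt_mul (by positivity),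
    Real.sqrt_sq (by positivity)]
  ring

theorem abs_meanShift_sub_le_of_cube_le {k d L : ℕ} (hk : 0 < k) (hd0 : 1 ≤ d) (hkL : k ^ 3 ≤ L)
    {p : ℝ} (hp : 0 < p) (hpd : p ^ 3 = d) :
    |meanShift k d L - 2 * √(L / k * d)| ≤
      √(L / k * d) * (12000 * (1 / p ^ 2 + √((d : ℝ) ^ 3 / k))) := by
  have hk1 : (1 : ℝ) ≤ k := by exact_mod_cast hk
  have hk0 : (0 : ℝ) < k := by linarith
  have hd' : (1 : ℝ) ≤ d := by exact_mod_cast hd0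
  have hkL' : (k : ℝ) ^ 3 ≤ L := by exact_mod_cast hkL
  have hWA := sqrt_mul_sqrt_cube (k := k) (d := d) (L := L)
  have hkL2 : (k : ℝ) ≤ √L := by
    refine Real.le_sqrt_of_sq_le (le_trans ?_ hkL')
    exact pow_le_pow_right₀ hk1 (by norm_num)
  have hrk : 1 ≤ √(L : ℝ) / k := by rw [le_div_iff₀ hk0]; linarith
  set W := √((L : ℝ) / k * d) with hW
  set A := √((d : ℝ) ^ 3 / k) with hA
  have hW0 : 0 ≤ W := Real.sqrt_nonneg _
  have hA0 : 0 ≤ A := Real.sqrt_nonneg _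
  have hWA0 : 0 ≤ W * A := by positivity
  have hWp : 0 ≤ W * (1 / p ^ 2) := by positivity
  have hD0 := meanShift_nonneg (L := L) hk d
  have hdWA : (d : ℝ) ≤ W * A := by
    rw [hWA]
    exact (le_self_pow₀ hd' (by norm_num)).trans (le_mul_of_one_le_right (sq_nonneg _) hrk)
  have hsplit : W * (12000 * (1 / p ^ 2 + A)) = 12000 * (W * (1 / p ^ 2)) + 12000 * (W * A) := by
    ring
  rw [hsplit]
  rcases lt_or_ge (16 * d ^ 2) k with h | h
  · have hdd : d ≤ d ^ 2 := Nat.le_self_pow (by norm_num) d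
    have hc := abs_meanShift_sub_gen_le hd0 h hkL
    have hlog := mul_le_mul_of_nonneg_left (sqrt_sq_mul_log_le hk hd0 hp hpd) hW0
    rw [← hA] at hlog
    rw [← hW] at hc
    have e1 : W * (19 / p ^ 2 + A) = 19 * (W * (1 / p ^ 2)) + W * A := by ring
    rw [e1] at hlog
    obtain ⟨c1, c2⟩ := abs_le.1 hc
    rw [abs_le]
    constructor
    · rcases le_total (d ^ 3) k with h3 | h3
      · have hg := le_gen_iterate_of_cube_le hd0 (by omega) h3 hkL hp hpd
        rw [← hW, ← hA] at hg
        have e2 : W * (10244 / p ^ 2 + 6 * A) = 10244 * (W * (1 / p ^ 2)) + 6 * (W * A) := by ring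
        rw [e2] at hg
        linarith
      · have h3' : (k : ℝ) ≤ (d : ℝ) ^ 3 := by exact_mod_cast h3
        have hA1 : 1 ≤ A := by
          refine Real.one_le_sqrt.2 ?_
          rwa [one_le_div hk0]
        have : W ≤ W * A := le_mul_of_one_le_right hW0 hA1
        linarith
    · have hg := gen_iterate_le_sqrt hd0 (show d + 2 ≤ k by omega) L
      have e3 : (d : ℝ) * L / k = L / k * d := by ring
      rw [e3, ← hW] at hg
      linarith
  · have h' : (k : ℝ) ≤ 16 * (d : ℝ) ^ 2 := by exact_mod_cast h
    have hA4 : √(d : ℝ) ≤ 4 * A := by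
      refine Real.sqrt_le_iff.2 ⟨by positivity, ?_⟩
      rw [mul_pow, hA, Real.sq_sqrt (by positivity), ← mul_div_assoc, le_div_iff₀ hk0]
      calc (d : ℝ) * k ≤ d * (16 * (d : ℝ) ^ 2) := by gcongr
        _ = 4 ^ 2 * (d : ℝ) ^ 3 := by ring
    have hs1 : 1 ≤ √(d : ℝ) := Real.one_le_sqrt.2 hd'
    have hdr : (d : ℝ) * √((L : ℝ) / k) = W * √(d : ℝ) := by
      rw [hW, Real.sqrt_mul (by positivity), mul_assoc, Real.mul_self_sqrt (by positivity), mul_comm]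
    have h1 : W * √(d : ℝ) ≤ 4 * (W * A) := by
      have := mul_le_mul_of_nonneg_left hA4 hW0
      linarith
    have h2 : W ≤ W * √(d : ℝ) := le_mul_of_one_le_right hW0 hs1
    have h3 := meanShift_le_sqrt (L := L) hk d
    have h4 : 4 * ((d : ℝ) + 1) * √((L : ℝ) / k) ≤ 8 * (d * √((L : ℝ) / k)) := by
      have := mul_le_mul_of_nonneg_right hd' (Real.sqrt_nonneg ((L : ℝ) / k))
      linarith
    rw [abs_le]
    constructor <;> linarith

theorem abs_meanShift_sub_le_of_lt_cube {k d L : ℕ} (hk : 0 < k) (hd0 : 1 ≤ d) (hL : 1 ≤ L)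
    (hkL : L < k ^ 3) :
    |meanShift k d L - 2 * √(L / k * d)| ≤
      √(L / k * d) * (12 * (√k * √((d : ℝ) ^ 3) * √((L : ℝ) ^ 3) *
        Real.exp (-(√L * (√((k : ℝ) ^ 3))⁻¹)))) := by
  have hk1 : (1 : ℝ) ≤ k := by exact_mod_cast hk
  have hk0 : (0 : ℝ) < k := by linarith
  have hd' : (1 : ℝ) ≤ d := by exact_mod_cast hd0
  have hL' : (1 : ℝ) ≤ L := by exact_mod_cast hL
  have hkL' : (L : ℝ) < (k : ℝ) ^ 3 := by exact_mod_cast hkL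
  set W := √((L : ℝ) / k * d) with hW
  have hW0 : 0 ≤ W := Real.sqrt_nonneg _
  have h1 : W * (√k * √((d : ℝ) ^ 3) * √((L : ℝ) ^ 3)) = d ^ 2 * L ^ 2 := by
    rw [hW, ← Real.sqrt_mul (by positivity), ← Real.sqrt_mul (by positivity),
      ← Real.sqrt_mul (by positivity),
      show (L : ℝ) / k * d * (k * (d : ℝ) ^ 3 * (L : ℝ) ^ 3) = ((d : ℝ) ^ 2 * L ^ 2) ^ 2 by
        field_simp,
      Real.sqrt_sq (by positivity)]
  have h2 : (1 : ℝ) / 3 ≤ Real.exp (-(√L * (√((k : ℝ) ^ 3))⁻¹)) := by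
    have h3 : √L * (√((k : ℝ) ^ 3))⁻¹ ≤ 1 := by
      rw [← div_eq_mul_inv, div_le_one (Real.sqrt_pos.2 (by positivity))]
      exact Real.sqrt_le_sqrt hkL'.le
    have h4 : (1 : ℝ) / 3 ≤ Real.exp (-1) := by
      rw [Real.exp_neg, ← one_div]
      exact one_div_le_one_div_of_le (Real.exp_pos _) (by linarith [Real.exp_one_lt_d9])
    exact h4.trans (Real.exp_le_exp.2 (by linarith))
  have hdL : (d : ℝ) * L ≤ d ^ 2 * L ^ 2 := by
    rw [← mul_pow]
    exact le_self_pow₀ (one_le_mul_of_one_le_of_one_le hd' hL') (by norm_num)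
  have hWL : W ≤ d * L := by
    refine Real.sqrt_le_iff.2 ⟨by positivity, ?_⟩
    calc (L : ℝ) / k * d ≤ L * d := by gcongr; exact div_le_self (by positivity) hk1
      _ = d * L := mul_comm _ _
      _ ≤ d ^ 2 * L ^ 2 := hdL
      _ = (d * L) ^ 2 := by ring
  have hL1 : (L : ℝ) ≤ d * L := le_mul_of_one_le_left (by positivity) hd'
  have hd1 : (d : ℝ) ≤ d * L := le_mul_of_one_le_right (by positivity) hL'
  have h5 := meanShift_le_add (L := L) hk d
  have h6 := meanShift_nonneg (L := L) hk d
  have h7 : 4 * ((d : ℝ) ^ 2 * L ^ 2) ≤ W * (12 * (√k * √((d : ℝ) ^ 3) * √((L : ℝ) ^ 3) *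
        Real.exp (-(√L * (√((k : ℝ) ^ 3))⁻¹)))) := by
    have := mul_le_mul_of_nonneg_left h2 (show (0 : ℝ) ≤ d ^ 2 * L ^ 2 by positivity)
    calc 4 * ((d : ℝ) ^ 2 * L ^ 2) = 12 * (d ^ 2 * L ^ 2 * (1 / 3)) := by ring
      _ ≤ 12 * (d ^ 2 * L ^ 2 * Real.exp (-(√L * (√((k : ℝ) ^ 3))⁻¹))) := by linarith
      _ = _ := by rw [← h1]; ring
  refine le_trans ?_ h7
  rw [abs_le]
  constructor <;> linarith

theorem rpow_three_halves {x : ℝ} (hx : 0 ≤ x) : x ^ ((3 : ℝ) / 2) = √(x ^ 3) := by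
  rw [Real.sqrt_eq_rpow, ← Real.rpow_natCast, ← Real.rpow_mul hx]
  norm_num

theorem rpow_neg_three_halves {x : ℝ} (hx : 0 ≤ x) : x ^ (-(3 : ℝ) / 2) = (√(x ^ 3))⁻¹ := by
  rw [← rpow_three_halves hx, ← Real.rpow_neg hx, neg_div]

theorem rpow_neg_half {x : ℝ} (hx : 0 ≤ x) : x ^ (-(1 : ℝ) / 2) = (√x)⁻¹ := by
  rw [Real.sqrt_eq_rpow, ← Real.rpow_neg hx, neg_div]

theorem rpow_neg_two_thirds {x : ℝ} (hx : 0 ≤ x) :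
    x ^ (-(2 : ℝ) / 3) = 1 / (x ^ ((1 : ℝ) / 3)) ^ 2 := by
  rw [← Real.rpow_natCast, ← Real.rpow_mul hx, one_div, ← Real.rpow_neg hx]
  norm_num

/-- There exists an absolute constant `C > 0` such that for all integers
`k ≥ 2`, `d ≥ 1` and `L ≥ 1`,
`|E[P_d(L) − P_0(L)] − 2√(dL/k)| ≤ 2√(dL/k) · C · (d^{-2/3} + (log L)(dk/L)^{1/2}
  + d^{3/2} k^{-1/2} + k^{1/2} d^{3/2} L^{3/2} exp(−L^{1/2} k^{-3/2}))`. -/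
theorem stmt4 :
    ∃ C : ℝ, 0 < C ∧
      ∀ k d L : ℕ, 2 ≤ k → 1 ≤ d → 1 ≤ L →
        |EE k (L + d) L (fun w w' => (Pd d L w w' : ℝ) - (Pd 0 L w w' : ℝ)) -
            2 * Real.sqrt (d * L / k)| ≤
          2 * Real.sqrt (d * L / k) * C *
            ((d : ℝ) ^ (-(2 : ℝ) / 3) + Real.log L * Real.sqrt (d * k / L) +
              (d : ℝ) ^ ((3 : ℝ) / 2) * (k : ℝ) ^ (-(1 : ℝ) / 2) +
              (k : ℝ) ^ ((1 : ℝ) / 2) * (d : ℝ) ^ ((3 : ℝ) / 2) * (L : ℝ) ^ ((3 : ℝ) / 2) *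
                Real.exp (-((L : ℝ) ^ ((1 : ℝ) / 2) * (k : ℝ) ^ (-(3 : ℝ) / 2)))) := by
  refine ⟨6000, by norm_num, fun k d L hk hd hL => ?_⟩
  have hk0 : 0 < k := by omega
  have hd0 : (0 : ℝ) < d := by exact_mod_cast hd
  have hp : 0 < (d : ℝ) ^ ((1 : ℝ) / 3) := Real.rpow_pos_of_pos hd0 _
  have hpd : ((d : ℝ) ^ ((1 : ℝ) / 3)) ^ 3 = d := by
    rw [← Real.rpow_natCast, ← Real.rpow_mul hd0.le]
    norm_num
  have hlog : 0 ≤ Real.log L * √(d * k / L) :=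
    mul_nonneg (Real.log_nonneg (by exact_mod_cast hL)) (Real.sqrt_nonneg _)
  rw [rpow_three_halves hd0.le, rpow_three_halves L.cast_nonneg,
    rpow_neg_three_halves k.cast_nonneg, rpow_neg_half k.cast_nonneg, rpow_neg_two_thirds hd0.le,
    ← Real.sqrt_eq_rpow, ← Real.sqrt_eq_rpow, ← div_eq_mul_inv, ← Real.sqrt_div' _ k.cast_nonneg,
    show (d : ℝ) * L / k = L / k * d by ring]
  set p := (d : ℝ) ^ ((1 : ℝ) / 3)
  have hp2 : 0 ≤ 1 / p ^ 2 := by positivity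
  have hA : 0 ≤ √((d : ℝ) ^ 3 / k) := Real.sqrt_nonneg _
  have hT : 0 ≤ √k * √((d : ℝ) ^ 3) * √((L : ℝ) ^ 3) *
      Real.exp (-(√L * (√((k : ℝ) ^ 3))⁻¹)) := by positivity
  rw [show ∀ x y : ℝ, 2 * x * 6000 * y = x * (12000 * y) by intros; ring]
  rcases le_or_gt (k ^ 3) L with h | h
  · refine (abs_meanShift_sub_le_of_cube_le hk0 hd h hp hpd).trans ?_
    exact mul_le_mul_of_nonneg_left (by linarith) (Real.sqrt_nonneg _)
  · refine (abs_meanShift_sub_le_of_lt_cube hk0 hd hL h).trans ?_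
    exact mul_le_mul_of_nonneg_left (by linarith) (Real.sqrt_nonneg _)
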